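/- Let G be a finite group whose character graph Δ(G) is K₄-free with exactly seven vertices, and let M be a normal subgroup of G with R(G) < M such that S := M/R(G) ≅ PSL₂(2^f) for some integer f ≥ 2, the centralizer of M/R(G) in G/R(G) is trivial, the complement of the induced subgraph of Δ(G) on π(S) is not bipartite, and every vertex set of an odd cycle in the complement of Δ(G) is contained in π(S). Then it is impossible that one of |π(2^f − 1)|, |π(2^f + 1)| equals 1 while the other equals 2 (i.e. Δ(S) is not isomorphic to K₁ ∪ K₁ ∪ K₂). -/

import Mathlib

open CategoryTheory

/-- `cd(G)`: the set of character degrees of `G`, i.e. the dimensions of the simple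
finite-dimensional complex representations of `G`. -/
def charDegrees (G : Type) [Group G] : Set ℕ :=
  { n | ∃ V : FDRep ℂ G, Simple V ∧ Module.finrank ℂ V = n }

/-- `ρ(G)`: the set of primes dividing some character degree of `G`. -/
def charPrimes (G : Type) [Group G] : Set ℕ :=
  { p | p.Prime ∧ ∃ n ∈ charDegrees G, p ∣ n }

/-- The character graph `Δ(G)`, on vertex set `ρ(G)`: two distinct primes `p`, `q`
are adjacent iff `p * q` divides some character degree of `G`. -/
def charGraph (G : Type) [Group G] : SimpleGraph (charPrimes G) where
  Adj p q := (p : ℕ) ≠ (q : ℕ) ∧ ∃ n ∈ charDegrees G, (p : ℕ) * (q : ℕ) ∣ n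
  symm := by
    constructor
    rintro p q ⟨h, n, hn, hd⟩
    exact ⟨fun e => h e.symm, n, hn, by rwa [mul_comm]⟩
  loopless := by constructor; rintro p ⟨h, -⟩; exact h rfl

/-- The solvable radical `R(G)` of `G`: the largest solvable normal subgroup of `G`
(realized as the join of all solvable normal subgroups). -/
def solvableRadical (G : Type*) [Group G] : Subgroup G :=
  ⨆ N : { N : Subgroup G // N.Normal ∧ IsSolvable ↥N }, (N : Subgroup G)

instance solvableRadical_normal (G : Type*) [Group G] : (solvableRadical G).Normal := by
  constructor
  intro n hn g
  refine Subgroup.iSup_induction (C := fun x => g * x * g⁻¹ ∈ solvableRadical G)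
    (fun N : { N : Subgroup G // N.Normal ∧ IsSolvable ↥N } => (N : Subgroup G)) hn ?_ ?_ ?_
  · intro N x hx
    exact Subgroup.mem_iSup_of_mem N (N.2.1.conj_mem x hx g)
  · simpa using Subgroup.one_mem _
  · intro x y hx hy
    have h : g * (x * y) * g⁻¹ = (g * x * g⁻¹) * (g * y * g⁻¹) := by group
    rw [h]; exact Subgroup.mul_mem _ hx hy

/-- `PSL₂(F)`: the special linear group `SL₂(F)` modulo its center. -/
abbrev PSL2 (F : Type) [Field F] :=
  Matrix.SpecialLinearGroup (Fin 2) F ⧸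
    Subgroup.center (Matrix.SpecialLinearGroup (Fin 2) F)

/-- The join `Γ ⋆ Δ` of two simple graphs: the disjoint union together with all
edges between the two vertex sets. -/
def graphJoin {α β : Type*} (G : SimpleGraph α) (H : SimpleGraph β) :
    SimpleGraph (α ⊕ β) :=
  (G ⊕g H) ⊔
    { Adj := fun u v => u.isLeft ≠ v.isLeft
      symm := ⟨fun _ _ h => h.symm⟩
      loopless := ⟨fun _ h => h rfl⟩ }

/-- The image of a subgroup `M` of `G` in `G/R(G)`; when `R(G) ≤ M` this is `M/R(G)`. -/
def radicalQuotImage {G : Type*} [Group G] (M : Subgroup G) :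
    Subgroup (G ⧸ solvableRadical G) :=
  M.map (QuotientGroup.mk' (solvableRadical G))


section
open CategoryTheory

section PRepBasic

def Irr {ι E : Type} [AddCommGroup E] [Module ℂ E] (ρ : ι → E →ₗ[ℂ] E) : Prop :=
  Nontrivial E ∧ ∀ U : Submodule ℂ E, (∀ i, ∀ v ∈ U, ρ i v ∈ U) → U = ⊥ ∨ U = ⊤

structure PRep {K : Type} [Group K] (α : K → K → ℂ) {E : Type} [AddCommGroup E] [Module ℂ E]
    (ρ : K → E →ₗ[ℂ] E) : Prop where
  ne : ∀ s t, α s t ≠ 0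
  one : ρ 1 = 1
  mul : ∀ s t, ρ s * ρ t = α s t • ρ (s * t)

/-- Schur: an operator commuting with an irreducible family is scalar. -/
theorem Irr.scalar {ι E : Type} [AddCommGroup E] [Module ℂ E] [FiniteDimensional ℂ E]
    {ρ : ι → E →ₗ[ℂ] E} (h : Irr ρ) (X : E →ₗ[ℂ] E) (hX : ∀ i, X * ρ i = ρ i * X) :
    ∃ c : ℂ, X = c • 1 := by
  have := h.1
  obtain ⟨c, hc⟩ := Module.End.exists_eigenvalue X
  refine ⟨c, ?_⟩
  have := h.2 (Module.End.eigenspace X c) (by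
    intro i v hv
    rw [Module.End.mem_eigenspace_iff] at hv ⊢
    have := LinearMap.congr_fun (hX i) v
    simp only [Module.End.mul_apply] at this
    rw [this, hv, map_smul])
  rcases this with h0 | h1
  · exact absurd h0 hc
  · ext v
    have : v ∈ Module.End.eigenspace X c := h1 ▸ Submodule.mem_top
    simpa using Module.End.mem_eigenspace_iff.1 this

theorem Irr.bij {ι E E' : Type} [AddCommGroup E] [Module ℂ E] [AddCommGroup E'] [Module ℂ E']
    {ρ : ι → E →ₗ[ℂ] E} {ρ' : ι → E' →ₗ[ℂ] E'} (h : Irr ρ) (h' : Irr ρ')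
    (X : E →ₗ[ℂ] E') (hX : ∀ i v, X (ρ i v) = ρ' i (X v)) (h0 : X ≠ 0) :
    Function.Bijective X := by
  constructor
  · rw [← LinearMap.ker_eq_bot]
    refine (h.2 (LinearMap.ker X) (fun i v hv => ?_)).resolve_right ?_
    · rw [LinearMap.mem_ker] at hv ⊢; rw [hX, hv, map_zero]
    · rwa [LinearMap.ker_eq_top]
  · rw [← LinearMap.range_eq_top]
    refine (h'.2 (LinearMap.range X) (fun i v hv => ?_)).resolve_left ?_
    · obtain ⟨u, rfl⟩ := hv; exact ⟨ρ i u, hX i u⟩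
    · rwa [LinearMap.range_eq_bot]

theorem Irr.inj {ι E E' : Type} [AddCommGroup E] [Module ℂ E] [AddCommGroup E'] [Module ℂ E']
    {ρ : ι → E →ₗ[ℂ] E} {ρ' : ι → E' →ₗ[ℂ] E'} (h : Irr ρ)
    (X : E →ₗ[ℂ] E') (hX : ∀ i v, X (ρ i v) = ρ' i (X v)) (h0 : X ≠ 0) :
    Function.Injective X := by
  rw [← LinearMap.ker_eq_bot]
  refine (h.2 (LinearMap.ker X) (fun i v hv => ?_)).resolve_right ?_
  · rw [LinearMap.mem_ker] at hv ⊢; rw [hX, hv, map_zero]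
  · rwa [LinearMap.ker_eq_top]

variable {K : Type} [Group K] {α : K → K → ℂ} {E : Type} [AddCommGroup E] [Module ℂ E]
  {ρ : K → E →ₗ[ℂ] E} {E' : Type} [AddCommGroup E'] [Module ℂ E'] {ρ' : K → E' →ₗ[ℂ] E'}

/-- inverse operators -/
noncomputable def pinv (α : K → K → ℂ) (ρ : K → E →ₗ[ℂ] E) (g : K) : E →ₗ[ℂ] E :=
  (α g g⁻¹)⁻¹ • ρ g⁻¹

theorem PRep.mul_pinv (h : PRep α ρ) (g : K) : ρ g * pinv α ρ g = 1 := by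
  rw [pinv, mul_smul_comm, h.mul, smul_smul, inv_mul_cancel₀ (h.ne _ _), mul_inv_cancel, h.one,
    one_smul]

theorem PRep.pinv_mul (h : PRep α ρ) (g : K) : pinv α ρ g * ρ g = 1 := by
  have h2 : ρ g⁻¹ * ρ g = α g⁻¹ g • 1 := by rw [h.mul, inv_mul_cancel, h.one]
  have h3 : ρ g⁻¹ = (α g⁻¹ g) • pinv α ρ g := by
    calc ρ g⁻¹ = ρ g⁻¹ * (ρ g * pinv α ρ g) := by rw [h.mul_pinv, mul_one]
      _ = _ := by rw [← mul_assoc, h2, smul_mul_assoc, one_mul]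
  have : (α g⁻¹ g) • (pinv α ρ g * ρ g) = (α g⁻¹ g) • 1 := by
    rw [← smul_mul_assoc, ← h3, h2]
  exact smul_right_injective _ (h.ne g⁻¹ g) this

theorem PRep.pinv_mul_pinv (h : PRep α ρ) (s t : K) :
    pinv α ρ t * pinv α ρ s = (α s t)⁻¹ • pinv α ρ (s * t) := by
  have h1 : ρ (s*t) = (α s t)⁻¹ • (ρ s * ρ t) := by
    rw [h.mul, smul_smul, inv_mul_cancel₀ (h.ne _ _), one_smul]
  calc pinv α ρ t * pinv α ρ s
      = (pinv α ρ t * pinv α ρ s) * (ρ (s*t) * pinv α ρ (s*t)) := by rw [h.mul_pinv, mul_one]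
    _ = (α s t)⁻¹ • ((pinv α ρ t * (pinv α ρ s * ρ s) * ρ t) * pinv α ρ (s*t)) := by
        rw [h1]; simp only [smul_mul_assoc, mul_smul_comm, mul_assoc]
    _ = _ := by rw [h.pinv_mul, mul_one, h.pinv_mul, one_mul]

theorem PRep.inj (h : PRep α ρ) (g : K) : Function.Injective (ρ g) := by
  intro v w hvw
  have := congrArg (pinv α ρ g) hvw
  simpa [← Module.End.mul_apply, h.pinv_mul] using this

noncomputable def avg [Fintype K] (α : K → K → ℂ) (ρ : K → E →ₗ[ℂ] E) (ρ' : K → E' →ₗ[ℂ] E')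
    (X : E →ₗ[ℂ] E') : E →ₗ[ℂ] E' := ∑ g, ρ' g ∘ₗ X ∘ₗ pinv α ρ g

theorem avg_comm [Fintype K] (h : PRep α ρ) (h' : PRep α ρ') (X : E →ₗ[ℂ] E') (s : K) :
    ρ' s ∘ₗ avg α ρ ρ' X = avg α ρ ρ' X ∘ₗ ρ s := by
  have key : ρ' s ∘ₗ avg α ρ ρ' X ∘ₗ pinv α ρ s = avg α ρ ρ' X := by
    unfold avg
    have e0 : ρ' s ∘ₗ (∑ g, ρ' g ∘ₗ X ∘ₗ pinv α ρ g) ∘ₗ pinv α ρ s =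
        ∑ g, ρ' s ∘ₗ (ρ' g ∘ₗ X ∘ₗ pinv α ρ g) ∘ₗ pinv α ρ s := by
      ext v; simp
    rw [e0]
    refine Fintype.sum_equiv (Equiv.mulLeft s) _ _ (fun g => ?_)
    have e1 : ρ' s ∘ₗ ρ' g = α s g • ρ' (s * g) := h'.mul s g
    have e2 : pinv α ρ g ∘ₗ pinv α ρ s = (α s g)⁻¹ • pinv α ρ (s * g) := h.pinv_mul_pinv s g
    calc ρ' s ∘ₗ (ρ' g ∘ₗ X ∘ₗ pinv α ρ g) ∘ₗ pinv α ρ s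
        = (ρ' s ∘ₗ ρ' g) ∘ₗ X ∘ₗ (pinv α ρ g ∘ₗ pinv α ρ s) := by
          simp only [LinearMap.comp_assoc]
      _ = _ := by
          rw [e1, e2, LinearMap.comp_smul, LinearMap.comp_smul, LinearMap.smul_comp, smul_smul,
            inv_mul_cancel₀ (h.ne _ _), one_smul]; rfl
  have e3 : pinv α ρ s ∘ₗ ρ s = 1 := h.pinv_mul s
  calc ρ' s ∘ₗ avg α ρ ρ' X = (ρ' s ∘ₗ avg α ρ ρ' X ∘ₗ pinv α ρ s) ∘ₗ ρ s := by
        rw [LinearMap.comp_assoc, LinearMap.comp_assoc, e3]; rfl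
    _ = _ := by rw [key]

/-- restriction to an invariant subspace -/
noncomputable def presub (ρ : K → E →ₗ[ℂ] E) (U : Submodule ℂ E)
    (hU : ∀ g, ∀ v ∈ U, ρ g v ∈ U) (g : K) : U →ₗ[ℂ] U := (ρ g).restrict (hU g)

theorem PRep.sub (h : PRep α ρ) (U : Submodule ℂ E) (hU : ∀ g, ∀ v ∈ U, ρ g v ∈ U) :
    PRep α (presub ρ U hU) := by
  refine ⟨h.ne, ?_, ?_⟩
  · ext v; simp [presub, h.one]
  · intro s t; ext v
    have := LinearMap.congr_fun (h.mul s t) v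
    simpa [presub] using this

/-- Maschke -/
theorem PRep.maschke [Fintype K] (h : PRep α ρ) (U : Submodule ℂ E)
    (hU : ∀ g, ∀ v ∈ U, ρ g v ∈ U) :
    ∃ Q : E →ₗ[ℂ] E, (∀ g v, Q (ρ g v) = ρ g (Q v)) ∧ (∀ v, Q v ∈ U) ∧ ∀ v ∈ U, Q v = v := by
  obtain ⟨r, hr⟩ := LinearMap.exists_leftInverse_of_injective U.subtype (by simp)
  have hK : (Fintype.card K : ℂ) ≠ 0 := by simp
  have hmem : ∀ g v, ρ g (U.subtype (r (pinv α ρ g v))) ∈ U := fun g v => hU _ _ (r _).2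
  refine ⟨(Fintype.card K : ℂ)⁻¹ • avg α ρ ρ (U.subtype ∘ₗ r), ?_, ?_, ?_⟩
  · intro g v
    have := LinearMap.congr_fun (avg_comm h h (U.subtype ∘ₗ r) g) v
    simp only [LinearMap.comp_apply] at this
    simp only [LinearMap.smul_apply, map_smul, this]
  · intro v
    simp only [LinearMap.smul_apply, avg, LinearMap.sum_apply]
    exact U.smul_mem _ (U.sum_mem fun g _ => hmem g v)
  · intro v hv
    simp only [LinearMap.smul_apply, avg, LinearMap.sum_apply]
    have : ∀ g ∈ Finset.univ, (ρ g ∘ₗ (U.subtype ∘ₗ r) ∘ₗ pinv α ρ g) v = v := by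
      intro g _
      have h1 : pinv α ρ g v ∈ U := U.smul_mem _ (hU _ _ hv)
      have h2 := LinearMap.congr_fun hr ⟨_, h1⟩
      simp only [LinearMap.comp_apply, Submodule.subtype_apply, LinearMap.id_apply] at h2 ⊢
      rw [h2, ← Module.End.mul_apply, h.mul_pinv, Module.End.one_apply]
    rw [Finset.sum_congr rfl this]
    simp [Finset.card_univ, ← Nat.cast_smul_eq_nsmul ℂ, smul_smul, hK]

theorem PRep.exists_irr [Fintype K] : ∀ (n : ℕ) {E : Type} [AddCommGroup E] [Module ℂ E]
    [FiniteDimensional ℂ E] {ρ : K → E →ₗ[ℂ] E} (_ : PRep α ρ) (_ : Module.finrank ℂ E = n)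
    (v : E) (_ : v ≠ 0),
    ∃ (E' : Type) (_ : AddCommGroup E') (_ : Module ℂ E') (_ : FiniteDimensional ℂ E')
      (ρ' : K → E' →ₗ[ℂ] E') (p : E →ₗ[ℂ] E'), PRep α ρ' ∧ Irr ρ' ∧
      (∀ g w, p (ρ g w) = ρ' g (p w)) ∧ p v ≠ 0 := by
  intro n
  induction n using Nat.strong_induction_on with
  | _ n ih =>
  intro E _ _ _ ρ h hn v hv
  by_cases hirr : Irr ρ
  · exact ⟨E, _, _, inferInstance, ρ, LinearMap.id, h, hirr, fun _ _ => rfl, hv⟩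
  have hnt : Nontrivial E := ⟨v, 0, hv⟩
  simp only [Irr, hnt, true_and, not_forall, not_or] at hirr
  obtain ⟨U, hU, hb, ht⟩ := hirr
  obtain ⟨Q, hQ1, hQ2, hQ3⟩ := h.maschke U hU
  by_cases hQv : Q v = 0
  · have hk : ∀ g, ∀ w ∈ LinearMap.ker Q, ρ g w ∈ LinearMap.ker Q := by
      intro g w hw; rw [LinearMap.mem_ker] at hw ⊢; rw [hQ1, hw, map_zero]
    have hlt : Module.finrank ℂ (LinearMap.ker Q) < n := by
      rw [← hn]
      apply Submodule.finrank_lt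
      intro hk
      apply hb
      rw [eq_bot_iff]
      intro u hu
      have : u ∈ LinearMap.ker Q := hk ▸ Submodule.mem_top
      rw [LinearMap.mem_ker, hQ3 u hu] at this
      simpa using this
    obtain ⟨E', i1, i2, i3, ρ', p, a, b, c, d⟩ := ih _ hlt (h.sub _ hk) rfl ⟨v, hQv⟩
      (by simpa [Subtype.ext_iff] using hv)
    have hc : ∀ w, (1 - Q) w ∈ LinearMap.ker Q := by
      intro w; simp [LinearMap.mem_ker, hQ3 _ (hQ2 w)]
    refine ⟨E', i1, i2, i3, ρ', p ∘ₗ (LinearMap.codRestrict _ (1 - Q) hc), a, b, ?_, ?_⟩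
    · intro g w
      rw [LinearMap.comp_apply, LinearMap.comp_apply, ← c]
      congr 1
      ext
      simp [presub, hQ1]
    · have e : (LinearMap.codRestrict _ (1 - Q) hc) v = ⟨v, hQv⟩ := by ext; simp [hQv]
      rw [LinearMap.comp_apply, e]; exact d
  · have hlt : Module.finrank ℂ U < n := by
      rw [← hn]; exact Submodule.finrank_lt ht
    obtain ⟨E', i1, i2, i3, ρ', p, a, b, c, d⟩ := ih _ hlt (h.sub _ hU) rfl ⟨Q v, hQ2 v⟩
      (by simpa [Subtype.ext_iff] using hQv)
    refine ⟨E', i1, i2, i3, ρ', p ∘ₗ (LinearMap.codRestrict _ Q hQ2), a, b, ?_, ?_⟩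
    · intro g w
      rw [LinearMap.comp_apply, LinearMap.comp_apply, ← c]
      congr 1
      ext
      simp [presub, hQ1]
    · exact d

/-- Schur orthogonality, vanishing version -/
theorem schur_zero [Fintype K] [FiniteDimensional ℂ E]
    (hav : ∀ X : E →ₗ[ℂ] E', avg α ρ ρ' X = 0) (X : E →ₗ[ℂ] E) :
    ∑ g, LinearMap.trace ℂ E (X * pinv α ρ g) • ρ' g = 0 := by
  classical
  let b := Module.finBasis ℂ E
  ext w
  have : ∀ g, LinearMap.trace ℂ E (X * pinv α ρ g) • ρ' g w =
      ∑ i, (ρ' g ∘ₗ ((b.coord i ∘ₗ X).smulRight w) ∘ₗ pinv α ρ g) (b i) := by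
    intro g
    rw [LinearMap.trace_eq_matrix_trace ℂ b, Matrix.trace, Finset.sum_smul]
    refine Finset.sum_congr rfl fun i _ => ?_
    simp [LinearMap.toMatrix_apply]
  simp only [LinearMap.sum_apply, LinearMap.smul_apply, this]
  rw [Finset.sum_comm]
  simp only [LinearMap.zero_apply]
  refine Finset.sum_eq_zero fun i _ => ?_
  have := LinearMap.congr_fun (hav ((b.coord i ∘ₗ X).smulRight w)) (b i)
  simpa only [avg, LinearMap.sum_apply, LinearMap.zero_apply] using this

theorem trace_avg [Fintype K] [FiniteDimensional ℂ E] (h : PRep α ρ) (X : E →ₗ[ℂ] E) :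
    LinearMap.trace ℂ E (avg α ρ ρ X) = Fintype.card K * LinearMap.trace ℂ E X := by
  rw [avg, map_sum]
  have : ∀ g ∈ Finset.univ, LinearMap.trace ℂ E (ρ g ∘ₗ X ∘ₗ pinv α ρ g) =
      LinearMap.trace ℂ E X := by
    intro g _
    change LinearMap.trace ℂ E (ρ g * (X * pinv α ρ g)) = _
    rw [LinearMap.trace_mul_comm, mul_assoc, h.pinv_mul, mul_one]
  rw [Finset.sum_congr rfl this]
  simp [Finset.card_univ]

theorem avg_scalar [Fintype K] [FiniteDimensional ℂ E] (h : PRep α ρ) (hi : Irr ρ)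
    (X : E →ₗ[ℂ] E) : avg α ρ ρ X =
      (Fintype.card K * LinearMap.trace ℂ E X / Module.finrank ℂ E : ℂ) • 1 := by
  obtain ⟨c, hc⟩ := hi.scalar (avg α ρ ρ X) (fun i => (avg_comm h h X i).symm)
  have := hi.1
  have he : (Module.finrank ℂ E : ℂ) ≠ 0 := by
    simpa using Module.finrank_pos.ne'
  have h1 := trace_avg h X
  rw [hc, map_smul, LinearMap.trace_one, smul_eq_mul] at h1
  rw [hc, ← h1, mul_div_assoc, div_self he, mul_one]

theorem schur_sum [Fintype K] [FiniteDimensional ℂ E] (h : PRep α ρ) (hi : Irr ρ)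
    (X : E →ₗ[ℂ] E) :
    ∑ g, LinearMap.trace ℂ E (X * pinv α ρ g) • ρ g =
      (Fintype.card K / Module.finrank ℂ E : ℂ) • X := by
  classical
  let b := Module.finBasis ℂ E
  ext w
  have : ∀ g, LinearMap.trace ℂ E (X * pinv α ρ g) • ρ g w =
      ∑ i, (ρ g ∘ₗ ((b.coord i ∘ₗ X).smulRight w) ∘ₗ pinv α ρ g) (b i) := by
    intro g
    rw [LinearMap.trace_eq_matrix_trace ℂ b, Matrix.trace, Finset.sum_smul]
    refine Finset.sum_congr rfl fun i _ => ?_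
    simp [LinearMap.toMatrix_apply]
  simp only [LinearMap.sum_apply, LinearMap.smul_apply, this]
  rw [Finset.sum_comm]
  have h2 : ∀ i ∈ Finset.univ, ∑ g, (ρ g ∘ₗ ((b.coord i ∘ₗ X).smulRight w) ∘ₗ pinv α ρ g) (b i)
      = (Fintype.card K / Module.finrank ℂ E : ℂ) • (b.repr (X w) i • b i) := by
    intro i _
    have := LinearMap.congr_fun (avg_scalar h hi ((b.coord i ∘ₗ X).smulRight w)) (b i)
    rw [avg, LinearMap.sum_apply] at this
    rw [this]
    rw [LinearMap.trace_smulRight]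
    simp only [LinearMap.smul_apply, Module.End.one_apply, smul_smul, LinearMap.comp_apply,
      Module.Basis.coord_apply]
    congr 1; ring
  rw [Finset.sum_congr rfl h2, ← Finset.smul_sum, b.sum_repr]

end PRepBasic

end

section
open CategoryTheory

section Link
variable {G : Type} [Group G]

theorem PRep.ofHom {E : Type} [AddCommGroup E] [Module ℂ E] (σ : G →* (E →ₗ[ℂ] E)) :
    PRep (fun _ _ => 1) (fun g => σ g) := ⟨by simp, map_one σ, by simp⟩

def PRep.toHom {E : Type} [AddCommGroup E] [Module ℂ E] {ρ : G → E →ₗ[ℂ] E}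
    (h : PRep (fun _ _ => 1) ρ) : G →* (E →ₗ[ℂ] E) where
  toFun := ρ
  map_one' := h.one
  map_mul' s t := by rw [h.mul, one_smul]

theorem fdrep_scalar_of_simple [Finite G] (V : FDRep ℂ G) (hV : Simple V)
    (Q : V →ₗ[ℂ] V) (hQ : ∀ g v, Q (V.ρ g v) = V.ρ g (Q v)) : ∃ c : ℂ, Q = c • 1 := by
  have h1 := (FDRep.simple_iff_end_is_rank_one V).1 hV
  have h2 := (finrank_eq_one_iff_of_nonzero' _ (id_nonzero V)).1 h1
  let q : V ⟶ V := ⟨InducedCategory.homMk (ModuleCat.ofHom Q), fun g => by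
    ext v; exact hQ g v⟩
  obtain ⟨c, hc⟩ := h2 q
  refine ⟨c, ?_⟩
  have : q.hom.hom.hom = (c • 𝟙 V : V ⟶ V).hom.hom.hom := by rw [hc]
  exact this

theorem irr_of_simple [Finite G] (V : FDRep ℂ G) (hV : Simple V) : Irr (fun g => V.ρ g) := by
  cases nonempty_fintype G
  refine ⟨?_, ?_⟩
  · by_contra hn
    rw [not_nontrivial_iff_subsingleton] at hn
    apply id_nonzero V
    ext v
    exact Subsingleton.elim (α := V) _ _
  · intro U hU
    obtain ⟨Q, hQ1, hQ2, hQ3⟩ := (PRep.ofHom V.ρ).maschke U hU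
    obtain ⟨c, hc⟩ := fdrep_scalar_of_simple V hV Q hQ1
    by_cases hc0 : c = 0
    · left
      rw [eq_bot_iff]
      intro u hu
      have := hQ3 u hu
      rw [hc, hc0] at this
      simpa using this.symm
    · right
      rw [eq_top_iff]
      intro u _
      have := hQ2 u
      rw [hc] at this
      simp only [LinearMap.smul_apply, Module.End.one_apply] at this
      exact (U.smul_mem_iff hc0).1 this

theorem simple_of_irr [Finite G] {E : Type} [AddCommGroup E] [Module ℂ E] [FiniteDimensional ℂ E]
    (σ : G →* (E →ₗ[ℂ] E)) (h : Irr (fun g => σ g)) : Simple (FDRep.of σ) := by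
  rw [FDRep.simple_iff_end_is_rank_one]
  have := h.1
  obtain ⟨v, hv⟩ := exists_ne (0 : E)
  have h0 : (𝟙 (FDRep.of σ)) ≠ 0 := by
    intro h0
    have : (𝟙 (FDRep.of σ) : FDRep.of σ ⟶ FDRep.of σ).hom.hom.hom v = 0 := by rw [h0]; rfl
    exact hv this
  rw [finrank_eq_one_iff_of_nonzero' _ h0]
  intro q
  let Q : E →ₗ[ℂ] E := q.hom.hom.hom
  have hQ : ∀ g, Q * σ g = σ g * Q := by
    intro g
    ext v
    have := q.comm g
    have := congrArg (fun t => t.hom.hom v) this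
    exact this
  obtain ⟨c, hc⟩ := h.scalar Q hQ
  refine ⟨c, ?_⟩
  ext w
  have := LinearMap.congr_fun hc.symm w
  exact this

theorem mem_cd [Finite G] {n : ℕ} : n ∈ charDegrees G ↔
    ∃ (E : Type) (_ : AddCommGroup E) (_ : Module ℂ E) (_ : FiniteDimensional ℂ E)
      (ρ : G → E →ₗ[ℂ] E), PRep (fun _ _ => 1) ρ ∧ Irr ρ ∧ Module.finrank ℂ E = n := by
  constructor
  · rintro ⟨V, hV, hn⟩
    exact ⟨V, inferInstance, inferInstance, inferInstance, fun g => V.ρ g, PRep.ofHom V.ρ,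
      irr_of_simple V hV, hn⟩
  · rintro ⟨E, _, _, _, ρ, h, hi, hn⟩
    exact ⟨FDRep.of h.toHom, simple_of_irr h.toHom hi, hn⟩

/-- inflation: degrees of a quotient are degrees -/
theorem cd_quot [Finite G] {K : Type} [Group K] [Finite K] (π : G →* K)
    (hπ : Function.Surjective π) {n : ℕ} (h : n ∈ charDegrees K) : n ∈ charDegrees G := by
  rw [mem_cd] at h ⊢
  obtain ⟨E, i1, i2, i3, ρ, h, hi, hn⟩ := h
  refine ⟨E, i1, i2, i3, fun g => ρ (π g), ⟨fun _ _ => one_ne_zero, by simp [h.one], fun s t => by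
    rw [h.mul, map_mul]⟩, ⟨hi.1, fun U hU => hi.2 U fun k => ?_⟩, hn⟩
  obtain ⟨g, rfl⟩ := hπ k
  exact hU g

/-- twisted regular representation -/
noncomputable def treg {K : Type} [Group K] (α : K → K → ℂ) (s : K) : (K → ℂ) →ₗ[ℂ] (K → ℂ) where
  toFun f := fun x => α s (s⁻¹ * x) * f (s⁻¹ * x)
  map_add' f g := by ext x; simp [mul_add]
  map_smul' c f := by ext x; simp; ring

structure Cocyc {K : Type} [Group K] (α : K → K → ℂ) : Prop where
  ne : ∀ s t, α s t ≠ 0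
  one : ∀ s, α 1 s = 1
  coc : ∀ s t u, α s t * α (s * t) u = α s (t * u) * α t u

theorem treg_prep {K : Type} [Group K] {α : K → K → ℂ} (h : Cocyc α) : PRep α (treg α) := by
  refine ⟨h.ne, ?_, ?_⟩
  · ext f x; simp [treg, h.one]
  · intro s t
    refine LinearMap.ext fun f => funext fun x => ?_
    have := h.coc s t (t⁻¹ * s⁻¹ * x)
    simp only [treg, Module.End.mul_apply, LinearMap.coe_mk, AddHom.coe_mk, LinearMap.smul_apply,
      Pi.smul_apply, smul_eq_mul, mul_inv_rev]
    rw [show t * (t⁻¹ * s⁻¹ * x) = s⁻¹ * x by group] at this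
    rw [← mul_assoc (α s t), this, mul_assoc, mul_assoc t⁻¹]

/-- the cocycle identity follows from an actual PRep on a nontrivial space -/
theorem PRep.cocyc {K : Type} [Group K] {α : K → K → ℂ} {E : Type} [AddCommGroup E] [Module ℂ E]
    [Nontrivial E] {ρ : K → E →ₗ[ℂ] E} (h : PRep α ρ) : Cocyc α := by
  have hne : ∀ g, ρ g ≠ 0 := by
    intro g h0
    have := h.mul_pinv g
    rw [h0, zero_mul] at this
    exact one_ne_zero this.symm
  refine ⟨h.ne, fun s => ?_, fun s t u => ?_⟩
  · have := h.mul 1 s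
    rw [h.one, one_mul, one_mul] at this
    have h2 : (1 : ℂ) • ρ s = α 1 s • ρ s := by rw [← this, one_smul]
    exact (smul_left_injective ℂ (hne s) h2).symm
  · have h1 : (α s t * α (s * t) u) • ρ (s * t * u) = (α s (t * u) * α t u) • ρ (s * t * u) := by
      have e1 : ρ s * ρ t * ρ u = (α s t * α (s * t) u) • ρ (s * t * u) := by
        rw [h.mul, smul_mul_assoc, h.mul, smul_smul]
      have e2 : ρ s * (ρ t * ρ u) = (α s (t * u) * α t u) • ρ (s * t * u) := by
        rw [h.mul, mul_smul_comm, h.mul, smul_smul, mul_assoc s, mul_comm]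
      rw [← e1, ← e2, mul_assoc]
    exact smul_left_injective ℂ (hne _) h1

/-- pullback along a group hom -/
theorem PRep.comp {K L : Type} [Group K] [Group L] {α : K → K → ℂ} {E : Type} [AddCommGroup E]
    [Module ℂ E] {ρ : K → E →ₗ[ℂ] E} (h : PRep α ρ) (φ : L →* K) :
    PRep (fun s t => α (φ s) (φ t)) (fun s => ρ (φ s)) :=
  ⟨fun _ _ => h.ne _ _, by simp [h.one], fun s t => by rw [h.mul, map_mul]⟩

/-- change of gauge -/
theorem PRep.gauge {K : Type} [Group K] {α : K → K → ℂ} {E : Type} [AddCommGroup E]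
    [Module ℂ E] {ρ : K → E →ₗ[ℂ] E} (h : PRep α ρ) (κ : K → ℂ) (hκ : ∀ s, κ s ≠ 0)
    (h1 : κ 1 = 1) :
    PRep (fun s t => κ s * κ t / κ (s * t) * α s t) (fun s => κ s • ρ s) := by
  refine ⟨fun s t => ?_, by simp [h.one, h1], fun s t => ?_⟩
  · have := hκ s; have := hκ t; have := hκ (s * t); have := h.ne s t
    positivity
  · rw [smul_mul_smul_comm, h.mul, smul_smul, smul_smul]
    congr 1
    have := hκ (s * t)
    field_simp

theorem Irr.gauge {ι E : Type} [AddCommGroup E] [Module ℂ E] {ρ : ι → E →ₗ[ℂ] E}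
    (h : Irr ρ) (κ : ι → ℂ) (hκ : ∀ s, κ s ≠ 0) : Irr (fun s => κ s • ρ s) := by
  refine ⟨h.1, fun U hU => h.2 U fun i v hv => ?_⟩
  have := hU i v hv
  simpa [U.smul_mem_iff (hκ i)] using this

end Link

end

section
open CategoryTheory

section Degree
variable {K : Type} [Group K] {α : K → K → ℂ} {E : Type} [AddCommGroup E] [Module ℂ E]
  [FiniteDimensional ℂ E] {ρ : K → E →ₗ[ℂ] E}

theorem PRep.det_ne (h : PRep α ρ) (s : K) : LinearMap.det (ρ s) ≠ 0 := by
  intro h0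
  have := congrArg LinearMap.det (h.mul_pinv s)
  rw [map_mul, h0, zero_mul, map_one] at this
  exact zero_ne_one this

theorem degree_dvd_aux [Fintype K] (h : PRep α ρ) (hi : Irr ρ)
    (hα : ∀ s t, α s t ^ (Module.finrank ℂ E) = 1) : Module.finrank ℂ E ∣ Fintype.card K := by
  have := hi.1
  set e := Module.finrank ℂ E with he
  have hepos : 0 < e := Module.finrank_pos
  let R : Set ℂ := {c | c ^ e = 1}
  have hR : R.Finite := by
    have : R ⊆ (Polynomial.nthRoots e (1:ℂ)).toFinset := by
      intro c hc
      have hc : c ^ e = 1 := hc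
      simpa [Polynomial.mem_nthRoots hepos] using hc
    exact (Finset.finite_toSet _).subset this
  let S : Set (E →ₗ[ℂ] E) := (fun p : ℂ × K => p.1 • ρ p.2) '' (R ×ˢ Set.univ)
  have hS : S.Finite := (hR.prod Set.finite_univ).image _
  let L : Submodule ℤ (E →ₗ[ℂ] E) := Submodule.span ℤ S
  have hL : L.FG := Submodule.fg_span hS
  have hmul : ∀ x ∈ L, ∀ y ∈ L, x * y ∈ L := by
    have : L * L ≤ L := by
      rw [Submodule.span_mul_span, Submodule.span_le]
      rintro _ ⟨_, ⟨⟨c, s⟩, ⟨hc, -⟩, rfl⟩, _, ⟨⟨d, t⟩, ⟨hd, -⟩, rfl⟩, rfl⟩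
      apply Submodule.subset_span
      refine ⟨(c * d * α s t, s * t), ⟨?_, trivial⟩, ?_⟩
      · change (c * d * α s t) ^ e = 1
        rw [mul_pow, mul_pow, hα, hc, hd]; simp
      · simp only [smul_mul_smul_comm, h.mul, smul_smul]
    intro x hx y hy
    exact this (Submodule.mul_mem_mul hx hy)
  have hρ : ∀ g, ρ g ∈ L := fun g => Submodule.subset_span ⟨(1, g), ⟨by simp [R], trivial⟩, by simp⟩
  have hpi : ∀ g, pinv α ρ g ∈ L := fun g => Submodule.subset_span
    ⟨((α g g⁻¹)⁻¹, g⁻¹), ⟨by simp [R, inv_pow, hα], trivial⟩, rfl⟩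
  have h1 : (1 : E →ₗ[ℂ] E) ∈ L := by rw [← h.one]; exact hρ 1
  have hz : ((Fintype.card K / e : ℂ) ^ 2) • (1 : E →ₗ[ℂ] E) ∈ L := by
    have e1 : ∑ g, avg α ρ ρ (pinv α ρ g) * ρ g =
        ((Fintype.card K / e : ℂ) ^ 2) • (1 : E →ₗ[ℂ] E) := by
      have := schur_sum h hi 1
      simp only [one_mul] at this
      calc ∑ g, avg α ρ ρ (pinv α ρ g) * ρ g
          = (Fintype.card K / e : ℂ) • ∑ g, LinearMap.trace ℂ E (pinv α ρ g) • ρ g := by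
            rw [Finset.smul_sum]
            refine Finset.sum_congr rfl fun g _ => ?_
            rw [avg_scalar h hi, smul_mul_assoc, one_mul, smul_smul]
            congr 1; ring
        _ = _ := by rw [this, smul_smul, ← he, sq]
    rw [← e1]
    refine L.sum_mem fun g _ => hmul _ ?_ _ (hρ g)
    refine L.sum_mem fun k _ => ?_
    exact hmul _ (hρ k) _ (hmul _ (hpi g) _ (hpi k))
  have hint : IsIntegral ℤ ((Fintype.card K / e : ℂ) ^ 2) := by
    refine isIntegral_of_smul_mem_submodule L ?_ hL _ ?_
    · intro hb; rw [hb] at h1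
      exact one_ne_zero ((Submodule.mem_bot ℤ).1 h1)
    · intro n hn
      have := hmul _ hz _ hn
      rwa [smul_mul_assoc, one_mul] at this
  have hint2 : IsIntegral ℤ (Fintype.card K / e : ℂ) := IsIntegral.of_pow (by norm_num) hint
  have hint3 : IsIntegral ℤ (Fintype.card K / e : ℚ) := by
    have : ((Fintype.card K / e : ℚ) : ℂ) = (Fintype.card K / e : ℂ) := by push_cast; rfl
    rw [← this] at hint2
    exact (isIntegral_algebraMap_iff (algebraMap ℚ ℂ).injective).1 hint2
  obtain ⟨z, hz⟩ := IsIntegrallyClosed.isIntegral_iff.1 hint3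
  have he0 : (e : ℚ) ≠ 0 := by exact_mod_cast hepos.ne'
  have : (Fintype.card K : ℚ) = e * z := by
    simp only [eq_intCast] at hz
    rw [hz]; field_simp
  have h3 : ((Fintype.card K : ℕ) : ℤ) = (e : ℤ) * z := by exact_mod_cast this
  exact_mod_cast (Dvd.intro z h3.symm : (e : ℤ) ∣ (Fintype.card K : ℤ))

theorem degree_dvd [Finite K] (h : PRep α ρ) (hi : Irr ρ) :
    Module.finrank ℂ E ∣ Nat.card K := by
  cases nonempty_fintype K
  rw [Nat.card_eq_fintype_card]
  have := hi.1
  have hepos : 0 < Module.finrank ℂ E := Module.finrank_pos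
  have hk : ∀ s, ∃ c : ℂ, c ^ (Module.finrank ℂ E) = (LinearMap.det (ρ s))⁻¹ ∧ (s = 1 → c = 1) := by
    intro s
    by_cases hs : s = 1
    · exact ⟨1, by simp [hs, h.one], fun _ => rfl⟩
    · obtain ⟨c, hc⟩ := IsAlgClosed.exists_pow_nat_eq (LinearMap.det (ρ s))⁻¹ hepos
      exact ⟨c, hc, fun h => absurd h hs⟩
  choose κ hκ hκ1 using hk
  have hκ0 : ∀ s, κ s ≠ 0 := by
    intro s h0
    have := hκ s
    rw [h0, zero_pow hepos.ne'] at this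
    exact inv_ne_zero (h.det_ne s) this.symm
  have h' := h.gauge κ hκ0 (hκ1 1 rfl)
  have hdet : ∀ s, LinearMap.det (κ s • ρ s) = 1 := by
    intro s; rw [LinearMap.det_smul, hκ, inv_mul_cancel₀ (h.det_ne s)]
  refine degree_dvd_aux h' (hi.gauge κ hκ0) fun s t => ?_
  have := congrArg LinearMap.det (h'.mul s t)
  rw [map_mul, hdet, hdet, LinearMap.det_smul, hdet] at this
  simpa using this.symm
end Degree

end

section
open CategoryTheory

section Lift
variable {G K : Type} [Group G] [Group K] {W : Type} [AddCommGroup W] [Module ℂ W]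

structure NRep (π : G →* K) (θ : G → W →ₗ[ℂ] W) : Prop where
  one : θ 1 = 1
  mul : ∀ n m, π n = 1 → π m = 1 → θ n * θ m = θ (n * m)
  irr : Irr (fun n : π.ker => θ n)

def Stab (π : G →* K) (θ : G → W →ₗ[ℂ] W) (g : G) : Prop :=
  ∃ A : W →ₗ[ℂ] W, A ≠ 0 ∧ ∀ n, π n = 1 → A * θ n = θ (g * n * g⁻¹) * A

structure CLift (π : G →* K) (θ : G → W →ₗ[ℂ] W) (H : Subgroup K) (A : G → W →ₗ[ℂ] W)
    (β : K → K → ℂ) : Prop where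
  stab : ∀ g, π g ∈ H ↔ Stab π θ g
  ext : ∀ n, π n = 1 → A n = θ n
  comm : ∀ g n, π g ∈ H → π n = 1 → A g * θ n = θ (g * n * g⁻¹) * A g
  ne : ∀ s t, s ∈ H → t ∈ H → β s t ≠ 0
  mul : ∀ g h, π g ∈ H → π h ∈ H → A g * A h = β (π g) (π h) • A (g * h)

theorem NRep.prep {π : G →* K} {θ : G → W →ₗ[ℂ] W} (h : NRep π θ) :
    PRep (fun _ _ => 1) (fun n : π.ker => θ n) :=
  ⟨by simp, by simp [h.one], fun s t => by simp [h.mul s t s.2 t.2]⟩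

theorem NRep.inv_mul {π : G →* K} {θ : G → W →ₗ[ℂ] W} (h : NRep π θ) {n : G} (hn : π n = 1) :
    θ n⁻¹ * θ n = 1 := by rw [h.mul _ _ (by simp [hn]) hn, inv_mul_cancel, h.one]

theorem NRep.mul_inv {π : G →* K} {θ : G → W →ₗ[ℂ] W} (h : NRep π θ) {n : G} (hn : π n = 1) :
    θ n * θ n⁻¹ = 1 := by rw [h.mul _ _ hn (by simp [hn]), mul_inv_cancel, h.one]

theorem ker_conj {π : G →* K} {n : G} (g : G) (hn : π n = 1) : π (g * n * g⁻¹) = 1 := by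
  simp [hn]

theorem ker_conj' {π : G →* K} {n : G} (g : G) (hn : π n = 1) : π (g⁻¹ * n * g) = 1 := by
  simp [hn]

theorem NRep.conj_irr {π : G →* K} {θ : G → W →ₗ[ℂ] W} (h : NRep π θ) (g : G) :
    Irr (fun n : π.ker => θ (g * n * g⁻¹)) := by
  refine ⟨h.irr.1, fun U hU => h.irr.2 U fun n => ?_⟩
  have := hU ⟨g⁻¹ * n * g, ker_conj' g n.2⟩
  simpa [mul_assoc] using this

theorem Stab.bij {π : G →* K} {θ : G → W →ₗ[ℂ] W} (h : NRep π θ) {g : G} {A : W →ₗ[ℂ] W}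
    (h0 : A ≠ 0) (hA : ∀ n, π n = 1 → A * θ n = θ (g * n * g⁻¹) * A) : Function.Bijective A :=
  h.irr.bij (h.conj_irr g) A (fun n v => LinearMap.congr_fun (hA n n.2) v) h0

theorem Stab.exists_inv {π : G →* K} {θ : G → W →ₗ[ℂ] W} (h : NRep π θ) {g : G} {A : W →ₗ[ℂ] W}
    (h0 : A ≠ 0) (hA : ∀ n, π n = 1 → A * θ n = θ (g * n * g⁻¹) * A) :
    ∃ B : W →ₗ[ℂ] W, A * B = 1 ∧ B * A = 1 ∧
      ∀ n, π n = 1 → B * θ n = θ (g⁻¹ * n * g) * B := by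
  let e := LinearEquiv.ofBijective A (Stab.bij h h0 hA)
  have h1 : A * e.symm.toLinearMap = 1 := by
    ext v; exact e.apply_symm_apply v
  have h2 : e.symm.toLinearMap * A = 1 := by
    ext v; exact e.symm_apply_apply v
  refine ⟨e.symm.toLinearMap, h1, h2, fun n hn => ?_⟩
  have := hA _ (ker_conj' g hn)
  rw [show g * (g⁻¹ * n * g) * g⁻¹ = n by group] at this
  calc e.symm.toLinearMap * θ n = e.symm.toLinearMap * (θ n * A) * e.symm.toLinearMap := by
        rw [mul_assoc, mul_assoc, h1, mul_one]
    _ = _ := by rw [← this, ← mul_assoc, h2, one_mul]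

theorem ne_zero_of_mul_eq_one [Nontrivial W] {A B : W →ₗ[ℂ] W} (h : A * B = 1) : A ≠ 0 := by
  rintro rfl; rw [zero_mul] at h; exact zero_ne_one h

theorem Stab.mul {π : G →* K} {θ : G → W →ₗ[ℂ] W} (h : NRep π θ) {g k : G}
    (hg : Stab π θ g) (hk : Stab π θ k) : Stab π θ (g * k) := by
  have := h.irr.1
  obtain ⟨A, a0, hA⟩ := hg
  obtain ⟨B, b0, hB⟩ := hk
  obtain ⟨A', a1, a2, -⟩ := Stab.exists_inv h a0 hA
  obtain ⟨B', b1, b2, -⟩ := Stab.exists_inv h b0 hB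
  refine ⟨A * B, ne_zero_of_mul_eq_one (B := B' * A') ?_, fun n hn => ?_⟩
  · rw [mul_assoc, ← mul_assoc B, b1, one_mul, a1]
  · rw [mul_assoc, hB n hn, ← mul_assoc, hA _ (ker_conj k hn), mul_assoc]
    congr 2; group

theorem Stab.inv {π : G →* K} {θ : G → W →ₗ[ℂ] W} (h : NRep π θ) {g : G}
    (hg : Stab π θ g) : Stab π θ g⁻¹ := by
  have := h.irr.1
  obtain ⟨A, a0, hA⟩ := hg
  obtain ⟨A', a1, a2, a3⟩ := Stab.exists_inv h a0 hA
  exact ⟨A', ne_zero_of_mul_eq_one a2, by simpa using a3⟩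

theorem Stab.ker {π : G →* K} {θ : G → W →ₗ[ℂ] W} (h : NRep π θ) {n : G} (hn : π n = 1) :
    Stab π θ n := by
  have := h.irr.1
  refine ⟨θ n, ne_zero_of_mul_eq_one (h.mul_inv hn), fun m hm => ?_⟩
  rw [h.mul _ _ hn hm, h.mul _ _ (ker_conj n hm) hn]
  congr 1; group

theorem exists_lift [FiniteDimensional ℂ W] {π : G →* K} (hπ : Function.Surjective π)
    {θ : G → W →ₗ[ℂ] W} (h : NRep π θ) :
    ∃ (H : Subgroup K) (A : G → W →ₗ[ℂ] W) (β : K → K → ℂ), CLift π θ H A β := by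
  classical
  have hnt := h.irr.1
  let H : Subgroup K :=
    { carrier := {s | ∃ g, π g = s ∧ Stab π θ g}
      mul_mem' := by
        rintro _ _ ⟨g, rfl, hg⟩ ⟨k, rfl, hk⟩
        exact ⟨g * k, map_mul _ _ _, hg.mul h hk⟩
      one_mem' := ⟨1, map_one _, Stab.ker h (map_one _)⟩
      inv_mem' := by
        rintro _ ⟨g, rfl, hg⟩
        exact ⟨g⁻¹, map_inv _ _, hg.inv h⟩ }
  have hst : ∀ g, π g ∈ H ↔ Stab π θ g := by
    intro g
    refine ⟨?_, fun hg => ⟨g, rfl, hg⟩⟩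
    rintro ⟨g', e, hg'⟩
    have : Stab π θ (g' * (g'⁻¹ * g)) := hg'.mul h (Stab.ker h (by simp [e]))
    simpa using this
  have hch : ∀ s : K, ∃ (g : G) (A : W →ₗ[ℂ] W), π g = s ∧ (s = 1 → g = 1 ∧ A = 1) ∧
      (s ∈ H → A ≠ 0 ∧ ∀ n, π n = 1 → A * θ n = θ (g * n * g⁻¹) * A) := by
    intro s
    by_cases hs : s = 1
    · refine ⟨1, 1, by simp [hs], fun _ => ⟨rfl, rfl⟩, fun _ => ⟨one_ne_zero, by simp⟩⟩
    obtain ⟨g, rfl⟩ := hπ s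
    by_cases hH : π g ∈ H
    · obtain ⟨A, h0, hA⟩ := (hst g).1 hH
      exact ⟨g, A, rfl, fun h => absurd h hs, fun _ => ⟨h0, hA⟩⟩
    · exact ⟨g, 1, rfl, fun h => absurd h hs, fun h => absurd h hH⟩
  choose σ A hσ hσ1 hA using hch
  obtain ⟨AA, hAA⟩ : ∃ AA : G → W →ₗ[ℂ] W, ∀ g, AA g = A (π g) * θ ((σ (π g))⁻¹ * g) :=
    ⟨_, fun _ => rfl⟩
  have hr : ∀ g, π ((σ (π g))⁻¹ * g) = 1 := by intro g; simp [hσ]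
  have hcomm : ∀ g n, π g ∈ H → π n = 1 → AA g * θ n = θ (g * n * g⁻¹) * AA g := by
    intro g n hg hn
    obtain ⟨-, hA2⟩ := hA _ hg
    obtain ⟨r, hrdef, hr1⟩ : ∃ r, r = (σ (π g))⁻¹ * g ∧ π r = 1 := ⟨_, rfl, hr g⟩
    have e1 : θ r * θ n = θ (r * n * r⁻¹) * θ r := by
      rw [h.mul _ _ hr1 hn, h.mul _ _ (ker_conj r hn) hr1]; congr 1; group
    calc AA g * θ n = A (π g) * θ (r * n * r⁻¹) * θ r := by
          rw [hAA, ← hrdef, mul_assoc, e1, ← mul_assoc]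
      _ = θ (σ (π g) * (r * n * r⁻¹) * (σ (π g))⁻¹) * A (π g) * θ r := by
          rw [hA2 _ (ker_conj r hn)]
      _ = _ := by
          rw [hAA, ← hrdef, mul_assoc]
          congr 2
          rw [hrdef]; group
  have hA0 : ∀ g, π g ∈ H → AA g ≠ 0 := by
    intro g hg h0
    apply (hA _ hg).1
    calc A (π g) = AA g * θ ((σ (π g))⁻¹ * g)⁻¹ := by
          rw [hAA, mul_assoc, h.mul_inv (hr g), mul_one]
      _ = 0 := by rw [h0, zero_mul]
  have hAn : ∀ g n, π n = 1 → AA (g * n) = AA g * θ n := by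
    intro g n hn
    have : π (g * n) = π g := by simp [hn]
    rw [hAA, hAA, this, mul_assoc, h.mul _ _ (hr g) hn, mul_assoc]
  have hscal : ∀ g k, π g ∈ H → π k ∈ H → ∃ c : ℂ, c ≠ 0 ∧ AA g * AA k = c • AA (g * k) := by
    intro g k hg hk
    have hgk : π (g * k) ∈ H := by rw [map_mul]; exact H.mul_mem hg hk
    obtain ⟨B, b1, b2, b3⟩ := Stab.exists_inv h (hA0 _ hgk) (fun n hn => hcomm _ n hgk hn)
    obtain ⟨B1, c1, c2, -⟩ := Stab.exists_inv h (hA0 _ hg) (fun n hn => hcomm _ n hg hn)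
    obtain ⟨B2, d1, d2, -⟩ := Stab.exists_inv h (hA0 _ hk) (fun n hn => hcomm _ n hk hn)
    obtain ⟨c, hc⟩ := h.irr.scalar (B * (AA g * AA k)) (by
      rintro ⟨n, hn⟩
      change B * (AA g * AA k) * θ n = θ n * (B * (AA g * AA k))
      have hn : π n = 1 := hn
      rw [mul_assoc, mul_assoc, hcomm k n hk hn, ← mul_assoc (AA g), hcomm g _ hg (ker_conj k hn),
        mul_assoc, ← mul_assoc B, b3 _ (ker_conj g (ker_conj k hn)), mul_assoc]
      congr 2
      group)
    have e : AA g * AA k = c • AA (g * k) := by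
      calc AA g * AA k = AA (g * k) * (B * (AA g * AA k)) := by rw [← mul_assoc, b1, one_mul]
        _ = _ := by rw [hc, mul_smul_comm, mul_one]
    refine ⟨c, ?_, e⟩
    rintro rfl
    rw [zero_smul] at e
    have : AA g * (AA k * B2) * B1 = 0 := by rw [← mul_assoc, e]; simp
    rw [d1, mul_one, c1] at this
    exact one_ne_zero this
  have hβ : ∀ s t, ∃ c : ℂ, s ∈ H → t ∈ H → c ≠ 0 ∧
      AA (σ s) * AA (σ t) = c • AA (σ s * σ t) := by
    intro s t
    by_cases hh : s ∈ H ∧ t ∈ H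
    · obtain ⟨c, hc⟩ := hscal (σ s) (σ t) (by rw [hσ]; exact hh.1) (by rw [hσ]; exact hh.2)
      exact ⟨c, fun _ _ => hc⟩
    · exact ⟨0, fun a b => absurd ⟨a, b⟩ hh⟩
  choose β hβ using hβ
  refine ⟨H, AA, β, hst, ?_, hcomm, fun s t hs ht => (hβ s t hs ht).1, ?_⟩
  · intro n hn
    rw [hAA, hn, (hσ1 1 rfl).1, (hσ1 1 rfl).2]; simp
  · intro g k hg hk
    obtain ⟨r, rr, hrr⟩ : ∃ r, r = (σ (π g))⁻¹ * g ∧ π r = 1 := ⟨_, rfl, hr g⟩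
    obtain ⟨r', rr', hrr'⟩ : ∃ r, r = (σ (π k))⁻¹ * k ∧ π r = 1 := ⟨_, rfl, hr k⟩
    have eg : g = σ (π g) * r := by rw [rr]; group
    have ek : k = σ (π k) * r' := by rw [rr']; group
    have e1 : AA g = AA (σ (π g)) * θ r := by
      conv_lhs => rw [eg]
      exact hAn _ _ hrr
    have e2 : AA k = AA (σ (π k)) * θ r' := by
      conv_lhs => rw [ek]
      exact hAn _ _ hrr'
    set a := σ (π g) with ha
    set b := σ (π k) with hb
    have hbH : π b ∈ H := by rw [hb, hσ]; exact hk
    have e3 : θ r * AA b = AA b * θ (b⁻¹ * r * b) := by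
      rw [hcomm b _ hbH (ker_conj' b hrr)]; congr 2; group
    have e4 : g * k = (a * b) * ((b⁻¹ * r * b) * r') := by
      conv_lhs => rw [eg, ek]
      group
    rw [e4, hAn _ _ (by simp [hrr, hrr']), ← h.mul _ _ (ker_conj' b hrr) hrr', e1, e2]
    calc AA a * θ r * (AA b * θ r') = AA a * (θ r * AA b) * θ r' := by simp only [mul_assoc]
      _ = (AA a * AA b) * (θ (b⁻¹ * r * b) * θ r') := by rw [e3]; simp only [mul_assoc]
      _ = _ := by rw [(hβ _ _ hg hk).2, smul_mul_assoc]
end Lift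

end

section
open CategoryTheory TensorProduct

section Cliff
variable {G K : Type} [Group G] [Group K] {W : Type} [AddCommGroup W] [Module ℂ W]
  {V : Type} [AddCommGroup V] [Module ℂ V]

theorem clifford_dim [Finite G] [FiniteDimensional ℂ V] {ρ : G → V →ₗ[ℂ] V}
    (h : PRep (fun _ _ => 1) ρ) (hi : Irr ρ) (I : Subgroup G) (Y : Submodule ℂ V) (hY : Y ≠ ⊥)
    (hI : ∀ g ∈ I, ∀ y ∈ Y, ρ g y ∈ Y) (T : V →ₗ[ℂ] V) (hT : ∀ y ∈ Y, T y = y)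
    (hT0 : ∀ g, g ∉ I → ∀ y ∈ Y, T (ρ g y) = 0) :
    Module.finrank ℂ V = I.index * Module.finrank ℂ Y := by
  classical
  have : Fintype (G ⧸ I) := Fintype.ofFinite _
  have hm : ∀ s t v, ρ s (ρ t v) = ρ (s * t) v := by
    intro s t v
    have := LinearMap.congr_fun (h.mul s t) v
    simpa using this
  let Φ : (G ⧸ I → Y) →ₗ[ℂ] V := ∑ c, ρ c.out ∘ₗ Y.subtype ∘ₗ LinearMap.proj c
  have hΦ : ∀ f, Φ f = ∑ c, ρ c.out (f c) := by intro f; simp [Φ]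
  have hin : Function.Injective Φ := by
    rw [← LinearMap.ker_eq_bot, LinearMap.ker_eq_bot']
    intro f hf
    funext c0
    have h1 : T (ρ (c0.out)⁻¹ (Φ f)) = f c0 := by
      rw [hΦ, map_sum, map_sum, Finset.sum_eq_single c0]
      · rw [hm, inv_mul_cancel, h.one, Module.End.one_apply, hT _ (f c0).2]
      · intro c _ hc
        rw [hm]
        refine hT0 _ ?_ _ (f c).2
        intro hmem
        apply hc
        rw [← QuotientGroup.out_eq' c, ← QuotientGroup.out_eq' c0]
        exact (QuotientGroup.eq.2 hmem).symm
      · simp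
    rw [hf, map_zero, map_zero] at h1
    exact Subtype.ext h1.symm
  have hsu : LinearMap.range Φ = ⊤ := by
    refine (hi.2 _ ?_).resolve_left ?_
    · rintro g _ ⟨f, rfl⟩
      rw [hΦ, map_sum]
      refine Submodule.sum_mem _ fun c _ => ?_
      rw [hm]
      set d : G ⧸ I := QuotientGroup.mk (g * c.out) with hd
      have h2 : (d.out)⁻¹ * (g * c.out) ∈ I := by
        rw [← QuotientGroup.eq, QuotientGroup.out_eq']
      have h3 := hI _ h2 _ (f c).2
      refine ⟨Pi.single d ⟨_, h3⟩, ?_⟩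
      rw [hΦ, Finset.sum_eq_single d]
      · rw [Pi.single_eq_same]
        change ρ _ (ρ _ _) = _
        rw [hm]; congr 2; group
      · intro b _ hb; rw [Pi.single_eq_of_ne hb]; simp
      · simp
    · intro hb
      apply hY
      rw [eq_bot_iff]
      intro y hy
      have h4 : Φ (Pi.single (QuotientGroup.mk 1) ⟨ρ ((QuotientGroup.mk 1 : G ⧸ I).out)⁻¹ y,
          hI _ (I.inv_mem (by
            have := QuotientGroup.out_eq' (QuotientGroup.mk 1 : G ⧸ I)
            have := QuotientGroup.eq.1 this.symm
            simpa using this)) _ hy⟩) = y := by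
        rw [hΦ, Finset.sum_eq_single (QuotientGroup.mk 1)]
        · rw [Pi.single_eq_same]
          change ρ _ (ρ _ _) = _
          rw [hm, mul_inv_cancel, h.one]; rfl
        · intro b _ hb; rw [Pi.single_eq_of_ne hb]; simp
        · simp
      rw [← hb]
      exact ⟨_, h4⟩
  have := (LinearEquiv.ofBijective Φ ⟨hin, LinearMap.range_eq_top.1 hsu⟩).finrank_eq
  rw [← this, Module.finrank_pi_fintype]
  simp [Subgroup.index, Nat.card_eq_fintype_card]

theorem theta_proj [Finite G] [FiniteDimensional ℂ W] {π : G →* K} {θ : G → W →ₗ[ℂ] W}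
    (hθ : NRep π θ) {ρ : G → V →ₗ[ℂ] V} (h : PRep (fun _ _ => 1) ρ) :
    ∃ T : V →ₗ[ℂ] V, ∀ φ : W →ₗ[ℂ] V, (∀ n, π n = 1 → ∀ w, φ (θ n w) = ρ n (φ w)) →
      (∀ w, T (φ w) = φ w) ∧ ∀ g, ¬ Stab π θ g → ∀ w, T (ρ g (φ w)) = 0 := by
  classical
  cases nonempty_fintype π.ker
  have hm : ∀ s t v, ρ s (ρ t v) = ρ (s * t) v := by
    intro s t v
    have := LinearMap.congr_fun (h.mul s t) v
    simpa using this
  have hnt := hθ.irr.1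
  set c : ℂ := Fintype.card π.ker / Module.finrank ℂ W with hc
  have hc0 : c ≠ 0 := by
    have : 0 < Module.finrank ℂ W := Module.finrank_pos
    have : 0 < Fintype.card π.ker := Fintype.card_pos
    exact div_ne_zero (by exact_mod_cast this.ne') (by exact_mod_cast (Module.finrank_pos (R := ℂ) (M := W)).ne')
  let χ : π.ker → ℂ := fun n => LinearMap.trace ℂ W (1 * pinv (fun _ _ => 1) (fun n : π.ker => θ n) n)
  refine ⟨c⁻¹ • ∑ n : π.ker, χ n • ρ n, fun φ hφ => ⟨fun w => ?_, fun g hg w => ?_⟩⟩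
  · have h1 := schur_sum hθ.prep hθ.irr 1
    have h2 : (∑ n : π.ker, χ n • ρ n) (φ w) = φ ((∑ n : π.ker, χ n • θ n) w) := by
      simp only [LinearMap.sum_apply, LinearMap.smul_apply, map_sum, map_smul]
      exact Finset.sum_congr rfl fun n _ => by rw [hφ n n.2]
    rw [LinearMap.smul_apply, h2, h1]
    simp [← hc, smul_smul, hc0]
  · have h1 := schur_zero (α := fun _ _ => 1) (ρ := fun n : π.ker => θ n)
      (ρ' := fun n : π.ker => θ (g⁻¹ * n * g)) (by
        intro X
        by_contra h0
        apply hg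
        have hP : PRep (fun _ _ => 1) (fun n : π.ker => θ (g⁻¹ * n * g)) :=
          ⟨by simp, by simp [hθ.one], fun s t => by
            rw [hθ.mul _ _ (ker_conj' g s.2) (ker_conj' g t.2), one_smul]
            congr 1; simp only [Subgroup.coe_mul]; group⟩
        have := Stab.inv hθ (g := g⁻¹) ⟨_, h0, fun n hn => by
          have := avg_comm hθ.prep hP X ⟨n, hn⟩
          rw [inv_inv]
          exact this.symm⟩
        simpa using this) 1
    have h2 : (∑ n : π.ker, χ n • ρ n) (ρ g (φ w)) =
        ρ g (φ ((∑ n : π.ker, χ n • θ (g⁻¹ * n * g)) w)) := by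
      simp only [LinearMap.sum_apply, LinearMap.smul_apply, map_sum, map_smul]
      refine Finset.sum_congr rfl fun n _ => ?_
      rw [hφ _ (ker_conj' g n.2), hm, hm]
      congr 3; group
    rw [LinearMap.smul_apply, h2, h1]
    simp

variable {E : Type} [AddCommGroup E] [Module ℂ E]

noncomputable def tens (π : G →* K) (H : Subgroup K) (A : G → W →ₗ[ℂ] W) (ρE : H → E →ₗ[ℂ] E)
    (g : H.comap π) : W ⊗[ℂ] E →ₗ[ℂ] W ⊗[ℂ] E := TensorProduct.map (A g) (ρE ⟨π g, g.2⟩)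

noncomputable def alp (H : Subgroup K) (β : K → K → ℂ) (s t : H) : ℂ := (β s t)⁻¹

theorem tens_prep {π : G →* K} {θ : G → W →ₗ[ℂ] W} {H : Subgroup K} {A : G → W →ₗ[ℂ] W}
    {β : K → K → ℂ} (hθ : NRep π θ) (hL : CLift π θ H A β) {ρE : H → E →ₗ[ℂ] E}
    (hE : PRep (alp H β) ρE) : PRep (fun _ _ => 1) (tens π H A ρE) := by
  refine ⟨by simp, ?_, fun s t => ?_⟩
  · have : ρE ⟨π (1 : H.comap π), (1 : H.comap π).2⟩ = 1 := by
      rw [← hE.one]; congr 1; ext; simp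
    rw [tens, this, show ((1 : H.comap π) : G) = 1 from rfl, hL.ext 1 (map_one _), hθ.one,
      TensorProduct.map_one]
  · have h1 := hE.mul ⟨π s, s.2⟩ ⟨π t, t.2⟩
    have h2 := hL.mul s t s.2 t.2
    have h3 := hL.ne _ _ s.2 t.2
    simp only [tens]
    rw [← TensorProduct.map_mul, h1, h2, alp, TensorProduct.map_smul_left,
      TensorProduct.map_smul_right, smul_smul, mul_inv_cancel₀ h3]
    congr 3
    ext; simp

theorem CLift.aprep {π : G →* K} {θ : G → W →ₗ[ℂ] W} {H : Subgroup K} {A : G → W →ₗ[ℂ] W}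
    {β : K → K → ℂ} (hθ : NRep π θ) (hL : CLift π θ H A β) :
    PRep (fun s t : H.comap π => β (π s) (π t)) (fun g : H.comap π => A g) := by
  refine ⟨fun s t => hL.ne _ _ s.2 t.2, ?_, fun s t => hL.mul _ _ s.2 t.2⟩
  change A 1 = 1
  rw [hL.ext 1 (map_one _), hθ.one]

theorem CLift.cocyc {π : G →* K} (hπ : Function.Surjective π) {θ : G → W →ₗ[ℂ] W}
    {H : Subgroup K} {A : G → W →ₗ[ℂ] W}
    {β : K → K → ℂ} (hθ : NRep π θ) (hL : CLift π θ H A β) : Cocyc (alp H β) := by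
  have := hθ.irr.1
  have hc := (hL.aprep hθ).cocyc
  have hs : ∀ s : H, ∃ g : H.comap π, π g = s := by
    intro s
    obtain ⟨g, hg⟩ := hπ s
    exact ⟨⟨g, by rw [Subgroup.mem_comap, hg]; exact s.2⟩, hg⟩
  refine ⟨fun s t => inv_ne_zero (hL.ne _ _ s.2 t.2), fun s => ?_, fun s t u => ?_⟩
  · obtain ⟨g, hg⟩ := hs s
    have := hc.one g
    simp only [alp, ← hg]
    simpa using this
  · obtain ⟨g, hg⟩ := hs s
    obtain ⟨k, hk⟩ := hs t
    obtain ⟨l, hl⟩ := hs u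
    have := hc.coc g k l
    simp only [alp, Subgroup.coe_mul, ← hg, ← hk, ← hl]
    rw [← mul_inv, ← mul_inv, ← map_mul, ← map_mul]
    exact congrArg _ this

theorem tens_irr [Finite G] [FiniteDimensional ℂ W] {π : G →* K} (hπ : Function.Surjective π)
    {θ : G → W →ₗ[ℂ] W} {H : Subgroup K}
    {A : G → W →ₗ[ℂ] W} {β : K → K → ℂ} (hθ : NRep π θ) (hL : CLift π θ H A β)
    {ρE : H → E →ₗ[ℂ] E} (hE : PRep (alp H β) ρE) (hi : Irr ρE) : Irr (tens π H A ρE) := by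
  classical
  cases nonempty_fintype π.ker
  have hnt := hθ.irr.1
  have hnt' := hi.1
  let b := Module.finBasis ℂ W
  refine ⟨inferInstance, fun U hU => ?_⟩
  by_cases hb : U = ⊥
  · exact Or.inl hb
  right
  let E' : Submodule ℂ E := ⨅ w : W, U.comap (TensorProduct.mk ℂ W E w)
  have hE' : ∀ x, x ∈ E' ↔ ∀ w : W, w ⊗ₜ[ℂ] x ∈ U := by intro x; simp [E']
  have hinv : ∀ s, ∀ x ∈ E', ρE s x ∈ E' := by
    intro s x hx
    rw [hE'] at hx ⊢
    intro w
    obtain ⟨g, hg⟩ := hπ s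
    have hgH : g ∈ H.comap π := by rw [Subgroup.mem_comap, hg]; exact s.2
    have h1 := hU ⟨g, hgH⟩ _ (hx (pinv (fun s t : H.comap π => β (π s) (π t)) (fun g : H.comap π => A g) ⟨g, hgH⟩ w))
    have h2 := LinearMap.congr_fun ((hL.aprep hθ).mul_pinv ⟨g, hgH⟩) w
    rw [tens, TensorProduct.map_tmul] at h1
    rw [Module.End.mul_apply, Module.End.one_apply] at h2
    rw [h2] at h1
    have h3 : s = ⟨π g, hgH⟩ := Subtype.ext hg.symm
    rw [h3]
    exact h1
  have hburn : ∀ X : W →ₗ[ℂ] W, ∀ u ∈ U, TensorProduct.map X LinearMap.id u ∈ U := by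
    intro X u hu
    have h1 := schur_sum hθ.prep hθ.irr X
    set c : ℂ := Fintype.card π.ker / Module.finrank ℂ W with hc
    have hc0 : c ≠ 0 := by
      have : 0 < Module.finrank ℂ W := Module.finrank_pos
      have : 0 < Fintype.card π.ker := Fintype.card_pos
      exact div_ne_zero (by exact_mod_cast this.ne') (by exact_mod_cast (Module.finrank_pos (R := ℂ) (M := W)).ne')
    rw [← U.smul_mem_iff hc0, ← LinearMap.smul_apply, ← TensorProduct.map_smul_left, ← h1]
    have h2 : TensorProduct.map (∑ g : π.ker, LinearMap.trace ℂ W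
        (X * pinv (fun _ _ => 1) (fun n : π.ker => θ n) g) • θ g) (LinearMap.id (M := E)) =
        ∑ g : π.ker, LinearMap.trace ℂ W
        (X * pinv (fun _ _ => 1) (fun n : π.ker => θ n) g) •
          TensorProduct.map (θ g) (LinearMap.id (M := E)) := by
      refine TensorProduct.ext' fun w x => ?_
      simp [TensorProduct.sum_tmul, TensorProduct.smul_tmul']
    rw [h2, LinearMap.sum_apply]
    refine U.sum_mem fun n _ => U.smul_mem _ ?_
    have hn : π n = 1 := n.2
    have h3 := hU ⟨n, by rw [Subgroup.mem_comap, hn]; exact H.one_mem⟩ u hu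
    have h4 : ρE ⟨π n, by rw [hn]; exact H.one_mem⟩ = LinearMap.id := by
      rw [show LinearMap.id = (1 : E →ₗ[ℂ] E) from rfl, ← hE.one]; congr 1; ext; simp [hn]
    rw [tens] at h3
    simp only [h4, hL.ext n hn] at h3
    exact h3
  rcases hi.2 E' hinv with h0 | h1
  · exfalso
    apply hb
    rw [eq_bot_iff]
    intro u hu
    let c : Fin (Module.finrank ℂ W) → (W ⊗[ℂ] E →ₗ[ℂ] E) := fun j =>
      (TensorProduct.lid ℂ E).toLinearMap ∘ₗ TensorProduct.map (b.coord j) LinearMap.id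
    have hmap : ∀ j w, TensorProduct.map ((b.coord j).smulRight w) LinearMap.id =
        TensorProduct.mk ℂ W E w ∘ₗ c j := by
      intro j w
      refine TensorProduct.ext' fun w' x => ?_
      simp [c, TensorProduct.smul_tmul]
    have hcz : ∀ j, c j u = 0 := by
      intro j
      have : c j u ∈ E' := by
        rw [hE']
        intro w
        have := hburn ((b.coord j).smulRight w) u hu
        rwa [hmap] at this
      rw [h0] at this
      simpa using this
    have hid : (LinearMap.id : W ⊗[ℂ] E →ₗ[ℂ] W ⊗[ℂ] E) =
        ∑ j, TensorProduct.mk ℂ W E (b j) ∘ₗ c j := by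
      refine TensorProduct.ext' fun w x => ?_
      simp only [← hmap, LinearMap.sum_apply, TensorProduct.map_tmul, LinearMap.id_apply,
        ← TensorProduct.sum_tmul]
      congr 1
      simp
    have := LinearMap.congr_fun hid u
    rw [LinearMap.id_apply] at this
    rw [Submodule.mem_bot, this]
    simp [hcz]
  · rw [eq_top_iff]
    intro z _
    induction z using TensorProduct.induction_on with
    | zero => exact U.zero_mem
    | tmul w x => exact (hE' x).1 (h1 ▸ Submodule.mem_top) w
    | add x y hx hy => exact U.add_mem (hx trivial) (hy trivial)

/-- common dimension formula -/
theorem clifford_formula [Finite G] [FiniteDimensional ℂ W] [FiniteDimensional ℂ V]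
    {π : G →* K} (hπ : Function.Surjective π)
    {θ : G → W →ₗ[ℂ] W} {H : Subgroup K}
    {A : G → W →ₗ[ℂ] W} {β : K → K → ℂ} (hθ : NRep π θ) (hL : CLift π θ H A β)
    {ρE : H → E →ₗ[ℂ] E} (hE : PRep (alp H β) ρE) (hi : Irr ρE)
    {ρ : G → V →ₗ[ℂ] V} (h : PRep (fun _ _ => 1) ρ) (hV : Irr ρ)
    (ψ : W ⊗[ℂ] E →ₗ[ℂ] V) (hψ : ψ ≠ 0)
    (hψe : ∀ (g : H.comap π) z, ψ (tens π H A ρE g z) = ρ g (ψ z)) :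
    Module.finrank ℂ V = H.index * (Module.finrank ℂ W * Module.finrank ℂ E) := by
  have hti := tens_irr hπ hθ hL hE hi
  have hinj : Function.Injective ψ := hti.inj (ρ' := fun g : H.comap π => ρ g) ψ hψe hψ
  obtain ⟨T, hT⟩ := theta_proj hθ h
  have hφ : ∀ x : E, ∀ n, π n = 1 → ∀ w, ψ (θ n w ⊗ₜ x) = ρ n (ψ (w ⊗ₜ x)) := by
    intro x n hn w
    have hnH : n ∈ H.comap π := by rw [Subgroup.mem_comap, hn]; exact H.one_mem
    have := hψe ⟨n, hnH⟩ (w ⊗ₜ x)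
    rw [← this, tens, TensorProduct.map_tmul, hL.ext n hn]
    have h4 : ρE ⟨π n, by rw [hn]; exact H.one_mem⟩ = 1 := by
      rw [← hE.one]; congr 1; ext; simp [hn]
    rw [h4]; rfl
  have hT' := fun x => hT (ψ ∘ₗ (TensorProduct.mk ℂ W E).flip x) (fun n hn w => hφ x n hn w)
  have hd := clifford_dim h hV (H.comap π) (LinearMap.range ψ)
    (by rwa [Ne, LinearMap.range_eq_bot]) (by
      rintro g hg _ ⟨z, rfl⟩
      exact ⟨_, hψe ⟨g, hg⟩ z⟩) T (by
      rintro _ ⟨z, rfl⟩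
      induction z using TensorProduct.induction_on with
      | zero => simp
      | tmul w x => exact (hT' x).1 w
      | add x y hx hy => rw [map_add, map_add, hx, hy]) (by
      rintro g hg _ ⟨z, rfl⟩
      rw [Subgroup.mem_comap, hL.stab] at hg
      induction z using TensorProduct.induction_on with
      | zero => simp
      | tmul w x => exact (hT' x).2 g hg w
      | add x y hx hy => rw [map_add, map_add, map_add, hx, hy, add_zero])
  rw [hd, Subgroup.index_comap_of_surjective H hπ, LinearMap.finrank_range_of_inj hinj,
    Module.finrank_tensorProduct]
end Cliff

end

section
open CategoryTheory TensorProduct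

section CliffUp
variable {G K : Type} [Group G] [Group K] {W : Type} [AddCommGroup W] [Module ℂ W]
  {V : Type} [AddCommGroup V] [Module ℂ V]
variable {E : Type} [AddCommGroup E] [Module ℂ E]

theorem clifford_up [Finite G] [FiniteDimensional ℂ W] [FiniteDimensional ℂ E]
    {π : G →* K} (hπ : Function.Surjective π)
    {θ : G → W →ₗ[ℂ] W} {H : Subgroup K}
    {A : G → W →ₗ[ℂ] W} {β : K → K → ℂ} (hθ : NRep π θ) (hL : CLift π θ H A β)
    {ρE : H → E →ₗ[ℂ] E} (hE : PRep (alp H β) ρE) (hi : Irr ρE) :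
    H.index * (Module.finrank ℂ W * Module.finrank ℂ E) ∈ charDegrees G := by
  classical
  cases nonempty_fintype G
  have hti := tens_irr hπ hθ hL hE hi
  have htp := tens_prep hθ hL hE
  have hnt := hti.1
  let r : G → (G → W ⊗[ℂ] E) →ₗ[ℂ] (G → W ⊗[ℂ] E) := fun g =>
    { toFun := fun f x => f (x * g)
      map_add' := fun _ _ => rfl
      map_smul' := fun _ _ => rfl }
  have hr : PRep (fun _ _ => 1) r := by
    refine ⟨by simp, ?_, fun s t => ?_⟩
    · refine LinearMap.ext fun f => funext fun x => ?_
      simp [r]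
    · refine LinearMap.ext fun f => funext fun x => ?_
      simp [r, mul_assoc]
  let φ : W ⊗[ℂ] E →ₗ[ℂ] (G → W ⊗[ℂ] E) := LinearMap.pi fun x =>
    if hx : x ∈ H.comap π then tens π H A ρE ⟨x, hx⟩ else 0
  have hφe : ∀ (g : H.comap π) y, φ (tens π H A ρE g y) = r g (φ y) := by
    intro g y
    funext x
    change φ _ x = φ y (x * g)
    simp only [φ, LinearMap.pi_apply]
    by_cases hx : x ∈ H.comap π
    · rw [dif_pos hx, dif_pos ((H.comap π).mul_mem hx g.2)]
      have := LinearMap.congr_fun (htp.mul ⟨x, hx⟩ g) y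
      rw [one_smul] at this
      exact this
    · rw [dif_neg hx, dif_neg (fun h => hx (by
        simpa using (H.comap π).mul_mem h ((H.comap π).inv_mem g.2)))]
      rfl
  obtain ⟨y, hy⟩ := exists_ne (0 : W ⊗[ℂ] E)
  have hφy : φ y ≠ 0 := by
    intro h0
    have h1 : φ y 1 = 0 := by rw [h0]; rfl
    simp only [φ, LinearMap.pi_apply] at h1
    rw [dif_pos (H.comap π).one_mem] at h1
    have := htp.one
    rw [show (⟨1, (H.comap π).one_mem⟩ : H.comap π) = 1 from rfl, this] at h1
    exact hy h1
  obtain ⟨V, _, _, _, ρ, p, hV, hVi, hp, hp0⟩ := hr.exists_irr _ rfl (φ y) hφy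
  have := clifford_formula hπ hθ hL hE hi hV hVi (p ∘ₗ φ)
    (fun h => hp0 (by rw [← LinearMap.comp_apply, h]; rfl))
    (fun g z => by rw [LinearMap.comp_apply, hφe, hp]; rfl)
  rw [mem_cd]
  exact ⟨V, _, _, inferInstance, ρ, hV, hVi, this⟩

theorem PRep.sect [Fintype K] {α : K → K → ℂ} {ρ : K → E →ₗ[ℂ] E} {ρ' : K → V →ₗ[ℂ] V}
    (h : PRep α ρ) (h' : PRep α ρ') (hi : Irr ρ') (p : E →ₗ[ℂ] V)
    (hp : ∀ g w, p (ρ g w) = ρ' g (p w)) (h0 : p ≠ 0) :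
    ∃ i : V →ₗ[ℂ] E, (∀ g w, i (ρ' g w) = ρ g (i w)) ∧ ∀ v, p (i v) = v := by
  have hs : LinearMap.range p = ⊤ := by
    refine (hi.2 _ ?_).resolve_left (fun hb => h0 (LinearMap.range_eq_bot.1 hb))
    rintro g _ ⟨w, rfl⟩
    exact ⟨_, hp g w⟩
  obtain ⟨j, hj⟩ := p.exists_rightInverse_of_surjective hs
  have hK : (Fintype.card K : ℂ) ≠ 0 := by simp
  refine ⟨(Fintype.card K : ℂ)⁻¹ • avg α ρ' ρ j, fun g w => ?_, fun v => ?_⟩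
  · have := LinearMap.congr_fun (avg_comm h' h j g) w
    simp only [LinearMap.comp_apply] at this
    simp only [LinearMap.smul_apply, map_smul, this]
  · have : ∀ g, p (ρ g (j (pinv α ρ' g v))) = v := by
      intro g
      rw [hp, ← LinearMap.comp_apply p j, hj, LinearMap.id_apply, ← Module.End.mul_apply,
        h'.mul_pinv]
      rfl
    simp only [LinearMap.smul_apply, avg, LinearMap.sum_apply, LinearMap.comp_apply, map_smul,
      map_sum, this, Finset.sum_const, Finset.card_univ]
    rw [← Nat.cast_smul_eq_nsmul ℂ, smul_smul, inv_mul_cancel₀ hK, one_smul]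

theorem NRep.ofKer {π : G →* K} {θ : π.ker → W →ₗ[ℂ] W} (h : PRep (fun _ _ => 1) θ) (hi : Irr θ) :
    ∃ θ' : G → W →ₗ[ℂ] W, NRep π θ' ∧ ∀ n : π.ker, θ' n = θ n := by
  classical
  have h2 : ∀ n : π.ker, (fun g : G => if hg : g ∈ π.ker then θ ⟨g, hg⟩ else 0) n = θ n := by
    intro n; simp
  refine ⟨fun g => if hg : g ∈ π.ker then θ ⟨g, hg⟩ else 0, ⟨?_, ?_, ?_⟩, h2⟩
  · exact (h2 1).trans h.one
  · intro n m hn hm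
    have := h.mul ⟨n, hn⟩ ⟨m, hm⟩
    rw [one_smul] at this
    exact (congrArg₂ _ (h2 ⟨n, hn⟩) (h2 ⟨m, hm⟩)).trans (this.trans (h2 _).symm)
  · have : (fun n : π.ker => (fun g : G => if hg : g ∈ π.ker then θ ⟨g, hg⟩ else 0) n) = θ :=
      funext h2
    rw [this]
    exact hi

theorem clifford_down [Finite G] [Finite K] [FiniteDimensional ℂ V]
    {π : G →* K} (hπ : Function.Surjective π)
    {ρ : G → V →ₗ[ℂ] V} (h : PRep (fun _ _ => 1) ρ) (hV : Irr ρ) :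
    ∃ (W : Type) (_ : AddCommGroup W) (_ : Module ℂ W) (_ : FiniteDimensional ℂ W)
      (θ : G → W →ₗ[ℂ] W), NRep π θ ∧ Module.finrank ℂ V ∣ Nat.card K * Module.finrank ℂ W := by
  classical
  cases nonempty_fintype G
  have hntV := hV.1
  obtain ⟨v, hv⟩ := exists_ne (0 : V)
  have hres : PRep (fun _ _ => 1) (fun n : π.ker => ρ n) :=
    ⟨by simp, h.one, fun s t => by rw [h.mul]; rfl⟩
  obtain ⟨W, _, _, _, θ0, p, hW, hWi, hp, hp0⟩ := hres.exists_irr _ rfl v hv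
  obtain ⟨i0, hi0, hpi⟩ := hres.sect hW hWi p hp (fun h => hp0 (by rw [h]; rfl))
  obtain ⟨θ, hθ, hθ0⟩ := NRep.ofKer hW hWi
  have hntW := hWi.1
  refine ⟨W, _, _, inferInstance, θ, hθ, ?_⟩
  obtain ⟨H, A, β, hL⟩ := exists_lift hπ hθ
  have hco := hL.cocyc hπ hθ
  have hco1 : ∀ s, alp H β s 1 = 1 := by
    intro s
    have := hco.coc s 1 1
    rw [hco.one, mul_one, mul_one, mul_one] at this
    have h2 := hco.ne s 1
    field_simp at this
    simpa using this
  let Ap := fun g : H.comap π => A g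
  let βp := fun s t : H.comap π => β (π s) (π t)
  have hA : PRep βp Ap := hL.aprep hθ
  let P := pinv βp Ap
  let X : Submodule ℂ (W →ₗ[ℂ] V) :=
    { carrier := {φ | ∀ n, π n = 1 → ∀ w, φ (θ n w) = ρ n (φ w)}
      add_mem' := fun {a b} ha hb n hn w => by simp [ha n hn w, hb n hn w]
      zero_mem' := fun n hn w => by simp
      smul_mem' := fun c a ha n hn w => by simp [ha n hn w] }
  have hm : ∀ s t v, ρ s (ρ t v) = ρ (s * t) v := by
    intro s t v
    have := LinearMap.congr_fun (h.mul s t) v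
    simpa using this
  have hPA : ∀ g w, P g (Ap g w) = w := fun g w => LinearMap.congr_fun (hA.pinv_mul g) w
  have hAP : ∀ g w, Ap g (P g w) = w := fun g w => LinearMap.congr_fun (hA.mul_pinv g) w
  let C0 : H.comap π → (W →ₗ[ℂ] V) →ₗ[ℂ] (W →ₗ[ℂ] V) := fun g =>
    { toFun := fun φ => ρ g ∘ₗ φ ∘ₗ P g
      map_add' := fun _ _ => by ext; simp
      map_smul' := fun _ _ => by ext; simp }
  have hC0 : ∀ g φ w, C0 g φ w = ρ g (φ (P g w)) := fun _ _ _ => rfl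
  have hCX : ∀ g, ∀ φ ∈ X, C0 g φ ∈ X := by
    intro g φ hφ n hn w
    rw [hC0, hC0]
    have h1 := ker_conj' (g : G) hn
    have h2 := hL.comm g _ g.2 h1
    have h3 : P g (θ n w) = θ ((g : G)⁻¹ * n * g) (P g w) := by
      apply hA.inj g
      rw [hAP]
      have := LinearMap.congr_fun h2 (P g w)
      simp only [Module.End.mul_apply] at this
      change _ = A g _
      rw [this]
      change _ = θ _ (Ap g _)
      rw [hAP]
      congr 2; group
    rw [h3, hφ _ h1, hm, hm]
    congr 2; group
  have hCmul : ∀ g k φ w, C0 g (C0 k φ) w = (β (π g) (π k))⁻¹ • C0 (g * k) φ w := by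
    intro g k φ w
    rw [hC0, hC0, hC0, hm]
    have := LinearMap.congr_fun (hA.pinv_mul_pinv g k) w
    change P k (P g w) = (β (π g) (π k))⁻¹ • P (g * k) w at this
    rw [this, map_smul, map_smul]
    rfl
  have hCk : ∀ g : H.comap π, π g = 1 → ∀ φ ∈ X, ∀ w, C0 g φ w = φ w := by
    intro g hg φ hφ w
    rw [hC0, ← hφ g hg, ← hL.ext g hg]
    exact congrArg φ (hAP g w)
  have hCeq : ∀ g k : H.comap π, π g = π k → ∀ φ ∈ X, ∀ w, C0 g φ w = C0 k φ w := by
    intro g k hgk φ hφ w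
    have h1 := hCmul g (g⁻¹ * k) φ w
    have h2 : C0 (g⁻¹ * k) φ = φ := LinearMap.ext (hCk _ (by simp [hgk]) φ hφ)
    have h3 : (β (π g) (π (g⁻¹ * k : H.comap π)))⁻¹ = 1 := by
      have := hco1 ⟨π g, g.2⟩
      rw [alp] at this
      rw [← this]
      congr 2
      simp [hgk]
    rw [h2, h3, one_smul, mul_inv_cancel_left] at h1
    exact h1
  have hσ : ∀ s : H, ∃ g : H.comap π, π g = s := by
    intro s
    obtain ⟨g, hg⟩ := hπ s
    exact ⟨⟨g, by rw [Subgroup.mem_comap, hg]; exact s.2⟩, hg⟩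
  choose σ hσ using hσ
  let B : H → X →ₗ[ℂ] X := fun s => (C0 (σ s)).restrict (hCX (σ s))
  have hB : ∀ s (φ : X) w, (B s φ : W →ₗ[ℂ] V) w = C0 (σ s) φ w := fun _ _ _ => rfl
  have hBp : PRep (alp H β) B := by
    refine ⟨hco.ne, ?_, fun s t => ?_⟩
    · refine LinearMap.ext fun φ => Subtype.ext (LinearMap.ext fun w => ?_)
      exact hCk _ (by rw [hσ]; rfl) _ φ.2 _
    · refine LinearMap.ext fun φ => Subtype.ext (LinearMap.ext fun w => ?_)
      have h1 := hCmul (σ s) (σ t) φ w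
      rw [hCeq (σ s * σ t) (σ (s * t)) (by simp [hσ]) φ φ.2 w, hσ, hσ] at h1
      exact h1
  let φ0 : X := ⟨i0, fun n hn w => by rw [← hi0 ⟨n, hn⟩]; exact congrArg i0 (LinearMap.congr_fun (hθ0 ⟨n, hn⟩) w)⟩
  have hφ0 : φ0 ≠ 0 := by
    intro h0
    have h1 : i0 = 0 := congrArg Subtype.val h0
    obtain ⟨w, hw⟩ := exists_ne (0 : W)
    apply hw
    rw [← hpi w, h1]; simp
  cases nonempty_fintype H
  obtain ⟨E, _, _, _, ρE, q, hE, hEi, hq, hq0⟩ := hBp.exists_irr _ rfl φ0 hφ0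
  obtain ⟨i, hie, hqi⟩ := hBp.sect hE hEi q hq (fun h => hq0 (by rw [h]; rfl))
  have hntE := hEi.1
  let ψ : W ⊗[ℂ] E →ₗ[ℂ] V := TensorProduct.lift (X.subtype ∘ₗ i).flip
  have hψ : ∀ w x, ψ (w ⊗ₜ x) = (i x : W →ₗ[ℂ] V) w := fun w x => by simp [ψ]
  have hfo := clifford_formula hπ hθ hL hE hEi h hV ψ (by
    intro h0
    obtain ⟨x, hx⟩ := exists_ne (0 : E)
    apply hx
    rw [← hqi x]
    have : i x = 0 := Subtype.ext (LinearMap.ext fun w => by rw [← hψ, h0]; rfl)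
    rw [this, map_zero]) (by
    intro g z
    induction z using TensorProduct.induction_on with
    | zero => simp
    | add x y hx hy => rw [map_add, map_add, hx, hy, map_add, map_add]
    | tmul w x =>
      rw [tens, TensorProduct.map_tmul, hψ, hψ, hie, hB, hCeq _ g (by rw [hσ]) _ (i x).2, hC0]
      congr 2
      exact hPA g w)
  obtain ⟨c, hc⟩ := degree_dvd hE hEi
  rw [hfo, ← H.index_mul_card, hc]
  exact ⟨c, by ring⟩

/-- lifting degrees from a normal subgroup -/
theorem exists_alp_irr [Finite K] {H : Subgroup K} {β : K → K → ℂ} (h : Cocyc (alp H β)) :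
    ∃ (E : Type) (_ : AddCommGroup E) (_ : Module ℂ E) (_ : FiniteDimensional ℂ E)
      (ρE : H → E →ₗ[ℂ] E), PRep (alp H β) ρE ∧ Irr ρE := by
  classical
  cases nonempty_fintype H
  obtain ⟨E, _, _, _, ρE, q, hE, hEi, hq, hq0⟩ := (treg_prep h).exists_irr _ rfl
    (Pi.single 1 1 : H → ℂ) (by simp)
  exact ⟨E, _, _, inferInstance, ρE, hE, hEi⟩

theorem cd_normal [Finite G] (N : Subgroup G) [N.Normal] {n : ℕ} (hn : n ∈ charDegrees N) :
    ∃ m ∈ charDegrees G, n ∣ m := by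
  have hN : (QuotientGroup.mk' N).ker = N := QuotientGroup.ker_mk' N
  have hn' : n ∈ charDegrees (QuotientGroup.mk' N).ker := by rwa [hN]
  rw [mem_cd] at hn'
  obtain ⟨W, _, _, _, θ, h, hi, rfl⟩ := hn'
  obtain ⟨θ', hθ, -⟩ := NRep.ofKer h hi
  have hπ := QuotientGroup.mk'_surjective N
  obtain ⟨H, A, β, hL⟩ := exists_lift hπ hθ
  obtain ⟨E, _, _, _, ρE, hE, hEi⟩ := exists_alp_irr (hL.cocyc hπ hθ)
  exact ⟨_, clifford_up hπ hθ hL hE hEi, ⟨H.index * Module.finrank ℂ E, by ring⟩⟩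
end CliffUp

end

section
open CategoryTheory

section SL
variable {F : Type} [Field F]

abbrev SLF (F : Type) [Field F] := Matrix.SpecialLinearGroup (Fin 2) F

def xx (u : F) : SLF F := ⟨!![1, u; 0, 1], by simp [Matrix.det_fin_two]⟩
def yy (u : F) : SLF F := ⟨!![1, 0; u, 1], by simp [Matrix.det_fin_two]⟩

def hh : Fˣ →* SLF F where
  toFun s := ⟨!![(s : F), 0; 0, ((s⁻¹ : Fˣ) : F)], by simp [Matrix.det_fin_two]⟩
  map_one' := by ext i j; fin_cases i <;> fin_cases j <;> simp
  map_mul' s t := by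
    refine Subtype.ext ?_
    change _ = !![(s : F), 0; 0, ((s⁻¹ : Fˣ) : F)] * !![(t : F), 0; 0, ((t⁻¹ : Fˣ) : F)]
    ext i j; fin_cases i <;> fin_cases j <;> simp [mul_comm]

theorem sl_ext {a b : SLF F} (h1 : a 0 0 = b 0 0) (h2 : a 0 1 = b 0 1) (h3 : a 1 0 = b 1 0)
    (h4 : a 1 1 = b 1 1) : a = b := by
  ext i j; fin_cases i <;> fin_cases j <;> assumption

theorem sl_det (a : SLF F) : a 0 0 * a 1 1 - a 0 1 * a 1 0 = 1 := by
  have := a.2; rwa [Matrix.det_fin_two] at this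

@[simp] theorem sl_m00 (a b : SLF F) : (a * b) 0 0 = a 0 0 * b 0 0 + a 0 1 * b 1 0 := by
  simp [Matrix.mul_apply, Fin.sum_univ_two]
@[simp] theorem sl_m01 (a b : SLF F) : (a * b) 0 1 = a 0 0 * b 0 1 + a 0 1 * b 1 1 := by
  simp [Matrix.mul_apply, Fin.sum_univ_two]
@[simp] theorem sl_m10 (a b : SLF F) : (a * b) 1 0 = a 1 0 * b 0 0 + a 1 1 * b 1 0 := by
  simp [Matrix.mul_apply, Fin.sum_univ_two]
@[simp] theorem sl_m11 (a b : SLF F) : (a * b) 1 1 = a 1 0 * b 0 1 + a 1 1 * b 1 1 := by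
  simp [Matrix.mul_apply, Fin.sum_univ_two]
@[simp] theorem sl_i00 (a : SLF F) : a⁻¹ 0 0 = a 1 1 := by
  rw [Matrix.SpecialLinearGroup.SL2_inv_expl]; rfl
@[simp] theorem sl_i01 (a : SLF F) : a⁻¹ 0 1 = - a 0 1 := by
  rw [Matrix.SpecialLinearGroup.SL2_inv_expl]; rfl
@[simp] theorem sl_i10 (a : SLF F) : a⁻¹ 1 0 = - a 1 0 := by
  rw [Matrix.SpecialLinearGroup.SL2_inv_expl]; rfl
@[simp] theorem sl_i11 (a : SLF F) : a⁻¹ 1 1 = a 0 0 := by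
  rw [Matrix.SpecialLinearGroup.SL2_inv_expl]; rfl
@[simp] theorem sl_o00 : (1 : SLF F) 0 0 = 1 := by simp
@[simp] theorem sl_o01 : (1 : SLF F) 0 1 = 0 := by simp
@[simp] theorem sl_o10 : (1 : SLF F) 1 0 = 0 := by simp
@[simp] theorem sl_o11 : (1 : SLF F) 1 1 = 1 := by simp
@[simp] theorem xx00 (u : F) : xx u 0 0 = 1 := rfl
@[simp] theorem xx01 (u : F) : xx u 0 1 = u := rfl
@[simp] theorem xx10 (u : F) : xx u 1 0 = 0 := rfl
@[simp] theorem xx11 (u : F) : xx u 1 1 = 1 := rfl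
@[simp] theorem yy00 (u : F) : yy u 0 0 = 1 := rfl
@[simp] theorem yy01 (u : F) : yy u 0 1 = 0 := rfl
@[simp] theorem yy10 (u : F) : yy u 1 0 = u := rfl
@[simp] theorem yy11 (u : F) : yy u 1 1 = 1 := rfl
@[simp] theorem hh00 (s : Fˣ) : hh s 0 0 = s := rfl
@[simp] theorem hh01 (s : Fˣ) : hh s 0 1 = 0 := rfl
@[simp] theorem hh10 (s : Fˣ) : hh s 1 0 = 0 := rfl
@[simp] theorem hh11 (s : Fˣ) : hh s 1 1 = ((s⁻¹ : Fˣ) : F) := rfl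

theorem xx_add (u v : F) : xx (u + v) = xx u * xx v := by
  apply sl_ext <;> simp [add_comm]
theorem xx_zero : xx (0 : F) = 1 := by apply sl_ext <;> simp
theorem yy_add (u v : F) : yy (u + v) = yy u * yy v := by
  apply sl_ext <;> simp
theorem yy_zero : yy (0 : F) = 1 := by apply sl_ext <;> simp
theorem xx_inj : Function.Injective (xx : F → SLF F) := fun u v h => by
  have := congrArg (fun a : SLF F => a 0 1) h; simpa using this
theorem hh_inj : Function.Injective (hh : Fˣ → SLF F) := fun u v h => by
  have := congrArg (fun a : SLF F => a 0 0) h; exact Units.ext (by simpa using this)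

theorem hh_xx (s : Fˣ) (u : F) : hh s * xx u = xx (((s ^ 2 : Fˣ) : F) * u) * hh s := by
  apply sl_ext <;> simp
  field_simp

theorem hh_mul_xx_eq_one (s : Fˣ) (u : F) (h : hh s * xx u = 1) : s = 1 ∧ u = 0 := by
  have h1 := congrArg (fun a : SLF F => a 0 0) h
  have h2 := congrArg (fun a : SLF F => a 0 1) h
  simp at h1 h2
  exact ⟨h1, h2⟩

theorem bor (k : SLF F) (h : k 1 0 = 0) : ∃ s u, k = hh s * xx u := by
  have hd := sl_det k
  rw [h, mul_zero, sub_zero] at hd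
  have h0 : k 0 0 ≠ 0 := left_ne_zero_of_mul_eq_one hd
  refine ⟨Units.mk0 _ h0, k 0 1 / k 0 0, ?_⟩
  apply sl_ext <;> simp [h]
  · field_simp
  · exact eq_inv_of_mul_eq_one_right hd

theorem xyx (k : SLF F) (h : k 1 0 ≠ 0) : ∃ u c v, k = xx u * yy c * xx v := by
  have hd := sl_det k
  refine ⟨(k 0 0 - 1) / k 1 0, k 1 0, (k 1 1 - 1) / k 1 0, ?_⟩
  apply sl_ext <;> simp <;> field_simp <;> first | ring1 | linear_combination hd | linear_combination -hd

theorem sl_gen (H : Subgroup (SLF F)) (h1 : ∀ u, xx u ∈ H) (h2 : ∀ u, yy u ∈ H) : H = ⊤ := by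
  have key : ∀ k : SLF F, k 1 0 ≠ 0 → k ∈ H := by
    intro k hk
    obtain ⟨u, c, v, rfl⟩ := xyx k hk
    exact H.mul_mem (H.mul_mem (h1 _) (h2 _)) (h1 _)
  rw [eq_top_iff]
  intro k _
  by_cases hk : k 1 0 = 0
  · have hd := sl_det k
    rw [hk, mul_zero, sub_zero] at hd
    have : k * yy 1 ∈ H := key _ (by simp [hk]; exact right_ne_zero_of_mul_eq_one hd)
    have := H.mul_mem this (H.inv_mem (h2 1))
    simpa using this
  · exact key k hk

variable [CharP F 2]

def ww : SLF F := ⟨!![0, 1; 1, 0], by simp [Matrix.det_fin_two, CharTwo.neg_eq]⟩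
@[simp] theorem ww00 : (ww : SLF F) 0 0 = 0 := rfl
@[simp] theorem ww01 : (ww : SLF F) 0 1 = 1 := rfl
@[simp] theorem ww10 : (ww : SLF F) 1 0 = 1 := rfl
@[simp] theorem ww11 : (ww : SLF F) 1 1 = 0 := rfl

theorem ww_mul : (ww : SLF F) * ww = 1 := by apply sl_ext <;> simp
theorem ww_inv : (ww : SLF F)⁻¹ = ww := inv_eq_of_mul_eq_one_left ww_mul
theorem ww_xx (u : F) : ww * xx u * ww⁻¹ = yy u := by rw [ww_inv]; apply sl_ext <;> simp
theorem ww_yy (u : F) : ww * yy u * ww⁻¹ = xx u := by rw [ww_inv]; apply sl_ext <;> simp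
theorem ww_hh (s : Fˣ) : ww * hh s * ww⁻¹ = hh s⁻¹ := by rw [ww_inv]; apply sl_ext <;> simp
theorem hh_ww_hh (s : Fˣ) : hh s * ww * hh s = ww := by apply sl_ext <;> simp

theorem bruhat (k : SLF F) (h : k 1 0 ≠ 0) : ∃ u s v, k = xx u * ww * hh s * xx v := by
  have hd := sl_det k
  rw [CharTwo.sub_eq_add] at hd
  refine ⟨k 0 0 / k 1 0, Units.mk0 _ h, k 1 1 / k 1 0, ?_⟩
  apply sl_ext <;> simp <;> field_simp
  have : k 0 1 * k 1 0 = 1 - k 0 0 * k 1 1 := by linear_combination hd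
  rw [this, CharTwo.sub_eq_add, add_comm]

theorem sl_normal (N : Subgroup (SLF F)) [N.Normal] (h1 : ∀ u, xx u ∈ N) : N = ⊤ :=
  sl_gen N h1 fun u => by
    rw [← ww_xx]; exact Subgroup.Normal.conj_mem inferInstance _ (h1 u) _

theorem sl_card [Fintype F] : Nat.card (SLF F) =
    Fintype.card F * ((Fintype.card F - 1) * (Fintype.card F + 1)) := by
  classical
  let f : (Fˣ × F) ⊕ (F × Fˣ × F) → SLF F := fun z => match z with
    | Sum.inl (s, u) => hh s * xx u
    | Sum.inr (u, s, v) => xx u * ww * hh s * xx v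
  have hf : Function.Bijective f := by
    constructor
    · rintro (⟨s, u⟩ | ⟨u, s, v⟩) (⟨s', u'⟩ | ⟨u', s', v'⟩) h
      · simp only [f] at h
        have h1 := congrArg (fun a : SLF F => a 0 0) h
        have h2 := congrArg (fun a : SLF F => a 0 1) h
        simp at h1 h2
        have h1 := Units.ext h1
        subst h1
        simpa using h2
      · simp only [f] at h
        have h1 := congrArg (fun a : SLF F => a 1 0) h
        simp at h1
        all_goals exact absurd h1.symm s'.ne_zero
      · simp only [f] at h
        have h1 := congrArg (fun a : SLF F => a 1 0) h
        simp at h1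
        all_goals exact absurd h1.symm s'.ne_zero
      · simp only [f] at h
        have h1 := congrArg (fun a : SLF F => a 1 0) h
        have h2 := congrArg (fun a : SLF F => a 0 0) h
        have h3 := congrArg (fun a : SLF F => a 1 1) h
        simp at h1
        have h1 := Units.ext h1
        subst h1
        simp at h2 h3
        rw [h2, h3]
    · intro k
      by_cases hk : k 1 0 = 0
      · obtain ⟨s, u, rfl⟩ := bor k hk
        exact ⟨Sum.inl (s, u), rfl⟩
      · obtain ⟨u, s, v, rfl⟩ := bruhat k hk
        exact ⟨Sum.inr (u, s, v), rfl⟩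
  rw [← Nat.card_eq_of_bijective f hf, Nat.card_eq_fintype_card, Fintype.card_sum,
    Fintype.card_prod, Fintype.card_prod, Fintype.card_prod, Fintype.card_units]
  ring

theorem sq_surj [Finite F] (s : Fˣ) : ∃ t : Fˣ, t ^ 2 = s := by
  have hi : Function.Injective (fun t : Fˣ => t ^ 2) := by
    intro a b h
    have : (a : F) ^ 2 = (b : F) ^ 2 := by exact_mod_cast congrArg Units.val h
    exact Units.ext (CharTwo.sq_injective this)
  exact (Finite.injective_iff_surjective.1 hi) s

theorem sq_inj (a b : Fˣ) (h : a ^ 2 = b ^ 2) : a = b := by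
  have : (a : F) ^ 2 = (b : F) ^ 2 := by exact_mod_cast congrArg Units.val h
  exact Units.ext (CharTwo.sq_injective this)
end SL

end

section
open CategoryTheory

section Gauge
variable {F : Type} [Field F] {K : Type} [Group K] {T : Type} [Group T]

structure XSys (x : F → K) (h : T →* K) (χ : T →* Fˣ) : Prop where
  add : ∀ u v, x (u + v) = x u * x v
  inj : Function.Injective x
  conj : ∀ t u, h t * x u = x ((χ t : F) * u) * h t

structure Good (x : F → K) (h : T →* K) (χ : T →* Fˣ) (α : K → K → ℂ) : Prop where
  xx : ∀ u v, α (x u) (x v) = 1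
  hx : ∀ t u, α (h t) (x u) = α (x ((χ t : F) * u)) (h t)

variable {x : F → K} {h : T →* K} {χ : T →* Fˣ} {α : K → K → ℂ}

theorem XSys.zero (hX : XSys x h χ) : x 0 = 1 := by
  have := hX.add 0 0
  rw [add_zero] at this
  exact left_eq_mul.1 this

theorem PRep.ne0 {E : Type} [AddCommGroup E] [Module ℂ E] [Nontrivial E] {ρ : K → E →ₗ[ℂ] E}
    (h : PRep α ρ) (g : K) : ρ g ≠ 0 := by
  intro h0
  have := h.mul_pinv g
  rw [h0, zero_mul] at this
  exact one_ne_zero this.symm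

/-- cancel: `a • (ρ s * ρ t) = b • (ρ s * ρ t)` gives `a = b` -/
theorem PRep.smul_cancel {E : Type} [AddCommGroup E] [Module ℂ E] [Nontrivial E]
    {ρ : K → E →ₗ[ℂ] E} (h : PRep α ρ) {a b : ℂ} {g : K} (hh : a • ρ g = b • ρ g) : a = b :=
  smul_left_injective ℂ (h.ne0 g) hh

theorem exists_gauge [Finite F] [CharP F 2] [Finite K] [Finite T] (hT : Odd (Nat.card T))
    (hX : XSys x h χ)
    (hα : Cocyc α) (hc : ∀ u v, α (x u) (x v) = α (x v) (x u)) :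
    ∃ κ : K → ℂ, (∀ s, κ s ≠ 0) ∧ κ 1 = 1 ∧
      Good x h χ (fun s t => κ s * κ t / κ (s * t) * α s t) := by
  classical
  cases nonempty_fintype F
  cases nonempty_fintype K
  cases nonempty_fintype T
  have x0 := hX.zero
  have hreg := treg_prep hα
  -- splitting on x(F)
  let xh : Multiplicative F →* K :=
    { toFun := fun u => x u.toAdd, map_one' := x0, map_mul' := fun u v => hX.add _ _ }
  have hr2 := hreg.comp xh
  obtain ⟨E, _, _, _, ρE, p, hE, hEi, -, -⟩ := hr2.exists_irr _ rfl (Pi.single 1 1 : K → ℂ) (by simp)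
  have hnt := hEi.1
  have hsc : ∀ u : Multiplicative F, ∃ c : ℂ, ρE u = c • 1 := fun u => hEi.scalar _ fun v => by
    rw [hE.mul, hE.mul, mul_comm u v]
    congr 1
    exact hc _ _
  choose l hl using hsc
  have hl0 : ∀ u, l u ≠ 0 := fun u h0 => hE.ne0 u (by rw [hl, h0, zero_smul])
  have hlm : ∀ u v : F, l (.ofAdd u) * l (.ofAdd v) = α (x u) (x v) * l (.ofAdd (u + v)) := by
    intro u v
    have := hE.mul (.ofAdd u) (.ofAdd v)
    rw [hl, hl, hl, smul_mul_smul_comm, mul_one, smul_smul] at this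
    exact smul_left_injective ℂ (one_ne_zero (α := E →ₗ[ℂ] E)) this
  have hl1 : l (.ofAdd 0) = 1 := by
    have h1 := hE.one
    have : ρE (.ofAdd (0 : F)) = 1 := h1
    rw [hl] at this
    exact smul_left_injective ℂ (one_ne_zero (α := E →ₗ[ℂ] E)) (by simpa using this)
  let k0 : F → ℂ := fun u => (l (.ofAdd u))⁻¹
  have hk0 : ∀ u, k0 u ≠ 0 := fun u => inv_ne_zero (hl0 _)
  have hk1 : k0 0 = 1 := by simp only [k0, hl1, inv_one]
  have hkm : ∀ u v, k0 u * k0 v * α (x u) (x v) = k0 (u + v) := by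
    intro u v
    have h1 := hlm u v
    have h2 := hl0 (.ofAdd u)
    have h3 := hl0 (.ofAdd v)
    have h4 := hl0 (.ofAdd (u + v))
    simp only [k0]
    field_simp
    rw [← h1]
  -- the operators
  let ρ := treg α
  let r : F → (K → ℂ) →ₗ[ℂ] (K → ℂ) := fun u => k0 u • ρ (x u)
  have hrm : ∀ u v, r u * r v = r (u + v) := by
    intro u v
    simp only [r]
    rw [smul_mul_smul_comm, hreg.mul, smul_smul, hkm, ← hX.add]
  let ε : T → F → ℂ := fun t u =>
    k0 u * α (h t) (x u) / (k0 ((χ t : F) * u) * α (x ((χ t : F) * u)) (h t))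
  have hε : ∀ t u, ρ (h t) * r u = ε t u • (r ((χ t : F) * u) * ρ (h t)) := by
    intro t u
    simp only [r, ε]
    rw [mul_smul_comm, hreg.mul, smul_mul_assoc, hreg.mul, smul_smul, smul_smul, smul_smul, hX.conj]
    congr 1
    have := hk0 ((χ t : F) * u)
    have := hα.ne (x ((χ t : F) * u)) (h t)
    field_simp
  have hcan : ∀ (a b : ℂ) u t, a • (r u * ρ (h t)) = b • (r u * ρ (h t)) → a = b := by
    intro a b u t hab
    simp only [r] at hab
    rw [smul_mul_assoc, hreg.mul] at hab
    simp only [smul_smul] at hab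
    have := hreg.smul_cancel hab
    exact mul_right_cancel₀ (mul_ne_zero (hk0 _) (hα.ne _ _)) (by simpa [mul_assoc] using this)
  have hεa : ∀ t u v, ε t (u + v) = ε t u * ε t v := by
    intro t u v
    apply hcan _ _ ((χ t : F) * (u + v)) t
    rw [← hε, ← hrm, ← mul_assoc, hε, smul_mul_assoc, mul_assoc, hε, mul_smul_comm, smul_smul,
      ← mul_assoc, hrm, mul_add]
  have hε0 : ∀ t, ε t 0 = 1 := by
    intro t
    apply hcan _ _ ((χ t : F) * 0) t
    rw [← hε, one_smul]
    simp [r, hk1, x0, ρ, hreg.one]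
  have hε2 : ∀ t u, ε t u * ε t u = 1 := by
    intro t u
    rw [← hεa, CharTwo.add_self_eq_zero, hε0]
  have hεm : ∀ t s u, ε (t * s) u = ε t ((χ s : F) * u) * ε s u := by
    intro t s u
    apply hcan _ _ ((χ (t * s) : F) * u) (t * s)
    rw [← hε]
    have h1 : ρ (h (t * s)) = (α (h t) (h s))⁻¹ • (ρ (h t) * ρ (h s)) := by
      rw [hreg.mul, smul_smul, inv_mul_cancel₀ (hα.ne _ _), one_smul, map_mul]
    rw [h1, smul_mul_assoc, mul_assoc, hε, mul_smul_comm, ← mul_assoc, hε, mul_smul_comm,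
      smul_mul_assoc, smul_smul, smul_smul, smul_smul, map_mul, Units.val_mul, mul_assoc, mul_assoc]
    congr 1
    · ring
    · rw [mul_assoc (χ t : F)]
  let Λ : F → ℂ := fun u => ∏ t, ε t u
  have hΛa : ∀ u v, Λ (u + v) = Λ u * Λ v := by
    intro u v; simp only [Λ, hεa, Finset.prod_mul_distrib]
  have hΛ1 : Λ 0 = 1 := by simp [Λ, hε0]
  have hε00 : ∀ t u, ε t u ≠ 0 := fun t u h0 => by have := hε2 t u; simp [h0] at this
  have hΛ0 : ∀ u, Λ u ≠ 0 := fun u => Finset.prod_ne_zero_iff.2 fun t _ => hε00 t u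
  have hΛs : ∀ s u, Λ ((χ s : F) * u) = Λ u * ε s u := by
    intro s u
    have h1 : Λ u = Λ ((χ s : F) * u) * ε s u ^ Fintype.card T := by
      simp only [Λ]
      rw [← Fintype.prod_equiv (Equiv.mulRight s) (fun t => ε (t * s) u) _ (fun _ => rfl)]
      simp only [hεm, Finset.prod_mul_distrib, Finset.prod_const, Finset.card_univ]
    obtain ⟨m, hm⟩ := hT
    rw [Nat.card_eq_fintype_card] at hm
    rw [hm, pow_succ, pow_mul, sq, hε2, one_pow, one_mul] at h1
    rw [h1, mul_assoc, hε2, mul_one]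
  let κ : K → ℂ := fun s => if hs : ∃ u, x u = s then Λ hs.choose * k0 hs.choose else 1
  have hκx : ∀ u, κ (x u) = Λ u * k0 u := by
    intro u
    have hs : ∃ v, x v = x u := ⟨u, rfl⟩
    simp only [κ]
    rw [dif_pos hs, hX.inj hs.choose_spec]
  have hκ0 : ∀ s, κ s ≠ 0 := by
    intro s
    simp only [κ]
    split_ifs with hs
    · exact mul_ne_zero (hΛ0 _) (hk0 _)
    · exact one_ne_zero
  refine ⟨κ, hκ0, by rw [← x0, hκx, hΛ1, hk1, one_mul], fun u v => ?_, fun t u => ?_⟩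
  · change κ (x u) * κ (x v) / κ (x u * x v) * α (x u) (x v) = 1
    rw [← hX.add, hκx, hκx, hκx, hΛa, ← hkm u v]
    have := hΛ0 u
    have := hΛ0 v
    have := hk0 u
    have := hk0 v
    have := hα.ne (x u) (x v)
    field_simp
  · change κ (h t) * κ (x u) / κ (h t * x u) * α (h t) (x u) = κ (x ((χ t : F) * u)) * κ (h t) / κ (x ((χ t : F) * u) * h t) * α (x ((χ t : F) * u)) (h t)
    rw [hX.conj, hκx, hκx, hΛs]
    simp only [ε]
    have := hκ0 (x ((χ t : F) * u) * h t)
    have := hk0 ((χ t : F) * u)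
    have := hα.ne (x ((χ t : F) * u)) (h t)
    field_simp
end Gauge

end

section
open CategoryTheory

section Fix
variable {F : Type} [Field F] {K : Type} [Group K] {T : Type} [Group T]
variable {x : F → K} {h : T →* K} {χ : T →* Fˣ} {α : K → K → ℂ}
variable {E : Type} [AddCommGroup E] [Module ℂ E] {ρ : K → E →ₗ[ℂ] E}

theorem comm_scalar (hX : XSys x h χ) (hα : Cocyc α) (hρ : PRep α ρ) (u v : F) :
    ρ (x u) * ρ (x v) = (α (x u) (x v) / α (x v) (x u)) • (ρ (x v) * ρ (x u)) := by
  rw [hρ.mul, hρ.mul, smul_smul, div_mul_cancel₀ _ (hα.ne _ _), ← hX.add, ← hX.add, add_comm]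

theorem comm_add [Nontrivial E] (hX : XSys x h χ) (hα : Cocyc α) (hρ : PRep α ρ) (u v w : F) :
    α (x (u + v)) (x w) / α (x w) (x (u + v)) =
    (α (x u) (x w) / α (x w) (x u)) * (α (x v) (x w) / α (x w) (x v)) := by
  have h1 := comm_scalar hX hα hρ u w
  have h2 := comm_scalar hX hα hρ v w
  have h3 := comm_scalar hX hα hρ (u + v) w
  set a := α (x u) (x w) / α (x w) (x u)
  set b := α (x v) (x w) / α (x w) (x v)
  set c := α (x (u + v)) (x w) / α (x w) (x (u + v))
  have e1 : ρ (x u) * ρ (x v) = α (x u) (x v) • ρ (x (u + v)) := by rw [hρ.mul, hX.add]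
  have e2 : (ρ (x u) * ρ (x v)) * ρ (x w) = (a * b) • (ρ (x w) * (ρ (x u) * ρ (x v))) := by
    rw [mul_assoc, h2, mul_smul_comm, ← mul_assoc, h1, smul_mul_assoc, smul_smul, mul_assoc,
      mul_comm b]
  rw [e1, smul_mul_assoc, h3, mul_smul_comm, smul_smul, smul_smul, hρ.mul, smul_smul, smul_smul] at e2
  have e3 := hρ.smul_cancel e2
  have := hα.ne (x u) (x v)
  have := hα.ne (x w) (x (u + v))
  exact mul_right_cancel₀ (mul_ne_zero (hα.ne (x u) (x v)) (hα.ne (x w) (x (u + v)))) (by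
    linear_combination e3)

theorem comm_odd [CharP F 2] [FiniteDimensional ℂ E] (hX : XSys x h χ) (hρ : PRep α ρ)
    (he : Odd (Module.finrank ℂ E)) (u v : F) : α (x u) (x v) = α (x v) (x u) := by
  have hnt : Nontrivial E := Module.nontrivial_of_finrank_pos (R := ℂ) he.pos
  have hα := hρ.cocyc
  have h1 := comm_scalar hX hα hρ u v
  have h2 := comm_add hX hα hρ u u v
  have h3 : x (u + u) = 1 := by rw [CharTwo.add_self_eq_zero, hX.zero]
  have h4 : ∀ s, α s 1 = 1 := by
    intro s
    have := hα.coc s 1 1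
    rw [hα.one, mul_one, mul_one, mul_one] at this
    have h2 := hα.ne s 1
    field_simp at this
    simpa using this
  rw [h3, hα.one, h4, div_one] at h2
  set c := α (x u) (x v) / α (x v) (x u) with hc
  have h5 := congrArg LinearMap.det h1
  rw [LinearMap.det_smul, map_mul, map_mul, mul_comm (LinearMap.det (ρ (x v)))] at h5
  have h6 : c ^ Module.finrank ℂ E = 1 := by
    have h7 : LinearMap.det (ρ (x u)) * LinearMap.det (ρ (x v)) ≠ 0 :=
      mul_ne_zero (hρ.det_ne _) (hρ.det_ne _)
    exact mul_right_cancel₀ h7 (by rw [← h5, one_mul])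
  obtain ⟨m, hm⟩ := he
  rw [hm, pow_succ, pow_mul, sq, ← h2, one_pow, one_mul] at h6
  rw [h6] at hc
  exact (div_eq_one_iff_eq (hα.ne _ _)).1 hc.symm

theorem comm_big [CharP F 2] [Fintype F] (h4 : 4 < Fintype.card F)
    (hX : XSys x h χ) (hχ : Function.Surjective χ) (hα : Cocyc α) (u v : F) :
    α (x u) (x v) = α (x v) (x u) := by
  classical
  have hreg := treg_prep hα
  set ρ := treg α
  have hnt : Nontrivial (K → ℂ) := Function.nontrivial
  obtain ⟨c, hcdef⟩ : ∃ c : F → F → ℂ, ∀ u v, c u v = α (x u) (x v) / α (x v) (x u) :=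
    ⟨_, fun _ _ => rfl⟩
  have c1 : ∀ u v w, c (u + v) w = c u w * c v w := by
    intro u v w; simp only [hcdef]; exact comm_add hX hα hreg u v w
  have cs : ∀ u v, c u v = (c v u)⁻¹ := by intro u v; simp only [hcdef, inv_div]
  have c2 : ∀ u v w, c w (u + v) = c w u * c w v := by
    intro u v w; rw [cs, c1, mul_inv, ← cs, ← cs]
  have c0 : ∀ u v, c u v ≠ 0 := fun u v => by
    rw [hcdef]; exact div_ne_zero (hα.ne _ _) (hα.ne _ _)
  have csc : ∀ (s : Fˣ) u v, c ((s : F) * u) ((s : F) * v) = c u v := by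
    intro s u v
    obtain ⟨t, rfl⟩ := hχ s
    have key : ∀ u, ∃ k : ℂ, k ≠ 0 ∧ ρ (h t) * ρ (x u) = k • (ρ (x ((χ t : F) * u)) * ρ (h t)) := by
      intro u
      refine ⟨α (h t) (x u) / α (x ((χ t : F) * u)) (h t), div_ne_zero (hα.ne _ _) (hα.ne _ _), ?_⟩
      rw [hreg.mul, hreg.mul, smul_smul, div_mul_cancel₀ _ (hα.ne _ _), hX.conj]
    obtain ⟨a, a0, ha⟩ := key u
    obtain ⟨b, b0, hb⟩ := key v
    have e1 := comm_scalar hX hα hreg u v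
    have e2 := comm_scalar hX hα hreg ((χ t : F) * u) ((χ t : F) * v)
    rw [← hcdef] at e1 e2
    have h1 : ∀ (u v : F) (a b : ℂ), ρ (h t) * ρ (x u) = a • (ρ (x ((χ t : F) * u)) * ρ (h t)) →
        ρ (h t) * ρ (x v) = b • (ρ (x ((χ t : F) * v)) * ρ (h t)) →
        ρ (h t) * (ρ (x u) * ρ (x v)) =
          (a * b) • (ρ (x ((χ t : F) * u)) * ρ (x ((χ t : F) * v)) * ρ (h t)) := by
      intro u v a b ha hb
      rw [← mul_assoc, ha, smul_mul_assoc, mul_assoc, hb, mul_smul_comm, smul_smul, mul_assoc]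
    have h2 := h1 u v a b ha hb
    have h3 := h1 v u b a hb ha
    rw [e1, mul_smul_comm, h3, e2, smul_mul_assoc, smul_smul, smul_smul, hreg.mul, smul_mul_assoc,
      hreg.mul] at h2
    simp only [smul_smul] at h2
    have h4 := hreg.smul_cancel h2
    have e : a * b * (α (x (↑(χ t) * v)) (x (↑(χ t) * u)) * α (x (↑(χ t) * v) * x (↑(χ t) * u)) (h t)) ≠ 0 :=
      mul_ne_zero (mul_ne_zero a0 b0) (mul_ne_zero (hα.ne _ _) (hα.ne _ _))
    exact (mul_right_cancel₀ e (by linear_combination h4)).symm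
  -- choose y with y^4 ≠ y
  obtain ⟨y, hy⟩ : ∃ y : F, y ^ 4 - y ≠ 0 := by
    by_contra hcon
    push Not at hcon
    have hp : (Polynomial.X ^ 4 - Polynomial.X : Polynomial F) ≠ 0 :=
      FiniteField.X_pow_card_sub_X_ne_zero F (by norm_num)
    have h1 : Finset.univ ⊆ (Polynomial.X ^ 4 - Polynomial.X : Polynomial F).roots.toFinset := by
      intro z _
      rw [Multiset.mem_toFinset, Polynomial.mem_roots hp]
      simp [hcon z]
    have h2 := Finset.card_le_card h1
    have h3 := Multiset.toFinset_card_le (Polynomial.X ^ 4 - Polynomial.X : Polynomial F).roots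
    have h5 := Polynomial.card_roots' (Polynomial.X ^ 4 - Polynomial.X : Polynomial F)
    rw [FiniteField.X_pow_card_sub_X_natDegree_eq F (by norm_num)] at h5
    rw [Finset.card_univ] at h2
    omega
  have e0 : y ≠ 0 := by rintro rfl; simp at hy
  have e1 : 1 + y ≠ 0 := by
    intro hh
    have : y = 1 := by rw [← CharTwo.sub_eq_add] at hh; exact (sub_eq_zero.1 hh).symm
    rw [this] at hy; simp at hy
  have e2 : y ^ 2 + y + 1 ≠ 0 := by
    intro hh
    apply hy
    have : y ^ 4 - y = (y ^ 2 - y) * (y ^ 2 + y + 1) := by ring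
    rw [this, hh, mul_zero]
  have cdiv : ∀ z w : F, z ≠ 0 → c z w = c 1 (w / z) := by
    intro z w hz
    have := csc (Units.mk0 z hz) 1 (w / z)
    rw [← this, Units.val_mk0, mul_one, mul_div_cancel₀ _ hz]
  have cone : ∀ w, c 1 w = 1 := by
    intro w
    set k := (y ^ 2 + y + 1) / (y * (1 + y)) with hk
    have hk0 : k ≠ 0 := div_ne_zero e2 (mul_ne_zero e0 e1)
    have h1 : w / k / (1 + y) = w / k + w / k / y + w := by
      have hw : w / k * k = w := div_mul_cancel₀ _ hk0
      set v := w / k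
      rw [← CharTwo.sub_eq_add _ w, ← hw, hk]
      field_simp
      ring
    have h2 := c1 1 y (w / k)
    rw [cdiv _ _ e1, cdiv _ _ e0, h1, c2, c2] at h2
    have h3 := mul_ne_zero (c0 1 (w / k)) (c0 1 (w / k / y))
    exact mul_left_cancel₀ h3 (by rw [h2, mul_one])
  have : c u v = 1 := by
    by_cases hu : u = 0
    · rw [cs, hu]
      have := c2 0 0 v
      rw [add_zero] at this
      rw [left_eq_mul₀ (c0 _ _)] at this
      rw [this, inv_one]
    · rw [cdiv _ _ hu, cone]
  rw [hcdef] at this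
  exact (div_eq_one_iff_eq (hα.ne _ _)).1 this

end Fix

end

section
open CategoryTheory

section Fix2
variable {F : Type} [Field F] {K : Type} [Group K] {T : Type} [Group T]
variable {x : F → K} {h : T →* K} {χ : T →* Fˣ} {α : K → K → ℂ}
variable {E : Type} [AddCommGroup E] [Module ℂ E] {ρ : K → E →ₗ[ℂ] E}

def fixP (x : F → K) (ρ : K → E →ₗ[ℂ] E) : Submodule ℂ E where
  carrier := {v | ∀ u, ρ (x u) v = v}
  add_mem' := fun {a b} ha hb u => by rw [map_add, ha u, hb u]
  zero_mem' := fun u => map_zero _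
  smul_mem' := fun c a ha u => by rw [map_smul, ha u]

noncomputable def eP [Fintype F] (x : F → K) (ρ : K → E →ₗ[ℂ] E) : E →ₗ[ℂ] E :=
  (Fintype.card F : ℂ)⁻¹ • ∑ u, ρ (x u)

theorem good_mul (hX : XSys x h χ) (hG : Good x h χ α) (hρ : PRep α ρ) (u v : F) :
    ρ (x u) * ρ (x v) = ρ (x (u + v)) := by
  rw [hρ.mul, hG.xx, one_smul, hX.add]

theorem good_comm (hX : XSys x h χ) (hG : Good x h χ α) (hρ : PRep α ρ) (t : T) (u : F) :
    ρ (h t) * ρ (x u) = ρ (x ((χ t : F) * u)) * ρ (h t) := by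
  rw [hρ.mul, hρ.mul, hG.hx, hX.conj]

theorem eP_proj [Fintype F] (hX : XSys x h χ) (hG : Good x h χ α) (hρ : PRep α ρ) :
    LinearMap.IsProj (fixP x ρ) (eP x ρ) := by
  constructor
  · intro v u
    simp only [eP, LinearMap.smul_apply, map_smul, LinearMap.sum_apply, map_sum]
    congr 1
    refine Fintype.sum_equiv (Equiv.addLeft u) _ _ fun w => ?_
    rw [← Module.End.mul_apply, good_mul hX hG hρ]; rfl
  · intro v hv
    have : ∀ u, ρ (x u) v = v := hv
    simp only [eP, LinearMap.smul_apply, LinearMap.sum_apply, this]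
    rw [Finset.sum_const, Finset.card_univ, ← Nat.cast_smul_eq_nsmul ℂ, smul_smul,
      inv_mul_cancel₀ (by simp), one_smul]

theorem eP_trace [Fintype F] [FiniteDimensional ℂ E] (hX : XSys x h χ) (hG : Good x h χ α)
    (hρ : PRep α ρ) : LinearMap.trace ℂ E (eP x ρ) = Module.finrank ℂ (fixP x ρ) :=
  (eP_proj hX hG hρ).trace

theorem fix_inv (hX : XSys x h χ) (hG : Good x h χ α) (hρ : PRep α ρ) (t : T) (v : E)
    (hv : v ∈ fixP x ρ) : ρ (h t) v ∈ fixP x ρ := by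
  intro u
  have h1 := LinearMap.congr_fun (good_comm hX hG hρ t (((χ t)⁻¹ : Fˣ) * u)) v
  rw [Module.End.mul_apply, Module.End.mul_apply, hv, Units.mul_inv_cancel_left] at h1
  exact h1.symm

theorem trace_h_x [FiniteDimensional ℂ E] (hX : XSys x h χ) (hG : Good x h χ α)
    (hρ : PRep α ρ) (t : T) (ht : χ t ≠ 1) (u : F) :
    LinearMap.trace ℂ E (ρ (h t) * ρ (x u)) = LinearMap.trace ℂ E (ρ (h t)) := by
  have hk : (χ t : F) - 1 ≠ 0 := fun h0 => ht (Units.ext (sub_eq_zero.1 h0))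
  set v := u / ((χ t : F) - 1) with hv
  have hu : u = (χ t : F) * v - v := by rw [hv]; field_simp
  have e1 : ρ (x v) * ρ (x (-v)) = 1 := by
    rw [good_mul hX hG hρ, add_neg_cancel, hX.zero, hρ.one]
  have e3 : ρ (x u) = ρ (x (- v)) * ρ (x (χ t * v)) := by
    rw [good_mul hX hG hρ, hu, sub_eq_add_neg, add_comm]
  rw [LinearMap.trace_mul_comm, e3, mul_assoc, ← good_comm hX hG hρ,
    LinearMap.trace_mul_comm, mul_assoc, e1, mul_one]

theorem trace_h_eP [Fintype F] [FiniteDimensional ℂ E] (hX : XSys x h χ) (hG : Good x h χ α)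
    (hρ : PRep α ρ) (t : T) (ht : χ t ≠ 1) :
    LinearMap.trace ℂ E (ρ (h t) * eP x ρ) = LinearMap.trace ℂ E (ρ (h t)) := by
  rw [eP, mul_smul_comm, Finset.mul_sum, map_smul, map_sum]
  simp only [trace_h_x hX hG hρ t ht]
  rw [Finset.sum_const, Finset.card_univ, ← Nat.cast_smul_eq_nsmul ℂ, smul_smul,
      inv_mul_cancel₀ (by simp), one_smul]

theorem PRep.pow (hρ : PRep α ρ) (s : K) (n : ℕ) : ∃ c : ℂ, c ≠ 0 ∧ ρ s ^ n = c • ρ (s ^ n) := by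
  induction n with
  | zero => exact ⟨1, one_ne_zero, by simp [hρ.one]⟩
  | succ n ih =>
    obtain ⟨c, c0, hc⟩ := ih
    exact ⟨c * α (s ^ n) s, mul_ne_zero c0 (hρ.ne _ _), by
      rw [pow_succ, hc, smul_mul_assoc, hρ.mul, smul_smul, pow_succ]⟩

theorem exists_root {p : ℕ} (hp : p ≠ 0) (c : ℂ) : ∃ w : ℂ, w ^ p = c :=
  IsAlgClosed.exists_pow_nat_eq c (Nat.pos_of_ne_zero hp)

/-- a finite order operator whose proper powers are traceless has order dividing the dimension -/
theorem dvd_of_traceless [FiniteDimensional ℂ E] (p : ℕ) (hp : 0 < p) (σ : E →ₗ[ℂ] E) (h1 : σ ^ p = 1)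
    (h2 : ∀ j, 0 < j → j < p → LinearMap.trace ℂ E (σ ^ j) = 0) : p ∣ Module.finrank ℂ E := by
  set Q : E →ₗ[ℂ] E := (p : ℂ)⁻¹ • ∑ j ∈ Finset.range p, σ ^ j with hQ
  have hp0 : (p : ℂ) ≠ 0 := by exact_mod_cast hp.ne'
  have hσQ : σ * Q = Q := by
    rw [hQ, mul_smul_comm]
    congr 1
    have := mul_geom_sum σ p
    rw [h1, sub_self, sub_mul, one_mul, sub_eq_zero] at this
    exact this
  have hσQ' : ∀ j, σ ^ j * Q = Q := by
    intro j
    induction j with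
    | zero => simp
    | succ j ih => rw [pow_succ, mul_assoc, hσQ, ih]
  have hQQ : Q * Q = Q := by
    conv_lhs => lhs; rw [hQ]
    rw [smul_mul_assoc, Finset.sum_mul]
    simp only [hσQ']
    rw [Finset.sum_const, Finset.card_range, ← Nat.cast_smul_eq_nsmul ℂ, smul_smul,
      inv_mul_cancel₀ hp0, one_smul]
  have hproj : LinearMap.IsProj (LinearMap.range Q) Q := by
    refine ⟨fun v => ⟨v, rfl⟩, ?_⟩
    rintro _ ⟨v, rfl⟩
    exact LinearMap.congr_fun hQQ v
  have h3 := hproj.trace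
  rw [hQ, map_smul, map_sum, Finset.sum_eq_single 0 (fun j hj hj0 => h2 j (Nat.pos_of_ne_zero hj0)
    (Finset.mem_range.1 hj)) (fun hh => absurd (Finset.mem_range.2 hp) hh), pow_zero,
    LinearMap.trace_one, smul_eq_mul, ← hQ] at h3
  refine ⟨Module.finrank ℂ (LinearMap.range Q), ?_⟩
  rw [inv_mul_eq_iff_eq_mul₀ hp0] at h3
  exact_mod_cast h3

theorem treg_single [DecidableEq K] (s y : K) :
    treg α s (Pi.single 1 1) y = if y = s then α s 1 else 0 := by
  change α s (s⁻¹ * y) * (Pi.single 1 1 : K → ℂ) (s⁻¹ * y) = _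
  by_cases hy : y = s
  · subst hy; simp
  · rw [if_neg hy, Pi.single_eq_of_ne, mul_zero]
    intro hh
    exact hy (inv_mul_eq_one.1 hh).symm

/-- (c) -/
theorem good_borel [Finite F] [Finite K] [Finite T] (hX : XSys x h χ) (hG : Good x h χ α)
    (hα : Cocyc α) (hχ : Function.Injective χ)
    (hB : ∀ k, ∃ t u, k = h t * x u) {p : ℕ} (hp : p.Prime) (hpT : p ∣ Nat.card T) :
    ∃ (E : Type) (_ : AddCommGroup E) (_ : Module ℂ E) (_ : FiniteDimensional ℂ E)
      (ρ : K → E →ₗ[ℂ] E), PRep α ρ ∧ Irr ρ ∧ p ∣ Module.finrank ℂ E := by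
  classical
  cases nonempty_fintype F
  cases nonempty_fintype K
  have hreg := treg_prep hα
  have hx1 : x 1 ≠ 1 := by rw [← hX.zero]; exact fun hh => one_ne_zero (hX.inj hh)
  let d : K → ℂ := Pi.single 1 1
  have hv : treg α (x 1) d - d ≠ 0 := by
    intro h0
    have h1 : treg α (x 1) (Pi.single 1 1) (x 1) - (Pi.single 1 1 : K → ℂ) (x 1) = 0 :=
      congrFun h0 (x 1)
    rw [treg_single, if_pos rfl, Pi.single_eq_of_ne hx1, sub_zero] at h1
    exact hα.ne _ _ h1
  obtain ⟨E, _, _, _, ρ, p', hρ, hi, hp', hp0⟩ := hreg.exists_irr _ rfl _ hv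
  refine ⟨E, _, _, inferInstance, ρ, hρ, hi, ?_⟩
  have hfix : fixP x ρ = ⊥ := by
    refine (hi.2 _ ?_).resolve_right ?_
    · intro k v hv
      obtain ⟨t, u, rfl⟩ := hB k
      have h1 := LinearMap.congr_fun (hρ.mul (h t) (x u)) v
      rw [Module.End.mul_apply, hv u, LinearMap.smul_apply] at h1
      have h2 := fix_inv hX hG hρ t v hv
      rw [h1, Submodule.smul_mem_iff _ (hρ.ne _ _)] at h2
      exact h2
    · intro htop
      apply hp0
      have : p' d ∈ fixP x ρ := htop ▸ Submodule.mem_top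
      rw [map_sub, hp', this 1, sub_self]
  have heP : eP x ρ = 0 := by
    ext v
    have := (eP_proj hX hG hρ).map_mem v
    rw [hfix] at this
    simpa using this
  haveI := Fact.mk hp
  obtain ⟨t, ht⟩ := exists_prime_orderOf_dvd_card' p hpT
  have htr : ∀ j, 0 < j → j < p → LinearMap.trace ℂ E (ρ (h (t ^ j))) = 0 := by
    intro j j0 jp
    rw [← trace_h_eP hX hG hρ, heP, mul_zero, map_zero]
    rw [Ne, map_eq_one_iff χ hχ]
    exact pow_ne_one_of_lt_orderOf j0.ne' (ht ▸ jp)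
  obtain ⟨c, c0, hc⟩ := hρ.pow (h t) p
  rw [← map_pow, ← ht, pow_orderOf_eq_one, map_one, hρ.one, ht] at hc
  obtain ⟨w, hw⟩ := exists_root hp.ne_zero c⁻¹
  refine dvd_of_traceless p hp.pos (w • ρ (h t)) ?_ ?_
  · rw [smul_pow, hw, hc, smul_smul, inv_mul_cancel₀ c0, one_smul]
  · intro j j0 jp
    obtain ⟨c', -, hc'⟩ := hρ.pow (h t) j
    rw [smul_pow, hc', ← map_pow, map_smul, map_smul, htr j j0 jp, smul_zero, smul_zero]
end Fix2

end

section
open CategoryTheory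

section IV
variable {F : Type} [Field F] [CharP F 2] {α : SLF F → SLF F → ℂ}
variable {E : Type} [AddCommGroup E] [Module ℂ E] {ρ : SLF F → E →ₗ[ℂ] E}

abbrev sqH (F : Type) [Field F] : Fˣ →* Fˣ := powMonoidHom 2
abbrev SGood (α : SLF F → SLF F → ℂ) : Prop := Good (xx : F → SLF F) hh (sqH F) α

theorem sl_XSys : XSys (xx : F → SLF F) hh (sqH F) :=
  ⟨xx_add, xx_inj, fun t u => hh_xx t u⟩

/-- elements acting by scalars -/
def scal (hρ : PRep α ρ) : Subgroup (SLF F) where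
  carrier := {s | ∃ c : ℂ, ρ s = c • 1}
  one_mem' := ⟨1, by rw [hρ.one, one_smul]⟩
  mul_mem' := by
    rintro a b ⟨c, hc⟩ ⟨d, hd⟩
    have := hρ.mul a b
    rw [hc, hd, smul_mul_smul_comm, mul_one] at this
    refine ⟨(α a b)⁻¹ * (c * d), ?_⟩
    rw [mul_smul, this, smul_smul, inv_mul_cancel₀ (hρ.ne _ _), one_smul]
  inv_mem' := by
    rintro a ⟨c, hc⟩
    have h1 := hρ.mul_pinv a
    rw [hc, pinv, smul_mul_smul_comm, one_mul] at h1
    refine ⟨(c * (α a a⁻¹)⁻¹)⁻¹, ?_⟩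
    by_cases h0 : c * (α a a⁻¹)⁻¹ = 0
    · rw [h0, zero_smul] at h1
      rw [← mul_one (ρ _), ← h1]; simp
    · rw [← h1, smul_smul, inv_mul_cancel₀ h0, one_smul]

theorem scal_normal (hρ : PRep α ρ) : (scal hρ).Normal := by
  constructor
  rintro a ⟨c, hc⟩ g
  have h1 : ρ g * ρ a * ρ g⁻¹ = (α g a * α (g * a) g⁻¹) • ρ (g * a * g⁻¹) := by
    rw [hρ.mul, smul_mul_assoc, hρ.mul, smul_smul]
  rw [hc, mul_smul_comm, mul_one, smul_mul_assoc, hρ.mul, mul_inv_cancel, hρ.one] at h1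
  refine ⟨(α g a * α (g * a) g⁻¹)⁻¹ * (c * α g g⁻¹), ?_⟩
  rw [mul_smul, mul_smul c, h1, smul_smul, inv_mul_cancel₀ (mul_ne_zero (hρ.ne _ _) (hρ.ne _ _)),
    one_smul]

theorem fix_top_one [FiniteDimensional ℂ E] (hρ : PRep α ρ) (hi : Irr ρ) (h : fixP xx ρ = ⊤) :
    Module.finrank ℂ E = 1 := by
  have h1 : scal hρ = ⊤ := by
    haveI := scal_normal hρ
    refine sl_normal _ fun u => ⟨1, ?_⟩
    ext v
    have : v ∈ fixP xx ρ := h ▸ Submodule.mem_top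
    simpa using this u
  have := hi.1
  obtain ⟨v, hv⟩ := exists_ne (0 : E)
  have h2 := (hi.2 (ℂ ∙ v) (by
    intro s w hw
    obtain ⟨c, hc⟩ : s ∈ scal hρ := h1 ▸ Subgroup.mem_top s
    rw [hc]
    exact Submodule.smul_mem _ _ hw)).resolve_left (by simpa using hv)
  rw [← finrank_top, ← h2, finrank_span_singleton hv]

theorem invol_trace [FiniteDimensional ℂ E] (σ : E →ₗ[ℂ] E) (h : σ * σ = 1) :
    ∃ τ : ℤ, LinearMap.trace ℂ E σ = τ := by
  set Q : E →ₗ[ℂ] E := (2 : ℂ)⁻¹ • (1 + σ) with hQ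
  have hQQ : Q * Q = Q := by
    rw [hQ, smul_mul_smul_comm, add_mul, mul_add, mul_add, h, mul_one, one_mul, mul_one,
      add_comm σ 1, ← two_smul ℂ (1 + σ), smul_smul]
    congr 1; norm_num
  have hproj : LinearMap.IsProj (LinearMap.range Q) Q := by
    refine ⟨fun v => ⟨v, rfl⟩, ?_⟩
    rintro _ ⟨v, rfl⟩
    exact LinearMap.congr_fun hQQ v
  have h3 := hproj.trace
  rw [hQ, map_smul, map_add, LinearMap.trace_one, ← hQ, smul_eq_mul] at h3
  refine ⟨2 * Module.finrank ℂ (LinearMap.range Q) - Module.finrank ℂ E, ?_⟩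
  push_cast
  rw [← h3]; ring

theorem trace_xx [Finite F] [FiniteDimensional ℂ E] (hG : SGood α) (hρ : PRep α ρ) (u : F)
    (hu : u ≠ 0) : LinearMap.trace ℂ E (ρ (xx u)) = LinearMap.trace ℂ E (ρ (xx 1)) := by
  obtain ⟨t, ht⟩ := sq_surj (Units.mk0 u hu)
  have h1 := good_comm sl_XSys hG hρ t 1
  have h2 : ((sqH F t : Fˣ) : F) * 1 = u := by
    rw [mul_one]; change ((t ^ 2 : Fˣ) : F) = u; rw [ht]; rfl
  rw [h2] at h1
  rw [← mul_one (ρ (xx u)), ← hρ.mul_pinv (hh t), ← mul_assoc, ← h1, LinearMap.trace_mul_comm,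
    ← mul_assoc, hρ.pinv_mul, one_mul]

theorem dim_formula [Fintype F] [FiniteDimensional ℂ E] (hG : SGood α) (hρ : PRep α ρ) :
    ∃ m : ℕ, Module.finrank ℂ E = Module.finrank ℂ (fixP xx ρ) + m * (Fintype.card F - 1) := by
  classical
  obtain ⟨τ, hτ⟩ := invol_trace (ρ (xx 1)) (by
    rw [good_mul sl_XSys hG hρ, CharTwo.add_self_eq_zero, xx_zero, hρ.one])
  have h1 := eP_trace sl_XSys hG hρ
  rw [eP, map_smul, map_sum, ← Finset.add_sum_erase _ _ (Finset.mem_univ (0 : F)),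
    Finset.sum_congr rfl (fun u hu => (trace_xx hG hρ u (Finset.ne_of_mem_erase hu)).trans hτ),
    Finset.sum_const, xx_zero, hρ.one, LinearMap.trace_one, Finset.card_erase_of_mem
    (Finset.mem_univ _), Finset.card_univ, smul_eq_mul, inv_mul_eq_iff_eq_mul₀ (by simp),
    nsmul_eq_mul] at h1
  have hq : 1 < Fintype.card F := Fintype.one_lt_card
  obtain ⟨n, hn⟩ : ∃ n, Fintype.card F = n + 1 := ⟨_, (Nat.succ_pred_eq_of_pos (by omega)).symm⟩
  have hle : Module.finrank ℂ (fixP xx ρ) ≤ Module.finrank ℂ E := Submodule.finrank_le _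
  rw [hn] at h1 ⊢
  have h2 : ((Module.finrank ℂ E : ℤ) + n * τ) = (n + 1) * Module.finrank ℂ (fixP xx ρ) := by
    rw [Nat.add_sub_cancel] at h1
    exact_mod_cast h1
  rw [Nat.add_sub_cancel]
  have h3 : (Module.finrank ℂ E : ℤ) - Module.finrank ℂ (fixP xx ρ) =
    (Module.finrank ℂ (fixP xx ρ) - τ) * n := by linarith
  have h4 : 0 ≤ ((Module.finrank ℂ (fixP xx ρ) : ℤ) - τ) := by
    by_contra hlt
    push Not at hlt
    have hn0 : (0 : ℤ) < n := by omega
    nlinarith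
  obtain ⟨m, hm⟩ := Int.eq_ofNat_of_zero_le h4
  refine ⟨m, ?_⟩
  rw [hm] at h3
  zify; linarith
end IV

end

section
open CategoryTheory

section IV2
variable {F : Type} [Field F] [CharP F 2] {α : SLF F → SLF F → ℂ}
variable {E : Type} [AddCommGroup E] [Module ℂ E] {ρ : SLF F → E →ₗ[ℂ] E}

theorem PRep.mem_iff {K : Type} [Group K] {α : K → K → ℂ} {ρ : K → E →ₗ[ℂ] E} (hρ : PRep α ρ)
    (U : Submodule ℂ E) (s t : K) (v : E) : ρ s (ρ t v) ∈ U ↔ ρ (s * t) v ∈ U := by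
  rw [← Module.End.mul_apply, hρ.mul, LinearMap.smul_apply, U.smul_mem_iff (hρ.ne _ _)]

/-- eigenvector for the whole torus -/
theorem eig_all {t0 : Fˣ} (ht0 : ∀ t : Fˣ, ∃ n : ℕ, t = t0 ^ n)
    (hρ : PRep α ρ) (v : E) (μ : ℂ) (hv : ρ (hh t0) v = μ • v) (t : Fˣ) :
    ∃ c : ℂ, ρ (hh t) v = c • v := by
  obtain ⟨n, rfl⟩ := ht0 t
  obtain ⟨c, c0, hc⟩ := hρ.pow (hh t0) n
  have h1 : ∀ k : ℕ, (ρ (hh t0) ^ k) v = μ ^ k • v := by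
    intro k
    induction k with
    | zero => simp
    | succ k ih => rw [pow_succ, Module.End.mul_apply, hv, map_smul, ih, smul_smul, pow_succ']
  refine ⟨c⁻¹ * μ ^ n, ?_⟩
  rw [mul_smul, ← h1, hc, map_pow, LinearMap.smul_apply, smul_smul, inv_mul_cancel₀ c0, one_smul]

theorem dim_le [Fintype F] [FiniteDimensional ℂ E] {t0 : Fˣ} (ht0 : ∀ t : Fˣ, ∃ n : ℕ, t = t0 ^ n)
    (hG : SGood α) (hρ : PRep α ρ) (hi : Irr ρ)
    (ha : fixP xx ρ ≠ ⊥) : Module.finrank ℂ E ≤ Fintype.card F + 1 := by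
  have : Nontrivial (fixP xx ρ) := Submodule.nontrivial_iff_ne_bot.2 ha
  obtain ⟨μ, hμ⟩ := Module.End.exists_eigenvalue
    ((ρ (hh t0)).restrict (fun v hv => fix_inv sl_XSys hG hρ t0 v hv) :
      Module.End ℂ (fixP xx ρ))
  obtain ⟨⟨v, hvf⟩, hv⟩ := hμ.exists_hasEigenvector
  have hv1 : ρ (hh t0) v = μ • v := congrArg Subtype.val hv.apply_eq_smul
  have hv0 : v ≠ 0 := fun h => hv.2 (Subtype.ext h)
  let b : Option F → E := fun o => o.elim v (fun u => ρ (xx u) (ρ ww v))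
  set U := Submodule.span ℂ (Set.range b) with hU
  have hvU : v ∈ U := Submodule.subset_span ⟨none, rfl⟩
  have hk : ∀ k, ρ k v ∈ U := by
    intro k
    by_cases h : k 1 0 = 0
    · obtain ⟨s, u, rfl⟩ := bor k h
      rw [← hρ.mem_iff, hvf u]
      obtain ⟨c, hc⟩ := eig_all ht0 hρ v μ hv1 s
      rw [hc]; exact U.smul_mem _ hvU
    · obtain ⟨u, s, w, rfl⟩ := bruhat k h
      rw [← hρ.mem_iff, hvf w, ← hρ.mem_iff]
      obtain ⟨c, hc⟩ := eig_all ht0 hρ v μ hv1 s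
      rw [hc, map_smul]
      refine U.smul_mem _ ?_
      rw [← hρ.mem_iff]
      exact Submodule.subset_span ⟨some u, rfl⟩
  have htop : Submodule.span ℂ (Set.range fun k => ρ k v) = ⊤ := by
    refine (hi.2 _ ?_).resolve_left ?_
    · intro i w hw
      induction hw using Submodule.span_induction with
      | mem w hw =>
        obtain ⟨k, rfl⟩ := hw
        change ρ i (ρ k v) ∈ _
        rw [hρ.mem_iff]
        exact Submodule.subset_span ⟨_, rfl⟩
      | zero => rw [map_zero]; exact Submodule.zero_mem _
      | add a b _ _ h1 h2 => rw [map_add]; exact Submodule.add_mem _ h1 h2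
      | smul c a _ h1 => rw [map_smul]; exact Submodule.smul_mem _ _ h1
    · intro h0
      have : v ∈ Submodule.span ℂ (Set.range fun k => ρ k v) :=
        Submodule.subset_span ⟨1, by simp [hρ.one]⟩
      rw [h0] at this
      exact hv0 (by simpa using this)
  have hUt : U = ⊤ := by
    rw [eq_top_iff, ← htop, Submodule.span_le]
    rintro _ ⟨k, rfl⟩
    exact hk k
  have h5 := finrank_range_le_card (R := ℂ) b
  rw [Set.finrank, ← hU, hUt, finrank_top, Fintype.card_option] at h5
  exact h5

/-- irreducible constituents with fixed vectors -/
theorem fix_dims [Fintype F] [FiniteDimensional ℂ E] {t0 : Fˣ}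
    (ht0 : ∀ t : Fˣ, ∃ n : ℕ, t = t0 ^ n) (hq : 4 ≤ Fintype.card F)
    (hG : SGood α) (hρ : PRep α ρ) (hi : Irr ρ) :
    (Module.finrank ℂ (fixP xx ρ) = 0 ∧ Fintype.card F - 1 ∣ Module.finrank ℂ E) ∨
    (Module.finrank ℂ (fixP xx ρ) = 1 ∧ Module.finrank ℂ E ≤ Fintype.card F) ∨
    (Module.finrank ℂ (fixP xx ρ) = 2 ∧ Module.finrank ℂ E = Fintype.card F + 1) := by
  obtain ⟨m, hm⟩ := dim_formula hG hρ
  by_cases ha : fixP xx ρ = ⊥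
  · left
    have h0 : Module.finrank ℂ (fixP xx ρ) = 0 := by rw [ha, finrank_bot]
    exact ⟨h0, ⟨m, by rw [hm, h0, zero_add, mul_comm]⟩⟩
  right
  have hle := dim_le ht0 hG hρ hi ha
  have ha1 : 1 ≤ Module.finrank ℂ (fixP xx ρ) := Submodule.one_le_finrank_iff.2 ha
  obtain ⟨n, hn⟩ : ∃ n, Fintype.card F = n + 1 := ⟨_, (Nat.succ_pred_eq_of_pos (by omega)).symm⟩
  rw [hn, Nat.add_sub_cancel] at hm
  rw [hn] at hle hq ⊢
  have hm1 : m ≤ 1 := by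
    by_contra h
    have : 2 * n ≤ m * n := Nat.mul_le_mul_right _ (by omega)
    omega
  interval_cases m
  · left
    have h1 := fix_top_one hρ hi (Submodule.eq_top_of_finrank_eq (by omega))
    omega
  · omega

theorem eig_gamma [Fintype F] [FiniteDimensional ℂ E] {t0 : Fˣ} (h1 : t0 ≠ 1) (hG : SGood α)
    (hρ : PRep α ρ) (ha : Module.finrank ℂ (fixP xx ρ) = 1) (v : E) (hv0 : v ≠ 0)
    (hvf : v ∈ fixP xx ρ) (μ : ℂ) (hv : ρ (hh t0) v = μ • v) :
    μ ^ 2 = α (hh t0) ww * α (hh t0 * ww) (hh t0) := by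
  set g := hh t0
  have hsq : ∀ s : Fˣ, s ≠ 1 → sqH F s ≠ 1 := fun s hs h => hs (sq_inj s 1 (by
    rw [one_pow]; exact h))
  have hpr := eP_proj sl_XSys hG hρ
  have htr := eP_trace sl_XSys hG hρ
  rw [ha] at htr
  have hsp : ∀ w ∈ fixP xx ρ, ∃ c : ℂ, c • v = w := by
    have := (finrank_eq_one_iff_of_nonzero' (⟨v, hvf⟩ : fixP xx ρ)
      (fun h => hv0 (congrArg Subtype.val h))).1 ha
    intro w hw
    obtain ⟨c, hc⟩ := this ⟨w, hw⟩
    exact ⟨c, congrArg Subtype.val hc⟩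
  have hμ0 : μ ≠ 0 := by
    rintro rfl
    rw [zero_smul] at hv
    exact hv0 (hρ.inj g (by rw [hv, map_zero]))
  have hge : ρ g * eP xx ρ = μ • eP xx ρ := by
    ext w
    obtain ⟨c, hc⟩ := hsp _ (hpr.map_mem w)
    rw [Module.End.mul_apply, LinearMap.smul_apply, ← hc, map_smul, hv, smul_comm]
  have hge' : pinv α ρ g * eP xx ρ = μ⁻¹ • eP xx ρ := by
    have := congrArg (fun X => pinv α ρ g * X) hge
    simp only [← mul_assoc, hρ.pinv_mul, one_mul, mul_smul_comm] at this
    nth_rw 2 [this]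
    rw [smul_smul, inv_mul_cancel₀ hμ0, one_smul]
  have t1 : LinearMap.trace ℂ E (ρ g) = μ := by
    rw [← trace_h_eP sl_XSys hG hρ t0 (hsq _ h1), hge, map_smul, htr]; simp
  have t2 : LinearMap.trace ℂ E (pinv α ρ g) = μ⁻¹ := by
    have e : g⁻¹ = hh t0⁻¹ := (map_inv hh t0).symm
    have e2 := hge'
    rw [pinv, e, map_smul, ← trace_h_eP sl_XSys hG hρ t0⁻¹ (hsq _ (inv_ne_one.2 h1)), ← map_smul,
      ← smul_mul_assoc, ← e, ← pinv, hge', map_smul, htr]; simp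
  have h2 : ρ g * ρ ww * ρ g = (α g ww * α (g * ww) g) • ρ ww := by
    rw [hρ.mul, smul_mul_assoc, hρ.mul, smul_smul, hh_ww_hh]
  have h3 : ρ ww * ρ g * pinv α ρ ww = (α g ww * α (g * ww) g) • pinv α ρ g := by
    calc ρ ww * ρ g * pinv α ρ ww = pinv α ρ g * (ρ g * ρ ww * ρ g) * pinv α ρ ww := by
          simp only [← mul_assoc, hρ.pinv_mul, one_mul]
      _ = _ := by rw [h2, mul_smul_comm, smul_mul_assoc, mul_assoc, hρ.mul_pinv, mul_one]
  have h4 := congrArg (LinearMap.trace ℂ E) h3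
  rw [LinearMap.trace_mul_comm, ← mul_assoc, hρ.pinv_mul, one_mul, map_smul, t1, t2,
    smul_eq_mul] at h4
  rw [sq]
  nth_rw 1 [h4]
  rw [mul_assoc, inv_mul_cancel₀ hμ0, mul_one]
end IV2

end

section
open CategoryTheory

section IV3
variable {F : Type} [Field F] [CharP F 2] {α : SLF F → SLF F → ℂ}

theorem exists_gen (F : Type) [Field F] [Finite F] (hq : 4 ≤ Nat.card F) :
    ∃ t0 : Fˣ, (∀ t : Fˣ, ∃ n : ℕ, t = t0 ^ n) ∧ t0 ≠ 1 ∧ orderOf t0 = Nat.card F - 1 := by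
  obtain ⟨g, hg⟩ := IsCyclic.exists_generator (α := Fˣ)
  have ho : orderOf g = Nat.card F - 1 := by
    rw [orderOf_eq_card_of_forall_mem_zpowers hg, Nat.card_units]
  refine ⟨g, fun t => ?_, ?_, ho⟩
  · obtain ⟨n, hn⟩ := (isOfFinOrder_of_finite g).mem_powers_iff_mem_zpowers.2 (hg t)
    exact ⟨n, hn.symm⟩
  · intro h
    rw [h, orderOf_one] at ho
    omega

/-- principal series -/
theorem exists_ps [Fintype F] (hq : 4 ≤ Fintype.card F) (hG : SGood α) (hα : Cocyc α) {t0 : Fˣ}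
    (ht0 : ∀ t : Fˣ, ∃ n : ℕ, t = t0 ^ n) (h1 : t0 ≠ 1) (ho : orderOf t0 = Fintype.card F - 1)
    (μ : ℂ) (hμ0 : μ ≠ 0)
    (hμ : treg α (hh t0) ^ (Fintype.card F - 1) = μ ^ (Fintype.card F - 1) • 1)
    (hμ2 : μ ^ 2 ≠ α (hh t0) ww * α (hh t0 * ww) (hh t0)) :
    ∃ (E : Type) (_ : AddCommGroup E) (_ : Module ℂ E) (_ : FiniteDimensional ℂ E)
      (ρ : SLF F → E →ₗ[ℂ] E) (p : (SLF F → ℂ) →ₗ[ℂ] E),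
      PRep α ρ ∧ Irr ρ ∧ Module.finrank ℂ E = Fintype.card F + 1 ∧
      Module.finrank ℂ (fixP xx ρ) = 2 ∧ (∀ g w, p (treg α g w) = ρ g (p w)) ∧ p ≠ 0 ∧
      ∃ v ∈ fixP xx ρ, v ≠ 0 ∧ ρ (hh t0) v = μ • v := by
  classical
  cases nonempty_fintype (SLF F)
  have hreg := treg_prep hα
  set n := Fintype.card F - 1 with hn
  set d : SLF F → ℂ := Pi.single 1 1 with hd
  set R := treg α with hR
  set w0 := ∑ u, R (xx u) d with hw0
  have hw0f : w0 ∈ fixP xx R := by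
    intro u
    rw [hw0, map_sum]
    refine Fintype.sum_equiv (Equiv.addLeft u) _ _ fun w => ?_
    rw [← Module.End.mul_apply, good_mul sl_XSys hG hreg]; rfl
  set σ : (SLF F → ℂ) →ₗ[ℂ] (SLF F → ℂ) := μ⁻¹ • R (hh t0) with hσ
  have hσn : σ ^ n = 1 := by
    rw [hσ, smul_pow, hμ, smul_smul, inv_pow, inv_mul_cancel₀ (pow_ne_zero _ hμ0), one_smul]
  have hpf : ∀ j, (σ ^ j) w0 ∈ fixP xx R := by
    intro j
    induction j with
    | zero => simpa using hw0f
    | succ j ih =>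
      rw [pow_succ', Module.End.mul_apply, hσ, LinearMap.smul_apply, ← hσ]
      exact Submodule.smul_mem _ _ (fix_inv sl_XSys hG hreg t0 _ ih)
  set v := (∑ j ∈ Finset.range n, σ ^ j) w0 with hv
  have hvf : v ∈ fixP xx R := by
    rw [hv, LinearMap.sum_apply]
    exact Submodule.sum_mem _ fun j _ => hpf j
  have hσv : σ v = v := by
    have := mul_geom_sum σ n
    rw [hσn, sub_self, sub_mul, one_mul, sub_eq_zero] at this
    exact LinearMap.congr_fun this w0
  have hgv : R (hh t0) v = μ • v := by
    conv_rhs => rw [← hσv]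
    rw [hσ, LinearMap.smul_apply, smul_smul, mul_inv_cancel₀ hμ0, one_smul]
  have hn0 : 0 < n := by omega
  have key : ∀ j < n, ∀ u, (σ ^ j) (R (xx u) d) 1 = if j = 0 ∧ u = 0 then 1 else 0 := by
    intro j hj u
    obtain ⟨c, c0, hc⟩ := hreg.pow (hh t0) j
    rw [hσ, smul_pow, hc, LinearMap.smul_apply, LinearMap.smul_apply, ← Module.End.mul_apply,
      hreg.mul, LinearMap.smul_apply, Pi.smul_apply, Pi.smul_apply, Pi.smul_apply, hd,
      treg_single]
    by_cases h0 : j = 0 ∧ u = 0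
    · obtain ⟨rfl, rfl⟩ := h0
      simp only [pow_zero, hreg.one] at hc
      have hc1 : c = 1 := by
        have e := congrFun (LinearMap.congr_fun hc d) 1
        simp [hd] at e
        exact e.symm
      simp [hα.one, xx_zero, hc1]
    · rw [if_neg h0, if_neg, smul_zero, smul_zero, smul_zero]
      intro h2
      rw [← map_pow] at h2
      obtain ⟨h3, h4⟩ := hh_mul_xx_eq_one _ _ h2.symm
      refine h0 ⟨?_, h4⟩
      by_contra hj0
      exact pow_ne_one_of_lt_orderOf hj0 (ho ▸ hj) h3
  have hv0 : v ≠ 0 := by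
    intro h0
    have h2 := congrFun h0 1
    rw [hv, LinearMap.sum_apply, Finset.sum_apply] at h2
    simp only [hw0, map_sum, Finset.sum_apply] at h2
    rw [Finset.sum_congr rfl fun j hj => Finset.sum_congr rfl fun u _ =>
      key j (Finset.mem_range.1 hj) u, Finset.sum_eq_single 0, Finset.sum_eq_single 0] at h2
    · simp at h2
    · intro u _ hu; simp [hu]
    · simp
    · intro j _ hj; simp [hj]
    · intro h; exact absurd (Finset.mem_range.2 hn0) h
  obtain ⟨E, _, _, _, ρ, p, hρ, hi, hp, hp0⟩ := hreg.exists_irr _ rfl v hv0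
  have hpf : p v ∈ fixP xx ρ := fun u => by rw [← hp, hvf u]
  have hpe : ρ (hh t0) (p v) = μ • p v := by rw [← hp, hgv, map_smul]
  have hne : fixP xx ρ ≠ ⊥ := fun h => hp0 (by rw [h] at hpf; simpa using hpf)
  refine ⟨E, _, _, inferInstance, ρ, p, hρ, hi, ?_⟩
  have h2 : Module.finrank ℂ (fixP xx ρ) = 2 ∧ Module.finrank ℂ E = Fintype.card F + 1 := by
    rcases fix_dims ht0 hq hG hρ hi with h | h | h
    · exact absurd (Submodule.finrank_eq_zero.1 h.1) hne
    · exact absurd (eig_gamma h1 hG hρ h.1 _ hp0 hpf μ hpe) hμ2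
    · exact h
  exact ⟨h2.2, h2.1, hp, fun h => hp0 (by rw [h]; rfl), p v, hpf, hp0, hpe⟩

theorem exists_mu [Fintype F] (hq : 4 ≤ Fintype.card F) (hα : Cocyc α) {t0 : Fˣ}
    (ho : orderOf t0 = Fintype.card F - 1) : ∃ μ : ℂ, μ ≠ 0 ∧
    treg α (hh t0) ^ (Fintype.card F - 1) = μ ^ (Fintype.card F - 1) • 1 ∧
    μ ^ 2 ≠ α (hh t0) ww * α (hh t0 * ww) (hh t0) := by
  have hreg := treg_prep hα
  set n := Fintype.card F - 1 with hn
  have hn0 : n ≠ 0 := by omega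
  obtain ⟨c, c0, hc⟩ := hreg.pow (hh t0) n
  rw [← map_pow, ← ho, pow_orderOf_eq_one, map_one, hreg.one, ho] at hc
  obtain ⟨μ, hμ⟩ := exists_root hn0 c
  have hμ0 : μ ≠ 0 := by rintro rfl; rw [zero_pow hn0] at hμ; exact c0 hμ.symm
  by_cases h : μ ^ 2 = α (hh t0) ww * α (hh t0 * ww) (hh t0)
  · have hζ := Complex.isPrimitiveRoot_exp n hn0
    set ζ := Complex.exp (2 * Real.pi * Complex.I / n)
    refine ⟨μ * ζ, mul_ne_zero hμ0 (hζ.ne_zero hn0), ?_, ?_⟩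
    · rw [mul_pow, hζ.pow_eq_one, mul_one, hμ, hc]
    · rw [← h, mul_pow]
      intro h2
      have : ζ ^ 2 = 1 := mul_left_cancel₀ (pow_ne_zero 2 hμ0) (by rw [h2, mul_one])
      have := Nat.le_of_dvd (by norm_num) ((hζ.pow_eq_one_iff_dvd 2).1 this)
      omega
  · exact ⟨μ, hμ0, by rw [hμ, hc], h⟩

theorem fix_add {K : Type} [Group K] [Fintype K] {α : K → K → ℂ} {x : F → K} {E V : Type}
    [AddCommGroup E] [Module ℂ E]
    [FiniteDimensional ℂ E] [AddCommGroup V] [Module ℂ V] [FiniteDimensional ℂ V]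
    {ρ : K → E →ₗ[ℂ] E} {ρ' : K → V →ₗ[ℂ] V}
    (h : PRep α ρ) (h' : PRep α ρ') (hi : Irr ρ') (p : E →ₗ[ℂ] V)
    (hp : ∀ g w, p (ρ g w) = ρ' g (p w)) (h0 : p ≠ 0)
    (hU : ∀ g, ∀ v ∈ LinearMap.ker p, ρ g v ∈ LinearMap.ker p) :
    Module.finrank ℂ (fixP x (presub ρ (LinearMap.ker p) hU)) + Module.finrank ℂ (fixP x ρ') ≤
      Module.finrank ℂ (fixP x ρ) ∧
    Module.finrank ℂ (LinearMap.ker p) + Module.finrank ℂ V = Module.finrank ℂ E := by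
  obtain ⟨i, hi1, hi2⟩ := h.sect h' hi p hp h0
  constructor
  · let L : (fixP x (presub ρ (LinearMap.ker p) hU)) × (fixP x ρ') →ₗ[ℂ] E :=
      ((LinearMap.ker p).subtype ∘ₗ Submodule.subtype _).coprod (i ∘ₗ Submodule.subtype _)
    have hL : ∀ z, L z ∈ fixP x ρ := by
      rintro ⟨⟨⟨a, ha⟩, ha'⟩, ⟨b, hb⟩⟩ u
      change ρ (x u) (a + i b) = a + i b
      rw [map_add, ← hi1, hb u]
      congr 1
      exact congrArg Subtype.val (ha' u)
    rw [← Module.finrank_prod]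
    refine LinearMap.finrank_le_finrank_of_injective (f := L.codRestrict _ hL) ?_
    rw [← LinearMap.ker_eq_bot, LinearMap.ker_codRestrict, LinearMap.ker_eq_bot']
    rintro ⟨⟨⟨a, ha⟩, ha'⟩, ⟨b, hb⟩⟩ hz
    have hz : a + i b = 0 := hz
    have hb0 : b = 0 := by
      have := congrArg p hz
      rwa [map_add, LinearMap.mem_ker.1 ha, zero_add, hi2, map_zero] at this
    subst hb0
    have ha0 : a = 0 := by simpa using hz
    subst ha0
    rfl
  · have h1 := LinearMap.finrank_range_add_finrank_ker p
    have h2 : LinearMap.range p = ⊤ := LinearMap.range_eq_top.2 fun v => ⟨i v, hi2 v⟩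
    rw [h2, finrank_top] at h1
    omega

theorem fix_bound [Fintype F] (hirr : ∀ (E : Type) [AddCommGroup E] [Module ℂ E]
      [FiniteDimensional ℂ E] (ρ : SLF F → E →ₗ[ℂ] E), PRep α ρ → Irr ρ →
      Module.finrank ℂ E ≤ Fintype.card F * Module.finrank ℂ (fixP xx ρ)) :
    ∀ (n : ℕ) (E : Type) [AddCommGroup E] [Module ℂ E] [FiniteDimensional ℂ E]
      (ρ : SLF F → E →ₗ[ℂ] E), PRep α ρ → Module.finrank ℂ E = n →
      Module.finrank ℂ E ≤ Fintype.card F * Module.finrank ℂ (fixP xx ρ) := by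
  classical
  cases nonempty_fintype (SLF F)
  intro n
  induction n using Nat.strong_induction_on with
  | _ n ih =>
  intro E _ _ _ ρ hρ hn
  rcases subsingleton_or_nontrivial E with hs | hs
  · rw [Module.finrank_zero_of_subsingleton]; exact Nat.zero_le _
  obtain ⟨v, hv⟩ := exists_ne (0 : E)
  obtain ⟨V, _, _, _, ρ', p, hρ', hi, hp, hp0⟩ := hρ.exists_irr _ rfl v hv
  have hU : ∀ g, ∀ v ∈ LinearMap.ker p, ρ g v ∈ LinearMap.ker p := by
    intro g v hv
    rw [LinearMap.mem_ker] at hv ⊢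
    rw [hp, hv, map_zero]
  obtain ⟨e1, e2⟩ := fix_add (x := (xx : F → SLF F)) hρ hρ' hi p hp
    (fun h => hp0 (by rw [h]; rfl)) hU
  have hV : 0 < Module.finrank ℂ V := by have := hi.1; exact Module.finrank_pos
  have h1 := ih (Module.finrank ℂ (LinearMap.ker p)) (by omega) _ _ (hρ.sub _ hU) rfl
  have h2 := hirr V ρ' hρ' hi
  nlinarith

theorem treg_trace [Fintype F] [DecidableEq F] [Fintype (SLF F)] (s : SLF F) (hs : s ≠ 1) :
    LinearMap.trace ℂ _ (treg α s) = 0 := by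
  classical
  rw [LinearMap.trace_eq_matrix_trace ℂ (Pi.basisFun ℂ (SLF F)), Matrix.trace]
  refine Finset.sum_eq_zero fun k _ => ?_
  rw [Matrix.diag_apply, LinearMap.toMatrix_apply]
  simp only [Pi.basisFun_apply, Pi.basisFun_repr, treg, LinearMap.coe_mk, AddHom.coe_mk]
  rw [Pi.single_eq_of_ne, mul_zero]
  intro h
  exact hs (by simpa using h)

theorem exists_cusp [Fintype F] (hq : 4 ≤ Fintype.card F) (hG : SGood α) (hα : Cocyc α) :
    ∃ (E : Type) (_ : AddCommGroup E) (_ : Module ℂ E) (_ : FiniteDimensional ℂ E)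
      (ρ : SLF F → E →ₗ[ℂ] E), PRep α ρ ∧ Irr ρ ∧ Fintype.card F - 1 ∣ Module.finrank ℂ E := by
  classical
  cases nonempty_fintype (SLF F)
  obtain ⟨t0, ht0, h1, ho⟩ := exists_gen F (by rwa [Nat.card_eq_fintype_card])
  rw [Nat.card_eq_fintype_card] at ho
  obtain ⟨μ, hμ0, hμ, hμ2⟩ := exists_mu hq hα ho
  obtain ⟨V, _, _, _, ρ', p, hρ', hi, hV, hV2, hp, hp0, -⟩ := exists_ps hq hG hα ht0 h1 ho μ hμ0 hμ hμ2
  by_contra hcon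
  have hirr : ∀ (E : Type) [AddCommGroup E] [Module ℂ E]
      [FiniteDimensional ℂ E] (ρ : SLF F → E →ₗ[ℂ] E), PRep α ρ → Irr ρ →
      Module.finrank ℂ E ≤ Fintype.card F * Module.finrank ℂ (fixP xx ρ) := by
    intro E _ _ _ ρ hρ hi
    rcases fix_dims ht0 hq hG hρ hi with h | h | h
    · exact absurd ⟨E, _, _, inferInstance, ρ, hρ, hi, h.2⟩ hcon
    · rw [h.1]; omega
    · rw [h.1]; omega
  have hreg := treg_prep hα
  have hU : ∀ g, ∀ v ∈ LinearMap.ker p, treg α g v ∈ LinearMap.ker p := by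
    intro g v hv
    rw [LinearMap.mem_ker] at hv ⊢
    rw [hp, hv, map_zero]
  obtain ⟨e1, e2⟩ := fix_add (x := (xx : F → SLF F)) hreg hρ' hi p hp hp0 hU
  have h3 := fix_bound hirr _ _ _ (hreg.sub _ hU) rfl
  have h4 := eP_trace sl_XSys hG hreg
  rw [eP, map_smul, map_sum, Finset.sum_eq_single 0, xx_zero, hreg.one, LinearMap.trace_one,
    smul_eq_mul, inv_mul_eq_iff_eq_mul₀ (by simp)] at h4
  · have h4 : Module.finrank ℂ (SLF F → ℂ) = Fintype.card F * Module.finrank ℂ (fixP xx (treg α)) := by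
      exact_mod_cast h4
    nlinarith
  · intro u _ hu
    exact treg_trace _ fun h => hu (xx_inj (h.trans xx_zero.symm))
  · simp

theorem Cocyc.gauge {K : Type} [Group K] {α : K → K → ℂ} (hα : Cocyc α) (κ : K → ℂ)
    (hκ : ∀ s, κ s ≠ 0) (h1 : κ 1 = 1) : Cocyc (fun s t => κ s * κ t / κ (s * t) * α s t) := by
  have : Nontrivial (K → ℂ) := Function.nontrivial
  exact ((treg_prep hα).gauge κ hκ h1).cocyc

theorem PRep.ungauge {K : Type} [Group K] {α : K → K → ℂ} {E : Type} [AddCommGroup E] [Module ℂ E]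
    {ρ : K → E →ₗ[ℂ] E} (κ : K → ℂ) (hκ : ∀ s, κ s ≠ 0) (h1 : κ 1 = 1)
    (h : PRep (fun s t => κ s * κ t / κ (s * t) * α s t) ρ) :
    PRep α (fun s => (κ s)⁻¹ • ρ s) := by
  have := h.gauge (fun s => (κ s)⁻¹) (fun s => inv_ne_zero (hκ s)) (by simp [h1])
  convert this using 3 with s t
  have := hκ s; have := hκ t; have := hκ (s * t)
  field_simp

/-- Theorem IV for arbitrary cocycles -/
theorem thmIV [Fintype F] (hq : 4 < Fintype.card F) (hα : Cocyc α) :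
    (∃ (E : Type) (_ : AddCommGroup E) (_ : Module ℂ E) (_ : FiniteDimensional ℂ E)
      (ρ : SLF F → E →ₗ[ℂ] E), PRep α ρ ∧ Irr ρ ∧ Fintype.card F - 1 ∣ Module.finrank ℂ E) ∧
    (∃ (E : Type) (_ : AddCommGroup E) (_ : Module ℂ E) (_ : FiniteDimensional ℂ E)
      (ρ : SLF F → E →ₗ[ℂ] E), PRep α ρ ∧ Irr ρ ∧ Fintype.card F + 1 ∣ Module.finrank ℂ E) := by
  have hX : XSys (xx : F → SLF F) hh (sqH F) := sl_XSys
  have hodd : Odd (Nat.card Fˣ) := by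
    rw [Nat.card_units, Nat.card_eq_fintype_card]
    obtain ⟨n, hn⟩ : ∃ n, Fintype.card F = 2 ^ n := by
      obtain ⟨n, -, h⟩ := FiniteField.card F 2
      exact ⟨n, h⟩
    have hn0 : n ≠ 0 := by rintro rfl; omega
    obtain ⟨k, rfl⟩ := Nat.exists_eq_succ_of_ne_zero hn0
    rw [Nat.pow_succ] at hn
    exact ⟨2 ^ k - 1, by omega⟩
  obtain ⟨κ, hκ, hκ1, hG⟩ := exists_gauge hodd hX hα
    (comm_big hq hX (fun s => sq_surj s) hα)
  have hα' := hα.gauge κ hκ hκ1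
  constructor
  · obtain ⟨E, _, _, _, ρ, hρ, hi, hd⟩ := exists_cusp hq.le hG hα'
    exact ⟨E, _, _, inferInstance, _, hρ.ungauge κ hκ hκ1, hi.gauge _ fun s => inv_ne_zero (hκ s), hd⟩
  · obtain ⟨t0, ht0, h1, ho⟩ := exists_gen F (by rw [Nat.card_eq_fintype_card]; exact hq.le)
    rw [Nat.card_eq_fintype_card] at ho
    obtain ⟨μ, hμ0, hμ, hμ2⟩ := exists_mu hq.le hα' ho
    obtain ⟨E, _, _, _, ρ, p, hρ, hi, hd, -⟩ := exists_ps hq.le hG hα' ht0 h1 ho μ hμ0 hμ hμ2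
    exact ⟨E, _, _, inferInstance, _, hρ.ungauge κ hκ hκ1, hi.gauge _ fun s => inv_ne_zero (hκ s),
      by rw [hd]⟩
end IV3

end

section
open CategoryTheory

section Sub
theorem pfix {S : Type} [Group S] [Finite S] (H Q : Subgroup S) {p : ℕ} (hp : p.Prime)
    (hQ : IsPGroup p Q) (hH : ¬ p ∣ H.index) : ∃ g : S, ∀ k ∈ Q, g⁻¹ * k * g ∈ H := by
  haveI := Fact.mk hp
  obtain ⟨a, ha⟩ := hQ.nonempty_fixed_point_of_prime_not_dvd_card (S ⧸ H) hH
  obtain ⟨g, rfl⟩ := QuotientGroup.mk_surjective a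
  refine ⟨g, fun k hk => ?_⟩
  have h1 := ha ⟨k, hk⟩
  have h2 : ((k * g : S) : S ⧸ H) = (g : S ⧸ H) := h1
  rw [eq_comm, QuotientGroup.eq] at h2
  rwa [mul_assoc]

variable {F : Type} [Field F] [CharP F 2]

theorem all_of_xx (H : Subgroup (SLF F)) (h1 : ∀ u, xx u ∈ H) (k : SLF F) (hk : k ∈ H)
    (h : k 1 0 ≠ 0) : H = ⊤ := by
  refine sl_gen H h1 fun u => ?_
  obtain ⟨a, s, b, rfl⟩ := bruhat k h
  have h2 : ww * hh s ∈ H := by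
    have e : ww * hh s = (xx a)⁻¹ * (xx a * ww * hh s * xx b) * (xx b)⁻¹ := by group
    rw [e]
    exact H.mul_mem (H.mul_mem (H.inv_mem (h1 _)) hk) (H.inv_mem (h1 _))
  have h3 := H.mul_mem (H.mul_mem h2 (h1 ((((s ^ 2 : Fˣ) : F))⁻¹ * u))) (H.inv_mem h2)
  have e : ww * hh s * xx ((((s ^ 2 : Fˣ) : F))⁻¹ * u) * (ww * hh s)⁻¹ = yy u := by
    rw [mul_assoc ww, hh_xx, mul_inv_cancel_left₀ (Units.ne_zero _), ← ww_xx]; group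
  rwa [e] at h3

theorem conj_top {S : Type} [Group S] (H : Subgroup S) (g : S)
    (h : H.map (MulAut.conj g).toMonoidHom = ⊤) : H = ⊤ := by
  rw [eq_top_iff]
  intro k _
  have : g * k * g⁻¹ ∈ H.map (MulAut.conj g).toMonoidHom := h ▸ Subgroup.mem_top _
  obtain ⟨k', hk', e⟩ := this
  have e : g * k' * g⁻¹ = g * k * g⁻¹ := e
  have : k' = k := by simpa using e
  exact this ▸ hk'

theorem mem_conj {S : Type} [Group S] (H : Subgroup S) (g k : S) :
    k ∈ H.map (MulAut.conj g).toMonoidHom ↔ g⁻¹ * k * g ∈ H := by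
  constructor
  · rintro ⟨k', hk', rfl⟩
    change g⁻¹ * (g * k' * g⁻¹) * g ∈ H
    have e : g⁻¹ * (g * k' * g⁻¹) * g = k' := by group
    rw [e]; exact hk'
  · intro h
    exact ⟨_, h, by change g * (g⁻¹ * k * g) * g⁻¹ = k; group⟩

theorem all_of_yy (H : Subgroup (SLF F)) (h1 : ∀ u, yy u ∈ H) (k : SLF F) (hk : k ∈ H)
    (h : k 0 1 ≠ 0) : H = ⊤ := by
  apply conj_top H ww
  refine all_of_xx _ (fun u => ?_) (ww * k * ww⁻¹) ?_ ?_
  · rw [mem_conj]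
    have : ww⁻¹ * xx u * ww = yy u := by
      have := ww_xx u
      rw [ww_inv] at this ⊢; exact this
    rw [this]; exact h1 u
  · rw [mem_conj]; convert hk using 1; group
  · rw [ww_inv]; simpa using h

theorem upper_pow (k : SLF F) (h : k 1 0 = 0) (n : ℕ) : (k ^ n) 1 0 = 0 ∧ (k ^ n) 0 0 = (k 0 0) ^ n := by
  induction n with
  | zero => simp
  | succ n ih =>
    rw [pow_succ]
    simp [ih.1, ih.2, h, pow_succ]

theorem upper_order [Fintype F] (k : SLF F) (h : k 1 0 = 0) :
    k ^ ((Fintype.card F - 1) * 2) = 1 := by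
  have h1 := upper_pow k h (Fintype.card F - 1)
  have h0 : k 0 0 ≠ 0 := by
    intro h0; have := sl_det k; rw [h, h0] at this; simp at this
  rw [FiniteField.pow_card_sub_one_eq_one _ h0] at h1
  obtain ⟨s, u, e⟩ := bor _ h1.1
  rw [pow_mul, e]
  rw [e] at h1
  have hs : s = 1 := by
    have := h1.2
    simpa using this
  rw [hs, map_one, one_mul, sq, ← xx_add, CharTwo.add_self_eq_zero, xx_zero]

theorem ord_offdiag [Fintype F] (k : SLF F) (h : ¬ orderOf k ∣ (Fintype.card F - 1) * 2) :
    k 1 0 ≠ 0 ∧ k 0 1 ≠ 0 := by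
  constructor
  · exact fun h0 => h (orderOf_dvd_of_pow_eq_one (upper_order k h0))
  · intro h0
    have h1 := upper_order (ww * k * ww⁻¹) (by rw [ww_inv]; simpa using h0)
    rw [conj_pow] at h1
    exact h (orderOf_dvd_of_pow_eq_one (by simpa using h1))
end Sub

end

section
open CategoryTheory

section SubB
variable {F : Type} [Field F] [CharP F 2]

theorem two_dvd_card [Fintype F] : 2 ∣ Fintype.card F := by
  obtain ⟨n, -, h⟩ := FiniteField.card F 2
  rw [h]; exact dvd_pow_self _ n.ne_zero

theorem r_ndvd [Fintype F] {r : ℕ} (hr : r.Prime) (h : r ∣ Fintype.card F + 1) :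
    ¬ r ∣ (Fintype.card F - 1) * 2 := by
  have h2 := two_dvd_card (F := F)
  have h1 : 0 < Fintype.card F := Fintype.card_pos
  intro hd
  have h3 : r ∣ 2 := by
    rcases hr.dvd_mul.1 hd with h3 | h3
    · have := Nat.dvd_sub h h3
      rwa [show Fintype.card F + 1 - (Fintype.card F - 1) = 2 by omega] at this
    · exact h3
  have h4 : r = 2 := (Nat.prime_dvd_prime_iff_eq hr Nat.prime_two).1 h3
  subst h4
  omega

theorem exists_ord {S : Type} [Group S] [Finite S] (H : Subgroup S) {r : ℕ} (hr : r.Prime)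
    (h : r ∣ Nat.card S) (hi : ¬ r ∣ H.index) : ∃ y ∈ H, orderOf y = r := by
  have := Fact.mk hr
  rw [← H.card_mul_index] at h
  obtain ⟨y, hy⟩ := exists_prime_orderOf_dvd_card' r ((hr.dvd_mul.1 h).resolve_right hi)
  exact ⟨y, y.2, by rw [← hy, Subgroup.orderOf_coe]⟩

theorem units_pow_pred [Fintype F] (s : Fˣ) : s ^ (Fintype.card F - 1) = 1 := by
  ext; push_cast; exact FiniteField.pow_card_sub_one_eq_one _ s.ne_zero

theorem sub_b1 [Fintype F] (hq : 4 ≤ Fintype.card F) (H : Subgroup (SLF F)) {p r k : ℕ}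
    (hp : p.Prime) (hr : r.Prime) (hk : Fintype.card F - 1 = p ^ k) (hpi : ¬ p ∣ H.index)
    (hrq : r ∣ Fintype.card F + 1) (hri : ¬ r ∣ H.index) : H = ⊤ := by
  classical
  have hpg : IsPGroup p (hh : Fˣ →* SLF F).range := by
    rintro ⟨_, s, rfl⟩
    refine ⟨k, Subtype.ext ?_⟩
    change (hh s) ^ (p ^ k) = 1
    rw [← hk, ← map_pow, units_pow_pred, map_one]
  obtain ⟨g, hg⟩ := pfix H _ hp hpg hpi
  apply conj_top H g
  set H' := H.map (MulAut.conj g).toMonoidHom with hH'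
  have hT : ∀ s, hh s ∈ H' := fun s => by rw [mem_conj]; exact hg _ ⟨s, rfl⟩
  obtain ⟨y0, hy0, hyo⟩ := exists_ord H hr (by
    rw [sl_card]; exact (hrq.mul_left _).mul_left _) hri
  obtain ⟨y, hy, hyo⟩ : ∃ y ∈ H', orderOf y = r := by
    refine ⟨g * y0 * g⁻¹, ⟨y0, hy0, rfl⟩, ?_⟩
    rw [← hyo]
    exact MulEquiv.orderOf_eq (MulAut.conj g) y0
  have hnd := r_ndvd hr hrq
  obtain ⟨hc, hb⟩ := ord_offdiag y (by rwa [hyo])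
  have hdet := sl_det y
  rw [CharTwo.sub_eq_add] at hdet
  obtain ⟨h, hh', h0, h1⟩ : ∃ h ∈ H', h 0 0 = 0 ∧ h 1 1 ≠ 0 := by
    by_cases ha : y 0 0 = 0
    · by_cases hd : y 1 1 = 0
      · exfalso
        have e : y ^ 2 = 1 := by
          rw [sq]; apply sl_ext
          · simp [ha, ← hdet]
          · simp [ha, hd]
          · simp [ha, hd]
          · simp [hd, ← hdet, ha]; ring
        exact hnd (dvd_mul_of_dvd_right (hyo ▸ orderOf_dvd_of_pow_eq_one e) _)
      · exact ⟨y, hy, ha, hd⟩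
    · by_cases hd : y 1 1 = 0
      · exact ⟨y⁻¹, H'.inv_mem hy, by simpa using hd, by simpa using ha⟩
      · obtain ⟨s, hs⟩ := sq_surj (Units.mk0 (y 0 1 * y 1 0 / (y 0 0) ^ 2)
          (div_ne_zero (mul_ne_zero hb hc) (pow_ne_zero 2 ha)))
        have hs2 : (s : F) ^ 2 * (y 0 0) ^ 2 = y 0 1 * y 1 0 := by
          have := congrArg Units.val hs
          simp only [Units.val_pow_eq_pow_val, Units.val_mk0] at this
          rw [this, div_mul_cancel₀ _ (pow_ne_zero 2 ha)]
        have hs0 : (s : F) ≠ 0 := s.ne_zero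
        refine ⟨y * hh s * y, H'.mul_mem (H'.mul_mem hy (hT s)) hy, ?_, ?_⟩
        · simp
          have : y 0 0 * s * y 0 0 + y 0 1 * (s : F)⁻¹ * y 1 0 =
            (s : F)⁻¹ * ((s : F) ^ 2 * (y 0 0) ^ 2 + y 0 1 * y 1 0) := by field_simp
          rw [this, hs2, CharTwo.add_self_eq_zero, mul_zero]
        · simp
          have e : y 1 0 * s * y 0 1 + y 1 1 * (s : F)⁻¹ * y 1 1 =
            (s : F)⁻¹ * ((y 0 1 * y 1 0) * (s : F) ^ 2 + y 1 1 ^ 2) := by field_simp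
          rw [e]
          refine mul_ne_zero (inv_ne_zero hs0) ?_
          intro h2
          have h3 : (y 0 0) ^ 2 * ((y 0 1 * y 1 0) * (s : F) ^ 2 + y 1 1 ^ 2) = 1 := by
            have : (y 0 0) ^ 2 * ((y 0 1 * y 1 0) * (s : F) ^ 2 + y 1 1 ^ 2) =
              (y 0 1 * y 1 0) * ((s : F) ^ 2 * (y 0 0) ^ 2) + (y 0 0 * y 1 1) ^ 2 := by ring
            rw [this, hs2, ← sq, add_comm, ← CharTwo.add_sq, hdet, one_pow]
          rw [h2, mul_zero] at h3
          exact zero_ne_one h3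
  have hd := sl_det h
  rw [h0, zero_mul, zero_sub, CharTwo.neg_eq] at hd
  obtain ⟨s, hs⟩ : ∃ s : Fˣ, s ≠ 1 := by
    obtain ⟨t0, -, h, -⟩ := exists_gen F (by rwa [Nat.card_eq_fintype_card])
    exact ⟨t0, h⟩
  have hs0 : (s : F) ≠ 0 := s.ne_zero
  have hs1 : (s : F) ^ 2 + 1 ≠ 0 := by
    intro h2
    apply hs
    apply sq_inj
    ext
    rw [one_pow]
    push_cast
    exact CharTwo.add_eq_zero.1 h2
  have hc' : h 1 0 * h 1 1 * ((s : F) ^ 2 + 1) ≠ 0 :=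
    mul_ne_zero (mul_ne_zero (right_ne_zero_of_mul_eq_one hd) h1) hs1
  have hyy : yy (h 1 0 * h 1 1 * ((s : F) ^ 2 + 1)) ∈ H' := by
    have := H'.mul_mem (H'.mul_mem (H'.mul_mem hh' (hT s)) (H'.inv_mem hh')) (hT s)
    convert this using 1
    apply sl_ext
    · simp [h0, CharTwo.neg_eq]; field_simp; exact hd.symm
    · simp [h0, CharTwo.neg_eq]
    · simp [h0, CharTwo.neg_eq]; field_simp
    · simp [h0, CharTwo.neg_eq]; field_simp; rw [mul_comm]; exact hd.symm
  refine all_of_yy H' (fun u => ?_) h hh' (left_ne_zero_of_mul_eq_one hd)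
  by_cases hu : u = 0
  · rw [hu, yy_zero]; exact H'.one_mem
  obtain ⟨t, ht⟩ := sq_surj (Units.mk0 (h 1 0 * h 1 1 * ((s : F) ^ 2 + 1) / u) (div_ne_zero hc' hu))
  have := H'.mul_mem (H'.mul_mem (hT t) hyy) (H'.inv_mem (hT t))
  convert this using 1
  have ht2 : (t : F) ^ 2 * u = h 1 0 * h 1 1 * ((s : F) ^ 2 + 1) := by
    have := congrArg Units.val ht
    simp only [Units.val_pow_eq_pow_val, Units.val_mk0] at this
    rw [this, div_mul_cancel₀ _ hu]
  rw [← ht2]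
  have ht0 : (t : F) ≠ 0 := t.ne_zero
  apply sl_ext
  · simp
  · simp
  · simp; field_simp
  · simp
end SubB

end

section
open CategoryTheory

section SubC
variable {F : Type} [Field F] [CharP F 2]

theorem exists_ne_one [Fintype F] (hq : 4 ≤ Fintype.card F) : ∃ s : Fˣ, s ≠ 1 := by
  obtain ⟨t0, -, h, -⟩ := exists_gen F (by rwa [Nat.card_eq_fintype_card])
  exact ⟨t0, h⟩

theorem index_two [Fintype F] (hq : 4 ≤ Fintype.card F) (H : Subgroup (SLF F)) (hH : H.index = 2) :
    False := by
  have hn := Subgroup.normal_of_index_eq_two hH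
  have : H = ⊤ := by
    refine sl_normal H fun u => ?_
    obtain ⟨s, hs⟩ := exists_ne_one (F := F) hq
    have hs1 : ((s ^ 2 : Fˣ) : F) + 1 ≠ 0 := by
      intro h2
      apply hs
      apply sq_inj
      ext
      rw [one_pow]
      exact CharTwo.add_eq_zero.1 h2
    set v := u / (((s ^ 2 : Fˣ) : F) + 1)
    have e : xx u = hh s * (xx v * (hh s)⁻¹ * (xx v)⁻¹) := by
      have : hh s * (xx v * (hh s)⁻¹ * (xx v)⁻¹) = (hh s * xx v) * (hh s)⁻¹ * (xx v)⁻¹ := by group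
      rw [this, hh_xx, mul_inv_cancel_right, eq_mul_inv_iff_mul_eq, ← xx_add]
      congr 1
      have : u = v * (((s ^ 2 : Fˣ) : F) + 1) := (div_mul_cancel₀ _ hs1).symm
      rw [this]
      have := CharTwo.add_self_eq_zero v
      linear_combination this
    by_contra hu
    rw [e] at hu
    rw [Subgroup.mul_mem_iff_of_index_two hH, Subgroup.mul_mem_iff_of_index_two hH,
      Subgroup.mul_mem_iff_of_index_two hH, H.inv_mem_iff, H.inv_mem_iff] at hu
    tauto
  rw [this, Subgroup.index_top] at hH
  omega

theorem sub_b2 [Fintype F] (hq : Fintype.card F = 16) (H : Subgroup (SLF F)) {p : ℕ}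
    (hp : p.Prime) (hp15 : p ∣ 15) (hpi : ¬ p ∣ H.index)
    (hri : ¬ 17 ∣ H.index) : H = ⊤ := by
  classical
  have h17 : Nat.Prime 17 := by norm_num
  have hF17 := Fact.mk h17
  have hcard : Nat.card (SLF F) = 4080 := by rw [sl_card, hq]
  have hHi := H.card_mul_index
  rw [hcard] at hHi
  have hHd : Nat.card H ∣ 4080 := ⟨_, hHi.symm⟩
  have h17H : 17 ∣ Nat.card H := by
    have : 17 ∣ Nat.card H * H.index := by rw [hHi]; norm_num
    exact (h17.dvd_mul.1 this).resolve_right hri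
  obtain ⟨c, hc⟩ := h17H
  obtain ⟨Q⟩ : Nonempty (Sylow 17 H) := inferInstance
  have hc17 : ¬ 17 ∣ c := by
    rintro ⟨d, rfl⟩
    have : 17 * (17 * d) ∣ 4080 := hc ▸ hHd
    have h2 : 289 ∣ 4080 := (Dvd.intro d (by ring)).trans this
    norm_num at h2
  have hQ : Nat.card Q = 17 := by
    rw [Q.card_eq_multiplicity, hc, Nat.factorization_mul (by norm_num) (by rintro rfl; simp at hc17)]
    simp [h17.factorization_self, Nat.factorization_eq_zero_of_not_dvd hc17]
  have hn1 := card_sylow_modEq_one 17 H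
  have hn2 := Sylow.card_dvd_index Q
  have hn3 := Q.card_eq_index_normalizer
  set n := Nat.card (Sylow 17 H) with hn
  have hQi : Nat.card Q * (Q : Subgroup H).index = Nat.card H := (Q : Subgroup H).card_mul_index
  rw [hQ] at hQi
  have hn4 : 17 * n ∣ 4080 := (Nat.mul_dvd_mul_left 17 hn2).trans (hQi ▸ hHd)
  have hn5 : n ∣ 240 := by
    have : 17 * n ∣ 17 * 240 := hn4
    exact Nat.dvd_of_mul_dvd_mul_left (by norm_num) this
  have hn6 : n = 1 ∨ n = 120 := by
    have h1 : n ≤ 240 := Nat.le_of_dvd (by norm_num) hn5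
    have h2 : n % 17 = 1 := hn1
    interval_cases n <;> first | omega | (exfalso; revert hn5; decide)
  rcases hn6 with h1 | h1
  · exfalso
    have hpF := Fact.mk hp
    obtain ⟨s, hs⟩ := exists_prime_orderOf_dvd_card' (G := Fˣ) p (by
      rw [Nat.card_units, Nat.card_eq_fintype_card, hq]; exact hp15)
    have hpg : IsPGroup p (Subgroup.zpowers (hh s)) := by
      refine IsPGroup.of_card (n := 1) ?_
      rw [Nat.card_zpowers, orderOf_injective hh hh_inj, hs, pow_one]
    obtain ⟨g, hg⟩ := pfix H _ hp hpg hpi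
    have hz : g⁻¹ * hh s * g ∈ H := hg _ (Subgroup.mem_zpowers _)
    set z : H := ⟨g⁻¹ * hh s * g, hz⟩ with hzdef
    have hzp : z ^ p = 1 := by
      apply Subtype.ext
      rw [Subgroup.coe_pow]
      have : (g⁻¹ * hh s * g) ^ p = g⁻¹ * hh s ^ p * g := by
        have := conj_pow (a := g⁻¹) (b := hh s) (i := p)
        rwa [inv_inv] at this
      change (g⁻¹ * hh s * g) ^ p = 1
      rw [this, ← map_pow, ← hs, pow_orderOf_eq_one]; simp
    have hQn : (Q : Subgroup H).Normal := by
      rw [h1] at hn3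
      rw [← Subgroup.normalizer_eq_top_iff]
      exact Subgroup.index_eq_one.1 hn3.symm
    obtain ⟨y, hy⟩ := exists_prime_orderOf_dvd_card' (G := Q) 17 (by rw [hQ])
    have hcyc : ∀ w : Q, ∃ k : ℕ, y ^ k = w := by
      intro w
      have : Subgroup.zpowers y = ⊤ := Subgroup.eq_top_of_card_eq _ (by
        rw [Nat.card_zpowers, hy, hQ])
      have hw : w ∈ Subgroup.zpowers y := this ▸ Subgroup.mem_top w
      exact (isOfFinOrder_of_finite y).mem_powers_iff_mem_zpowers.2 hw
    obtain ⟨k, hk⟩ := hcyc ⟨z * y * z⁻¹, hQn.conj_mem _ y.2 z⟩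
    have hk : z * (y : H) * z⁻¹ = (y : H) ^ k := (congrArg Subtype.val hk).symm
    have hyo : orderOf (y : H) = 17 := by rw [Subgroup.orderOf_coe, hy]
    have hkj : ∀ j : ℕ, z ^ j * (y : H) * (z ^ j)⁻¹ = (y : H) ^ (k ^ j) := by
      intro j
      induction j with
      | zero => simp
      | succ j ih =>
        calc z ^ (j + 1) * (y : H) * (z ^ (j + 1))⁻¹ = z * (z ^ j * (y : H) * (z ^ j)⁻¹) * z⁻¹ := by
              rw [pow_succ']; group
          _ = (z * y * z⁻¹) ^ (k ^ j) := by rw [ih, conj_pow]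
          _ = _ := by rw [hk, ← pow_mul, pow_succ']
    have hkp := hkj p
    rw [hzp, inv_one, mul_one, one_mul] at hkp
    have hkp : k ^ p ≡ 1 [MOD 17] := by
      have : (y : H) ^ (k ^ p) = (y : H) ^ 1 := by rw [← hkp, pow_one]
      rw [pow_eq_pow_iff_modEq, hyo] at this
      exact this
    have hk1 : k ≡ 1 [MOD 17] := by
      have h3 : ((k : ZMod 17)) ^ p = 1 := by
        have := (ZMod.natCast_eq_natCast_iff _ _ _).2 hkp
        simpa using this
      have h4 : (k : ZMod 17) = 1 := by
        have hk0 : (k : ZMod 17) ≠ 0 := by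
          intro h0; rw [h0, zero_pow hp.ne_zero] at h3; exact zero_ne_one h3
        have h5 := ZMod.pow_card_sub_one_eq_one hk0
        have h6 := orderOf_dvd_of_pow_eq_one h3
        have h7 := orderOf_dvd_of_pow_eq_one h5
        have h8 : orderOf (k : ZMod 17) ∣ 1 := by
          have h9 := Nat.dvd_gcd (h6.trans hp15) h7
          simpa using h9
        exact orderOf_eq_one_iff.1 (Nat.dvd_one.1 h8)
      exact (ZMod.natCast_eq_natCast_iff _ _ _).1 (by simpa using h4)
    have hcomm : z * (y : H) * z⁻¹ = y := by
      rw [hk]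
      have : (y : H) ^ k = (y : H) ^ 1 := by rw [pow_eq_pow_iff_modEq, hyo]; exact hk1
      rw [this, pow_one]
    set Y : SLF F := g * ((y : H) : SLF F) * g⁻¹ with hY
    have hYo : orderOf Y = 17 := by
      rw [← hyo, ← Subgroup.orderOf_coe]
      exact MulEquiv.orderOf_eq (MulAut.conj g) _
    have hYc : hh s * Y = Y * hh s := by
      have h2 : (z : SLF F) * ((y : H) : SLF F) * (z : SLF F)⁻¹ = ((y : H) : SLF F) :=
        congrArg Subtype.val hcomm
      have h3 : (z : SLF F) = g⁻¹ * hh s * g := rfl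
      rw [mul_inv_eq_iff_eq_mul, h3] at h2
      rw [hY]
      have h4 := congrArg (fun t => g * t * g⁻¹) h2
      calc hh s * (g * ((y : H) : SLF F) * g⁻¹) = g * (g⁻¹ * hh s * g * ((y : H) : SLF F)) * g⁻¹ := by
            group
        _ = _ := by rw [h4]; group
    obtain ⟨hY1, -⟩ := ord_offdiag Y (by rw [hYo, hq]; norm_num)
    have h5 : (hh s * Y) 1 0 = (Y * hh s) 1 0 := by rw [hYc]
    simp at h5
    have hs1 : s ≠ 1 := by
      rintro rfl
      rw [orderOf_one] at hs
      exact hp.ne_one hs.symm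
    apply hs1
    apply sq_inj
    ext
    rw [one_pow]
    push_cast
    have hs0 : (s : F) ≠ 0 := s.ne_zero
    have h6 : (s : F)⁻¹ = s := by
      have : (s : F)⁻¹ * Y 1 0 = s * Y 1 0 := by rw [h5, mul_comm]
      exact mul_right_cancel₀ hY1 this
    rw [sq]
    nth_rw 1 [← h6]
    exact inv_mul_cancel₀ hs0
  · have h2 : H.index ∣ 2 := by
      rw [h1] at hn2
      obtain ⟨d, hd⟩ := hn2
      rw [hd] at hQi
      rw [← hQi] at hHi
      refine ⟨d, ?_⟩
      nlinarith
    rcases (Nat.dvd_prime Nat.prime_two).1 h2 with h3 | h3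
    · exact Subgroup.index_eq_one.1 h3
    · exact (index_two (by omega) H h3).elim

theorem borel_case [Fintype F] (H : Subgroup (SLF F)) (h2 : ¬ 2 ∣ H.index) (hne : H ≠ ⊤) {p : ℕ}
    (hp : p.Prime) (hpq : p ∣ Fintype.card F - 1) {α : H → H → ℂ} (hα : Cocyc α) :
    Fintype.card F + 1 ∣ H.index ∧ (¬ p ∣ H.index → 
    ∃ (E : Type) (_ : AddCommGroup E) (_ : Module ℂ E) (_ : FiniteDimensional ℂ E)
      (ρ : H → E →ₗ[ℂ] E), PRep α ρ ∧ Irr ρ ∧ (2 ∣ Module.finrank ℂ E ∨ p ∣ Module.finrank ℂ E)) := by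
  classical
  cases nonempty_fintype (SLF F)
  let P : Subgroup (SLF F) :=
    { carrier := Set.range xx
      one_mem' := ⟨0, xx_zero⟩
      mul_mem' := by rintro _ _ ⟨u, rfl⟩ ⟨v, rfl⟩; exact ⟨u + v, xx_add u v⟩
      inv_mem' := by
        rintro _ ⟨u, rfl⟩
        exact ⟨u, by rw [eq_inv_iff_mul_eq_one, ← xx_add, CharTwo.add_self_eq_zero, xx_zero]⟩ }
  have hP : IsPGroup 2 P := by
    rintro ⟨_, u, rfl⟩
    refine ⟨1, Subtype.ext ?_⟩
    change (xx u) ^ (2 ^ 1) = 1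
    rw [pow_one, sq, ← xx_add, CharTwo.add_self_eq_zero, xx_zero]
  obtain ⟨g, hg⟩ := pfix H P Nat.prime_two hP h2
  obtain ⟨x, hxv⟩ : ∃ x : F → H, ∀ u, ((x u : H) : SLF F) = g⁻¹ * xx u * g :=
    ⟨fun u => ⟨g⁻¹ * xx u * g, hg _ ⟨u, rfl⟩⟩, fun _ => rfl⟩
  let cj : SLF F →* SLF F := (MulAut.conj g⁻¹).toMonoidHom
  have hcj : ∀ k, cj k = g⁻¹ * k * g := fun k => by
    change g⁻¹ * k * g⁻¹⁻¹ = _; rw [inv_inv]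
  let T : Subgroup Fˣ := H.comap (cj.comp hh)
  obtain ⟨h, hhv⟩ : ∃ h : T →* H, ∀ t : T, (h t : SLF F) = g⁻¹ * hh (t : Fˣ) * g :=
    ⟨((cj.comp hh).comp T.subtype).codRestrict H (fun t => t.2), fun t => hcj _⟩
  obtain ⟨χ, hχ⟩ : ∃ χ : T →* Fˣ, ∀ t : T, χ t = (t : Fˣ) ^ 2 :=
    ⟨(sqH F).comp T.subtype, fun _ => rfl⟩
  have hX : XSys x h χ := by
    refine ⟨fun u v => Subtype.ext ?_, fun u v huv => ?_, fun t u => Subtype.ext ?_⟩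
    · rw [Subgroup.coe_mul, hxv, hxv, hxv, xx_add]; group
    · have : g⁻¹ * xx u * g = g⁻¹ * xx v * g := by rw [← hxv, ← hxv, huv]
      exact xx_inj (by simpa using this)
    · rw [Subgroup.coe_mul, Subgroup.coe_mul, hhv, hxv, hxv, hχ]
      have := hh_xx (t : Fˣ) u
      calc (g⁻¹ * hh (t : Fˣ) * g) * (g⁻¹ * xx u * g) = g⁻¹ * (hh (t : Fˣ) * xx u) * g := by group
        _ = _ := by rw [this]; group
  have hB : ∀ k : H, ∃ t u, k = h t * x u := by
    intro k
    have h0 : (g * (k : SLF F) * g⁻¹) 1 0 = 0 := by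
      by_contra h0
      refine hne (conj_top H g (all_of_xx _ (fun u => ?_) _ ?_ h0))
      · rw [mem_conj, ← hxv]; exact (x u).2
      · rw [mem_conj]; convert k.2 using 1; group
    obtain ⟨s, u, e⟩ := bor _ h0
    have hs : s ∈ T := by
      change cj (hh s) ∈ H
      rw [hcj]
      have : g⁻¹ * hh s * g = k * ((x u : H) : SLF F)⁻¹ := by
        rw [eq_mul_inv_iff_mul_eq]
        rw [hxv]
        calc g⁻¹ * hh s * g * (g⁻¹ * xx u * g) = g⁻¹ * (hh s * xx u) * g := by group
          _ = k := by rw [← e]; group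
      rw [this]
      exact H.mul_mem k.2 (H.inv_mem (x u).2)
    refine ⟨⟨s, hs⟩, u, Subtype.ext ?_⟩
    rw [Subgroup.coe_mul, hhv, hxv]
    change _ = g⁻¹ * hh s * g * (g⁻¹ * xx u * g)
    calc (k : SLF F) = g⁻¹ * (g * (k : SLF F) * g⁻¹) * g := by group
      _ = _ := by rw [e]; group
  have hcardH : Nat.card H = Nat.card T * Fintype.card F := by
    have hbij : Function.Bijective (fun z : T × F => h z.1 * x z.2) := by
      constructor
      · rintro ⟨t, u⟩ ⟨t', u'⟩ e
        have e : (h t : SLF F) * (x u : SLF F) = (h t' : SLF F) * (x u' : SLF F) := congrArg Subtype.val e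
        rw [hhv, hhv, hxv, hxv] at e
        have e2 : hh (t : Fˣ) * xx u = hh (t' : Fˣ) * xx u' := by
          have := congrArg (fun k => g * k * g⁻¹) e
          simpa [mul_assoc] using this
        have e3 := congrArg (fun a : SLF F => a 0 0) e2
        have e4 := congrArg (fun a : SLF F => a 0 1) e2
        simp at e3 e4
        have : t = t' := Subtype.ext (Units.ext e3)
        subst this
        simp at e4
        rw [e4]
      · intro k
        obtain ⟨t, u, rfl⟩ := hB k
        exact ⟨(t, u), rfl⟩
    rw [← Nat.card_congr (Equiv.ofBijective _ hbij), Nat.card_prod, Nat.card_eq_fintype_card (α := F)]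
  have hTi := T.card_mul_index
  rw [Nat.card_units, Nat.card_eq_fintype_card (α := F)] at hTi
  have hHi := H.card_mul_index
  have hq0 : 0 < Fintype.card F := Fintype.card_pos
  have hT0 : 0 < Nat.card T := Nat.card_pos
  have hTH : Nat.card T * H.index = (Fintype.card F - 1) * (Fintype.card F + 1) := by
    rw [sl_card, hcardH] at hHi
    apply Nat.eq_of_mul_eq_mul_left hq0
    rw [← hHi]; ring
  have hodd : Odd (Nat.card T) := by
    have h3 : Odd (Fintype.card F - 1) := by
      obtain ⟨c, hc⟩ := two_dvd_card (F := F)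
      exact ⟨c - 1, by omega⟩
    rw [← hTi] at h3
    exact (Nat.odd_mul.1 h3).1
  refine ⟨⟨T.index, ?_⟩, fun hpi => ?_⟩
  · apply Nat.eq_of_mul_eq_mul_left hT0
    rw [hTH, ← hTi]; ring
  · have hpT : p ∣ Nat.card T := by
      have : p ∣ Nat.card T * H.index := by rw [hTH]; exact hpq.mul_right _
      exact (hp.dvd_mul.1 this).resolve_right hpi
    obtain ⟨E, _, _, _, ρ, _, hρ, hi, -⟩ := (treg_prep hα).exists_irr _ rfl
      (Pi.single 1 1 : H → ℂ) (by simp)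
    by_cases hev : 2 ∣ Module.finrank ℂ E
    · exact ⟨E, _, _, inferInstance, ρ, hρ, hi, Or.inl hev⟩
    have hc := comm_odd hX hρ (Nat.not_even_iff_odd.1 fun h => hev h.two_dvd)
    obtain ⟨κ, hκ, hκ1, hG⟩ := exists_gauge hodd hX hα hc
    obtain ⟨E', _, _, _, ρ', hρ', hi', hd⟩ := good_borel hX hG (hα.gauge κ hκ hκ1)
      (fun a b hab => Subtype.ext (sq_inj _ _ ((hχ a).symm.trans (hab.trans (hχ b))))) hB hp hpT
    exact ⟨E', _, _, inferInstance, _, hρ'.ungauge κ hκ hκ1,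
      hi'.gauge _ fun s => inv_ne_zero (hκ s), Or.inr hd⟩
end SubC

end

section
open CategoryTheory

theorem Irr.comp_surj {I J E : Type} [AddCommGroup E] [Module ℂ E] {ρ : I → E →ₗ[ℂ] E} (h : Irr ρ)
    (φ : J → I) (hφ : Function.Surjective φ) : Irr (fun j => ρ (φ j)) :=
  ⟨h.1, fun U hU => h.2 U fun i v hv => by
    obtain ⟨j, rfl⟩ := hφ i
    exact hU j v hv⟩

section Inv
variable {F : Type} [Field F] [CharP F 2]

theorem inv_up [Fintype F] {M : Type} [Group M] [Finite M] {π : M →* SLF F}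
    (hπ : Function.Surjective π) (hq : 4 < Fintype.card F) {p r : ℕ} (hp : p.Prime) (hr : r.Prime)
    (hpq : p ∣ Fintype.card F - 1) (hrq : r ∣ Fintype.card F + 1)
    (hcase : (∃ k, Fintype.card F - 1 = p ^ k) ∨ (Fintype.card F = 16 ∧ r = 17))
    (hn : ∀ m ∈ charDegrees M, ¬ 2 * p ∣ m ∧ ¬ 2 * r ∣ m ∧ ¬ p * r ∣ m)
    {W : Type} [AddCommGroup W] [Module ℂ W] [FiniteDimensional ℂ W] {θ : M → W →ₗ[ℂ] W}
    (hθ : NRep π θ) :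
    (∃ m ∈ charDegrees M, Module.finrank ℂ W * (Fintype.card F - 1) ∣ m) ∧
    (∃ m ∈ charDegrees M, Module.finrank ℂ W * (Fintype.card F + 1) ∣ m) := by
  obtain ⟨H, A, β, hL⟩ := exists_lift hπ hθ
  have hco := hL.cocyc hπ hθ
  have c2p : Nat.Coprime 2 p := (Nat.coprime_primes Nat.prime_two hp).2 (by
    rintro rfl
    obtain ⟨a, ha⟩ := hpq; obtain ⟨b, hb⟩ := two_dvd_card (F := F)
    omega)
  have c2r : Nat.Coprime 2 r := (Nat.coprime_primes Nat.prime_two hr).2 (by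
    rintro rfl
    obtain ⟨a, ha⟩ := hrq; obtain ⟨b, hb⟩ := two_dvd_card (F := F)
    omega)
  have cpr : Nat.Coprime p r := (Nat.coprime_primes hp hr).2 (by
    rintro rfl
    exact r_ndvd hr hrq (hpq.mul_right 2))
  have hH : H = ⊤ := by
    by_contra hne
    obtain ⟨E, _, _, _, ρE, hE, hEi⟩ := exists_alp_irr hco
    obtain ⟨n1, n2, n3⟩ := hn _ (clifford_up hπ hθ hL hE hEi)
    by_cases h2 : 2 ∣ H.index
    · have hpi : ¬ p ∣ H.index := fun h => n1 ((c2p.mul_dvd_of_dvd_of_dvd h2 h).mul_right _)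
      have hri : ¬ r ∣ H.index := fun h => n2 ((c2r.mul_dvd_of_dvd_of_dvd h2 h).mul_right _)
      rcases hcase with ⟨k, hk⟩ | ⟨h16, rfl⟩
      · exact hne (sub_b1 hq.le H hp hr hk hpi hrq hri)
      · exact hne (sub_b2 h16 H hp (by rw [h16] at hpq; exact hpq) hpi hri)
    · obtain ⟨h3, h4⟩ := borel_case H h2 hne hp hpq hco
      have hri : r ∣ H.index := hrq.trans h3
      have hpi : ¬ p ∣ H.index := fun h => n3 ((cpr.mul_dvd_of_dvd_of_dvd h hri).mul_right _)
      obtain ⟨E, _, _, _, ρE, hE, hEi, h5⟩ := h4 hpi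
      obtain ⟨n1, n2, n3⟩ := hn _ (clifford_up hπ hθ hL hE hEi)
      rcases h5 with h5 | h5
      · exact n2 (by rw [mul_comm 2]; exact mul_dvd_mul hri (h5.mul_left _))
      · exact n3 (by rw [mul_comm p]; exact mul_dvd_mul hri (h5.mul_left _))
  subst hH
  let φ : SLF F →* (⊤ : Subgroup (SLF F)) := (Subgroup.topEquiv.symm : SLF F ≃* _).toMonoidHom
  let ψ : (⊤ : Subgroup (SLF F)) →* SLF F := (Subgroup.topEquiv : _ ≃* SLF F).toMonoidHom
  have hψ : Function.Surjective ψ := Subgroup.topEquiv.surjective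
  have hα : Cocyc (fun s t => alp ⊤ β (φ s) (φ t)) :=
    ⟨fun s t => hco.ne _ _, fun s => by
      rw [map_one]; exact hco.one _, by
      intro a b c
      have h := hco.coc (φ a) (φ b) (φ c)
      simpa [map_mul] using h⟩
  obtain ⟨⟨E, _, _, _, ρ, hρ, hi, hd⟩, ⟨E', _, _, _, ρ', hρ', hi', hd'⟩⟩ := thmIV hq hα
  constructor
  · refine ⟨_, clifford_up hπ hθ hL (hρ.comp ψ) (hi.comp_surj ψ hψ), ?_⟩
    rw [Subgroup.index_top, one_mul]
    exact mul_dvd_mul_left _ hd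
  · refine ⟨_, clifford_up hπ hθ hL (hρ'.comp ψ) (hi'.comp_surj ψ hψ), ?_⟩
    rw [Subgroup.index_top, one_mul]
    exact mul_dvd_mul_left _ hd'
end Inv

end

section
open CategoryTheory

section Aut
variable {F : Type} [Field F] [CharP F 2]

def PX (F : Type) [Field F] [CharP F 2] : Subgroup (SLF F) where
  carrier := Set.range xx
  one_mem' := ⟨0, xx_zero⟩
  mul_mem' := by rintro _ _ ⟨u, rfl⟩ ⟨v, rfl⟩; exact ⟨u + v, xx_add u v⟩
  inv_mem' := by
    rintro _ ⟨u, rfl⟩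
    exact ⟨u, by rw [eq_inv_iff_mul_eq_one, ← xx_add, CharTwo.add_self_eq_zero, xx_zero]⟩

theorem PX_pgroup : IsPGroup 2 (PX F) := by
  rintro ⟨_, u, rfl⟩
  refine ⟨1, Subtype.ext ?_⟩
  change (xx u) ^ (2 ^ 1) = 1
  rw [pow_one, sq, ← xx_add, CharTwo.add_self_eq_zero, xx_zero]

theorem PX_index [Fintype F] : ¬ 2 ∣ (PX F).index := by
  have h := (PX F).card_mul_index
  have hc : Nat.card (PX F) = Fintype.card F := by
    rw [← Nat.card_eq_fintype_card]
    exact (Nat.card_congr (Equiv.ofInjective xx xx_inj)).symm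
  rw [hc, sl_card] at h
  rw [Nat.eq_of_mul_eq_mul_left Fintype.card_pos h]
  obtain ⟨c, hc⟩ := two_dvd_card (F := F)
  have h0 : 0 < Fintype.card F := Fintype.card_pos
  rw [Nat.prime_two.dvd_mul]
  omega

theorem aut_sylow [Fintype F] (φ : MulAut (SLF F)) {t : ℕ} (ht : t.Prime) (hφ : φ ^ t = 1)
    (htS : ¬ t ∣ Nat.card (SLF F)) :
    ∃ g : SLF F, ∀ u : F, ∃ u', (MulAut.conj g * φ * (MulAut.conj g)⁻¹) (xx u) = xx u' := by
  classical
  have : Fact t.Prime := ⟨ht⟩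
  have : Fact (Nat.Prime 2) := ⟨Nat.prime_two⟩
  have hpg : IsPGroup t (Subgroup.zpowers φ) := by
    rintro ⟨_, n, rfl⟩
    refine ⟨1, Subtype.ext ?_⟩
    change (φ ^ n) ^ (t ^ 1) = 1
    rw [pow_one, ← zpow_natCast, zpow_comm, zpow_natCast, hφ, one_zpow]
  obtain ⟨Q, hQ⟩ := hpg.nonempty_fixed_point_of_prime_not_dvd_card (Sylow 2 (SLF F)) (by
    intro h
    obtain ⟨Q⟩ := (inferInstance : Nonempty (Sylow 2 (SLF F)))
    exact htS (h.trans (Q.card_dvd_index.trans (Subgroup.index_dvd_card _))))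
  have hQ1 : φ • Q = Q := hQ ⟨φ, Subgroup.mem_zpowers φ⟩
  obtain ⟨g, hg⟩ := MulAction.exists_smul_eq (SLF F) Q (PX_pgroup.toSylow PX_index)
  refine ⟨g, fun u => ?_⟩
  have h1 : ∀ k, g * k * g⁻¹ ∈ PX F ↔ k ∈ (Q : Subgroup (SLF F)) := by
    intro k
    have : (PX F) = ((g • Q : Sylow 2 (SLF F)) : Subgroup (SLF F)) := by rw [hg]; rfl
    rw [this, Sylow.coe_subgroup_smul]
    exact Subgroup.smul_mem_pointwise_smul_iff (a := MulAut.conj g)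
  have h2 : ∀ k ∈ (Q : Subgroup (SLF F)), φ k ∈ (Q : Subgroup (SLF F)) := by
    intro k hk
    have : (Q : Subgroup (SLF F)) = ((φ • Q : Sylow 2 (SLF F)) : Subgroup (SLF F)) := by rw [hQ1]
    rw [this, Sylow.pointwise_smul_def]
    exact Subgroup.smul_mem_pointwise_smul _ φ _ hk
  have h3 : g * φ (g⁻¹ * xx u * g) * g⁻¹ ∈ PX F := by
    rw [h1]
    apply h2
    rw [← h1]
    refine ⟨u, by group⟩
  obtain ⟨u', hu'⟩ := h3
  refine ⟨u', ?_⟩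
  rw [hu']
  simp [MulAut.conj_inv_apply]

theorem conj_pow_eq {G : Type} [Group G] (a b : G) (t : ℕ) (h : b ^ t = 1) : (a * b * a⁻¹) ^ t = 1 := by
  rw [conj_pow, h]; simp

theorem P_norm (k : SLF F) (u : F) (hu : u ≠ 0) (h : (k * xx u * k⁻¹) 1 0 = 0) : k 1 0 = 0 := by
  simp at h
  have h2 : u * (k 1 0) ^ 2 = 0 := by linear_combination -h
  simpa [hu] using h2

theorem aut_opp [Fintype F] (φ : MulAut (SLF F)) {t : ℕ} (ht : Odd t) (hφ : φ ^ t = 1)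
    (hP : ∀ u : F, ∃ u', φ (xx u) = xx u') :
    ∃ w : F, (∀ u : F, ∃ u', (MulAut.conj (xx w) * φ * (MulAut.conj (xx w))⁻¹) (xx u) = xx u') ∧
      (∀ u : F, ∃ u', (MulAut.conj (xx w) * φ * (MulAut.conj (xx w))⁻¹) (yy u) = yy u') := by
  choose a ha using hP
  have hadd : ∀ u v, a (u + v) = a u + a v := fun u v => xx_inj (by
    rw [← ha, xx_add, map_mul, ha, ha, xx_add])
  have ha0 : a 0 = 0 := by simpa using hadd 0 0
  have hinj : Function.Injective a := fun u v h => xx_inj (φ.injective (by rw [ha, ha, h]))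
  have hsur : Function.Surjective a := Finite.injective_iff_surjective.1 hinj
  have hk : (φ ww) 1 0 ≠ 0 := by
    intro h0
    obtain ⟨s, u, e⟩ := bor _ h0
    have h1 : φ (ww * xx 1 * ww⁻¹) = xx ((s ^ 2 : Fˣ) * (a 1)) := by
      rw [map_mul, map_mul, map_inv, e, ha]
      calc hh s * xx u * xx (a 1) * (hh s * xx u)⁻¹ = (hh s * (xx (u + a 1) * (xx u)⁻¹)) * (hh s)⁻¹ := by
            rw [xx_add]; group
        _ = _ := by
          rw [add_comm, xx_add, mul_inv_cancel_right, hh_xx, mul_inv_cancel_right]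
    obtain ⟨v, hv⟩ := hsur ((s ^ 2 : Fˣ) * (a 1))
    rw [← hv, ← ha, ww_xx] at h1
    have h2 := φ.injective h1
    have := congrArg (fun a : SLF F => a 1 0) h2
    simp at this
  obtain ⟨b, s, v, e⟩ := bruhat _ hk
  have hyy : ∀ u, ∃ u', φ (yy u) = xx b * yy u' * (xx b)⁻¹ := by
    intro u
    refine ⟨(s ^ 2 : Fˣ) * a u, ?_⟩
    rw [← ww_xx, map_mul, map_mul, map_inv, e, ha, ← ww_xx]
    calc xx b * ww * hh s * xx v * xx (a u) * (xx b * ww * hh s * xx v)⁻¹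
        = xx b * ww * ((hh s * (xx (v + a u) * (xx v)⁻¹)) * (hh s)⁻¹) * ww⁻¹ * (xx b)⁻¹ := by
            rw [xx_add]; group
      _ = _ := by
          rw [add_comm, xx_add, mul_inv_cancel_right, hh_xx, mul_inv_cancel_right]; group
  let T : F → F := fun v => a v + b
  have hit : ∀ (n : ℕ) (v : F), ∃ c, c ≠ 0 ∧ (φ ^ n) (xx v * yy 1 * (xx v)⁻¹) = xx (T^[n] v) * yy c * (xx (T^[n] v))⁻¹ := by
    intro n v
    induction n with
    | zero => exact ⟨1, one_ne_zero, by simp⟩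
    | succ n ih =>
      obtain ⟨c, hc, ih⟩ := ih
      obtain ⟨c', hc'⟩ := hyy c
      refine ⟨c', ?_, ?_⟩
      · rintro rfl
        rw [yy_zero] at hc'
        have : yy c = 1 := φ.injective (by rw [hc']; simp)
        have := congrArg (fun a : SLF F => a 1 0) this
        simp at this
        exact hc this
      · rw [pow_succ', MulAut.mul_apply, ih, map_mul, map_mul, map_inv, ha, hc', Function.iterate_succ_apply']
        change _ = xx (a (T^[n] v) + b) * _ * _
        rw [xx_add]; group
  have hTt : ∀ v, T^[t] v = v := by
    intro v
    obtain ⟨c, hc, e⟩ := hit t v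
    rw [hφ, MulAut.one_apply] at e
    have e2 : yy 1 = xx (T^[t] v - v) * yy c * (xx (T^[t] v - v))⁻¹ := by
      have e3 : xx (T^[t] v - v) = (xx v)⁻¹ * xx (T^[t] v) := by
        rw [eq_inv_mul_iff_mul_eq, ← xx_add]; congr 1; ring
      rw [e3]
      calc yy 1 = (xx v)⁻¹ * (xx v * yy 1 * (xx v)⁻¹) * xx v := by group
        _ = _ := by rw [e]; group
    have e4 := congrArg (fun a : SLF F => a 0 0) e2
    simp [hc] at e4
    exact sub_eq_zero.1 e4
  have hTodd : ∀ (n : ℕ) (x : ℕ → F), a (∑ i ∈ Finset.range n, x i) = ∑ i ∈ Finset.range n, a (x i) := by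
    intro n x
    induction n with
    | zero => simpa using ha0
    | succ n ih => rw [Finset.sum_range_succ, hadd, ih, Finset.sum_range_succ]
  obtain ⟨v0, hv0⟩ : ∃ v0, T v0 = v0 := by
    refine ⟨∑ i ∈ Finset.range t, T^[i] 0, ?_⟩
    have h1 : T (∑ i ∈ Finset.range t, T^[i] 0) = ∑ i ∈ Finset.range t, T^[i + 1] 0 := by
      change a _ + b = _
      rw [hTodd]
      simp only [Function.iterate_succ_apply']
      change _ = ∑ i ∈ Finset.range t, (a (T^[i] 0) + b)
      rw [Finset.sum_add_distrib, Finset.sum_const, Finset.card_range, nsmul_eq_mul,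
        show (t : F) = 1 from by simp [CharTwo.natCast_eq_ite, Nat.not_even_iff_odd.2 ht], one_mul]
    rw [h1]
    have h2 := Finset.sum_range_succ (fun i => T^[i] 0) t
    rw [Finset.sum_range_succ', hTt] at h2
    simpa using h2
  refine ⟨v0, fun u => ⟨a u, ?_⟩, fun u => ?_⟩
  · rw [MulAut.mul_apply, MulAut.mul_apply, MulAut.conj_inv_apply, MulAut.conj_apply]
    have : (xx v0)⁻¹ * xx u * xx v0 = xx u := by rw [mul_assoc, ← xx_add, add_comm, xx_add]; group
    rw [this, ha, ← xx_add, add_comm, xx_add]; group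
  · obtain ⟨u', hu'⟩ := hyy u
    refine ⟨u', ?_⟩
    rw [MulAut.mul_apply, MulAut.mul_apply, MulAut.conj_inv_apply, MulAut.conj_apply, map_mul, map_mul,
      map_inv, ha, hu']
    have hinv : ∀ u : F, (xx u)⁻¹ = xx u := fun u => by
      rw [inv_eq_iff_mul_eq_one, ← xx_add, CharTwo.add_self_eq_zero, xx_zero]
    have h1 : xx v0 * xx (a v0) * xx b = 1 := by
      have h3 : a v0 + b = v0 := hv0
      rw [mul_assoc, ← xx_add, ← xx_add, h3, CharTwo.add_self_eq_zero, xx_zero]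
    calc xx v0 * ((xx (a v0))⁻¹ * (xx b * yy u' * (xx b)⁻¹) * xx (a v0)) * (xx v0)⁻¹
        = (xx v0 * xx (a v0) * xx b) * yy u' * (xx v0 * xx (a v0) * xx b)⁻¹ := by
          rw [hinv (a v0)]
          rw [mul_inv_rev, mul_inv_rev, hinv (a v0)]
          group
      _ = _ := by rw [h1]; group

/-- centralizing the torus forces triviality -/
theorem aut_triv [Fintype F] (φ : MulAut (SLF F)) {t : ℕ} (ht : t.Prime) (hφ : φ ^ t = 1)
    (htq : ¬ t ∣ Fintype.card F - 1)
    (hP : ∀ u : F, ∃ u', φ (xx u) = xx u') (hY : ∀ u : F, ∃ u', φ (yy u) = yy u')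
    (hT : ∀ s : Fˣ, φ (hh s) = hh s) : φ = 1 := by
  have key : ∀ s : Fˣ, s ^ t = 1 → s = 1 := by
    intro s hs
    have h1 := orderOf_dvd_of_pow_eq_one hs
    rcases (Nat.dvd_prime ht).1 h1 with h | h
    · exact orderOf_eq_one_iff.1 h
    · exact (htq (by rw [← h, ← Nat.card_eq_fintype_card, ← Nat.card_units]; exact orderOf_dvd_natCard s)).elim
  have hw : ∃ s, φ ww = ww * hh s := by
    have h1 : ∀ u : F, ∃ u', φ ww * φ (xx u) * (φ ww)⁻¹ = yy u' := by
      intro u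
      rw [← map_mul, ← map_inv, ← map_mul, ww_xx]; exact hY u
    have hne : ∀ u u' : F, u ≠ 0 → φ (xx u) = xx u' → u' ≠ 0 := by
      rintro u _ hu h rfl
      rw [xx_zero] at h
      have : xx u = 1 := φ.injective (by rw [h, map_one])
      rw [← xx_zero] at this
      exact hu (xx_inj this)
    obtain ⟨u, hu⟩ := hP 1
    obtain ⟨u', hu'⟩ := h1 1
    have hu0 := hne 1 u one_ne_zero hu
    rw [hu] at hu'
    have e0 : (φ ww) 0 0 = 0 := by
      have := congrArg (fun a : SLF F => a 0 1) hu'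
      simp at this
      have h2 : u * ((φ ww) 0 0) ^ 2 = 0 := by linear_combination this
      simpa [hu0] using h2
    have e1 : (φ ww) 1 1 = 0 := by
      have h3 : φ ww = (φ ww)⁻¹ := by rw [← map_inv, ww_inv]
      have := congrArg (fun a : SLF F => a 1 1) h3
      simp only [sl_i11] at this
      rw [this, e0]
    have hd := sl_det (φ ww)
    rw [e0, zero_mul, zero_sub, CharTwo.neg_eq] at hd
    have h10 : (φ ww) 1 0 ≠ 0 := right_ne_zero_of_mul_eq_one hd
    refine ⟨Units.mk0 _ h10, ?_⟩
    apply sl_ext <;> simp [e0, e1]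
    exact eq_inv_of_mul_eq_one_left hd
  obtain ⟨s, hs⟩ := hw
  have hs1 : s = 1 := by
    apply key
    apply hh_inj
    rw [map_pow, map_one]
    have : ∀ n : ℕ, (φ ^ n) ww = ww * hh s ^ n := by
      intro n
      induction n with
      | zero => simp
      | succ n ih => rw [pow_succ', MulAut.mul_apply, ih, map_mul, map_pow, hT, hs, pow_succ', mul_assoc]
    have h2 := this t
    rw [hφ, MulAut.one_apply] at h2
    exact mul_eq_left.1 h2.symm
  rw [hs1, map_one, mul_one] at hs
  choose a ha using hP
  have hac : ∀ v : F, a v = v * a 1 := by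
    intro v
    by_cases hv : v = 0
    · subst hv
      rw [zero_mul]
      apply xx_inj
      rw [← ha, xx_zero, map_one]
    obtain ⟨z, hz⟩ := sq_surj (Units.mk0 v hv)
    have h1 := congrArg φ (hh_xx z 1)
    rw [map_mul, map_mul, hT, ha, ha, hh_xx, mul_one, hz] at h1
    exact (xx_inj (mul_right_cancel h1)).symm
  have ha1 : a 1 = 1 := by
    have h0 : a 1 ≠ 0 := by
      intro h
      have h1 := ha 1
      rw [h, xx_zero] at h1
      have : xx (1 : F) = xx 0 := φ.injective (by rw [h1, xx_zero, map_one])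
      exact one_ne_zero (xx_inj this)
    have : ∀ n : ℕ, (φ ^ n) (xx 1) = xx ((a 1) ^ n) := by
      intro n
      induction n with
      | zero => simp
      | succ n ih => rw [pow_succ', MulAut.mul_apply, ih, ha, hac, pow_succ]
    have h2 := this t
    rw [hφ, MulAut.one_apply] at h2
    have h3 := key (Units.mk0 _ h0) (Units.ext (by simpa using (xx_inj h2).symm))
    exact congrArg Units.val h3
  have hx : ∀ u, φ (xx u) = xx u := fun u => by rw [ha, hac, ha1, mul_one]
  have htop : MonoidHom.eqLocus φ.toMonoidHom (MonoidHom.id (SLF F)) = ⊤ := by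
    apply sl_gen
    · exact hx
    · intro u
      change φ (yy u) = yy u
      rw [← ww_xx, map_mul, map_mul, map_inv, hs, hx]
  ext1 k
  exact (htop ▸ Subgroup.mem_top k : k ∈ MonoidHom.eqLocus φ.toMonoidHom (MonoidHom.id (SLF F)))

theorem aut_norm [Fintype F] (hq : 4 ≤ Fintype.card F) (φ : MulAut (SLF F)) {t : ℕ} (ht : t.Prime)
    (hφ : φ ^ t = 1) (htS : ¬ t ∣ Nat.card (SLF F)) :
    ∃ (g : SLF F) (k : ℕ),
      (∀ u : F, ∃ u', (MulAut.conj g * φ * (MulAut.conj g)⁻¹) (xx u) = xx u') ∧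
      (∀ s : Fˣ, (MulAut.conj g * φ * (MulAut.conj g)⁻¹) (hh s) = hh s ^ k) ∧
      (k ^ t ≡ 1 [MOD Fintype.card F - 1]) ∧
      (k ≡ 1 [MOD Fintype.card F - 1] → φ = 1) := by
  obtain ⟨g1, hg1⟩ := aut_sylow φ ht hφ htS
  have hodd : Odd t := ht.odd_of_ne_two (by
    rintro rfl
    exact htS (by rw [sl_card]; exact two_dvd_card.mul_right _))
  have htq : ¬ t ∣ Fintype.card F - 1 := fun h => htS (by
    rw [sl_card]; exact (h.mul_right _).mul_left _)
  obtain ⟨w, h1, h2⟩ := aut_opp _ hodd (conj_pow_eq _ _ _ hφ) hg1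
  refine ⟨xx w * g1, ?_⟩
  have e : MulAut.conj (xx w) * (MulAut.conj g1 * φ * (MulAut.conj g1)⁻¹) * (MulAut.conj (xx w))⁻¹ =
    MulAut.conj (xx w * g1) * φ * (MulAut.conj (xx w * g1))⁻¹ := by rw [map_mul]; group
  rw [e] at h1 h2
  have h3 := conj_pow_eq (MulAut.conj (xx w * g1)) φ t hφ
  have h4 : MulAut.conj (xx w * g1) * φ * (MulAut.conj (xx w * g1))⁻¹ = 1 → φ = 1 := fun h => by
    rw [mul_inv_eq_one] at h
    simpa using h
  generalize MulAut.conj (xx w * g1) * φ * (MulAut.conj (xx w * g1))⁻¹ = ψ at *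
  obtain ⟨t0, ht0, ht1, hto⟩ := exists_gen F (by rwa [Nat.card_eq_fintype_card])
  rw [Nat.card_eq_fintype_card] at hto
  have hT : ∃ s, ψ (hh t0) = hh s := by
    have hne : ∀ u u' : F, u ≠ 0 → ψ (xx u) = xx u' → u' ≠ 0 := by
      rintro u _ hu h rfl
      rw [xx_zero] at h
      have : xx u = 1 := ψ.injective (by rw [h, map_one])
      rw [← xx_zero] at this
      exact hu (xx_inj this)
    have hne' : ∀ u u' : F, u ≠ 0 → ψ (yy u) = yy u' → u' ≠ 0 := by
      rintro u _ hu h rfl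
      rw [yy_zero] at h
      have : yy u = 1 := ψ.injective (by rw [h, map_one])
      have := congrArg (fun a : SLF F => a 1 0) this
      exact hu (by simpa using this)
    have e10 : (ψ (hh t0)) 1 0 = 0 := by
      obtain ⟨u, hu⟩ := h1 1
      obtain ⟨u', hu'⟩ := h1 (((t0 ^ 2 : Fˣ) : F) * 1)
      refine P_norm _ u (hne 1 u one_ne_zero hu) ?_
      rw [← hu, ← map_mul, hh_xx, map_mul, mul_inv_cancel_right, hu', xx10]
    have e01 : (ψ (hh t0)) 0 1 = 0 := by
      obtain ⟨u, hu⟩ := h2 1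
      have h5 : hh t0 * yy 1 * (hh t0)⁻¹ = yy (((t0⁻¹ ^ 2 : Fˣ) : F)) := by
        apply sl_ext <;> simp [sq]
      obtain ⟨u', hu'⟩ := h2 (((t0⁻¹ ^ 2 : Fˣ) : F))
      have h6 : (ψ (hh t0) * yy u * (ψ (hh t0))⁻¹) 0 1 = 0 := by
        rw [← hu, ← map_inv, ← map_mul, ← map_mul, h5, hu', yy01]
      simp at h6
      have h7 : u * ((ψ (hh t0)) 0 1) ^ 2 = 0 := by linear_combination -h6
      simpa [hne' 1 u one_ne_zero hu] using h7
    obtain ⟨s, u, e⟩ := bor _ e10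
    refine ⟨s, ?_⟩
    rw [e] at e01 ⊢
    simp at e01
    rw [e01, xx_zero, mul_one]
  obtain ⟨s, hs⟩ := hT
  obtain ⟨k, hk⟩ := ht0 s
  have hall : ∀ z : Fˣ, ψ (hh z) = hh z ^ k := by
    intro z
    obtain ⟨n, rfl⟩ := ht0 z
    rw [map_pow, map_pow, hs, hk, map_pow, ← pow_mul, ← pow_mul, mul_comm]
  refine ⟨k, h1, hall, ?_, fun h5 => ?_⟩
  · rw [← hto, ← pow_eq_pow_iff_modEq]
    apply hh_inj
    have : ∀ n : ℕ, (ψ ^ n) (hh t0) = hh (t0 ^ (k ^ n)) := by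
      intro n
      induction n with
      | zero => simp
      | succ n ih => rw [pow_succ', MulAut.mul_apply, ih, hall, ← map_pow, ← pow_mul, pow_succ]
    have h6 := this t
    rw [h3, MulAut.one_apply] at h6
    rw [← h6, pow_one]
  · refine h4 (aut_triv ψ ht h3 htq h1 h2 fun z => ?_)
    rw [hall, ← map_pow]
    obtain ⟨n, rfl⟩ := ht0 z
    congr 1
    rw [← pow_mul, pow_eq_pow_iff_modEq, hto]
    simpa using h5.mul_left n
end Aut

end

section
open CategoryTheory

section CaseV
variable {F : Type} [Field F] [CharP F 2]

theorem aut_rep [Fintype F] (hq : 4 ≤ Fintype.card F) (φ : MulAut (SLF F)) {t : ℕ} (ht : t.Prime)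
    (hφ : φ ^ t = 1) (htS : ¬ t ∣ Nat.card (SLF F)) {E : Type} [AddCommGroup E] [Module ℂ E]
    [FiniteDimensional ℂ E] {ρ : SLF F → E →ₗ[ℂ] E} (hρ : PRep (fun _ _ => 1) ρ) (hi : Irr ρ)
    (hd : Module.finrank ℂ (fixP xx ρ) = 2) {t0 : Fˣ} {μ : ℂ}
    (hμ : IsPrimitiveRoot μ (Fintype.card F - 1)) {v : E} (hv : v ∈ fixP xx ρ) (hv0 : v ≠ 0)
    (he : ρ (hh t0) v = μ • v) (X : E →ₗ[ℂ] E) (hX0 : X ≠ 0)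
    (hX : ∀ m, X * ρ (φ m) = ρ m * X) : φ = 1 := by
  obtain ⟨g, k, h1, h2, hk, h3⟩ := aut_norm hq φ ht hφ htS
  apply h3
  have hmul : ∀ a b, ρ (a * b) = ρ a * ρ b := fun a b => by
    have := hρ.mul a b; rw [this, one_smul]
  have hgi : ρ g⁻¹ * ρ g = 1 := by rw [← hmul, inv_mul_cancel, hρ.one]
  have hgi' : ρ g * ρ g⁻¹ = 1 := by rw [← hmul, mul_inv_cancel, hρ.one]
  set Y : E →ₗ[ℂ] E := ρ g * X * ρ g⁻¹ with hY
  have hXY : X = ρ g⁻¹ * Y * ρ g := by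
    rw [hY]
    calc X = 1 * X * 1 := by simp
      _ = _ := by rw [← hgi]; simp only [mul_assoc]
  have hYm : ∀ m, Y * ρ ((MulAut.conj g * φ * (MulAut.conj g)⁻¹) m) = ρ m * Y := by
    intro m
    rw [MulAut.mul_apply, MulAut.mul_apply, MulAut.conj_inv_apply, MulAut.conj_apply, hmul, hmul, hY]
    calc ρ g * X * ρ g⁻¹ * (ρ g * ρ (φ (g⁻¹ * m * g)) * ρ g⁻¹)
        = ρ g * (X * (ρ g⁻¹ * ρ g) * ρ (φ (g⁻¹ * m * g))) * ρ g⁻¹ := by simp only [mul_assoc]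
      _ = ρ g * (ρ (g⁻¹ * m * g) * X) * ρ g⁻¹ := by rw [hgi, mul_one, hX]
      _ = (ρ g * ρ g⁻¹) * ρ m * (ρ g * X * ρ g⁻¹) := by rw [hmul, hmul]; simp only [mul_assoc]
      _ = _ := by rw [hgi', one_mul]
  have hY0 : Y ≠ 0 := by
    intro h; rw [h] at hXY; exact hX0 (by rw [hXY]; simp)
  generalize MulAut.conj g * φ * (MulAut.conj g)⁻¹ = ψ at *
  have hYi : Function.Injective Y := by
    refine Irr.inj (ρ := fun m => ρ (ψ m)) (ρ' := ρ) (hi.comp_surj ψ ψ.surjective) Y ?_ hY0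
    intro m w
    exact LinearMap.congr_fun (hYm m) w
  have hYf : ∀ w ∈ fixP xx ρ, Y w ∈ fixP xx ρ := by
    intro w hw u
    obtain ⟨u', hu'⟩ := h1 u
    have := LinearMap.congr_fun (hYm (xx u)) w
    rw [hu'] at this
    change Y (ρ (xx u') w) = ρ (xx u) (Y w) at this
    rw [← this, hw u']
  have hpow : ∀ (s : SLF F) (n : ℕ), ρ (s ^ n) = ρ s ^ n := by
    intro s n
    induction n with
    | zero => simp [hρ.one]
    | succ n ih => rw [pow_succ, hmul, ih, pow_succ]
  have heig : ∀ (w : E) (c : ℂ), ρ (hh t0) w = c • w → ρ (hh t0) (Y w) = c ^ k • Y w := by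
    intro w c hw
    have := LinearMap.congr_fun (hYm (hh t0)) w
    rw [h2, hpow] at this
    change Y ((ρ (hh t0) ^ k) w) = ρ (hh t0) (Y w) at this
    rw [← this]
    have h5 : ∀ n : ℕ, (ρ (hh t0) ^ n) w = c ^ n • w := by
      intro n
      induction n with
      | zero => simp
      | succ n ih => rw [pow_succ, Module.End.mul_apply, hw, map_smul, ih, smul_smul, pow_succ']
    rw [h5, map_smul]
  have hall : ∀ n : ℕ, (Y ^ n) v ∈ fixP xx ρ ∧ (Y ^ n) v ≠ 0 ∧
      ρ (hh t0) ((Y ^ n) v) = μ ^ (k ^ n) • (Y ^ n) v := by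
    intro n
    induction n with
    | zero => exact ⟨by simpa using hv, by simpa using hv0, by simpa using he⟩
    | succ n ih =>
      obtain ⟨i1, i2, i3⟩ := ih
      rw [pow_succ', Module.End.mul_apply]
      refine ⟨hYf _ i1, fun h => i2 (hYi (by rw [h, map_zero])), ?_⟩
      rw [heig _ _ i3, ← pow_mul, ← pow_succ]
  have hn0 : Fintype.card F - 1 ≠ 0 := by omega
  have hmod : ∀ a b : ℕ, μ ^ a = μ ^ b → a ≡ b [MOD Fintype.card F - 1] := by
    intro a b hab
    have hμu : orderOf μ = Fintype.card F - 1 := hμ.eq_orderOf.symm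
    have hu : IsUnit μ := hμ.isUnit hn0
    obtain ⟨ν, rfl⟩ := hu
    rw [← hμu, orderOf_units, ← pow_eq_pow_iff_modEq]
    exact Units.ext (by simpa using hab)
  have hodd : Odd t := ht.odd_of_ne_two (by
    rintro rfl
    exact htS (by rw [sl_card]; exact two_dvd_card.mul_right _))
  have hk2 : k ^ 2 ≡ 1 [MOD Fintype.card F - 1] → k ≡ 1 [MOD Fintype.card F - 1] := by
    intro h
    obtain ⟨m, rfl⟩ := hodd
    rw [pow_succ, pow_mul] at hk
    have h5 := (h.pow m).mul_right k
    rw [one_pow, one_mul] at h5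
    exact h5.symm.trans hk
  by_cases hinj : Function.Injective (fun i : Fin 3 => μ ^ (k ^ (i : ℕ)))
  · exfalso
    have hli := Module.End.eigenvectors_linearIndependent' (ρ (hh t0)) (fun i : Fin 3 => μ ^ (k ^ (i : ℕ)))
      hinj (fun i => (Y ^ (i : ℕ)) v) (fun i => ⟨Module.End.mem_eigenspace_iff.2 (hall i).2.2, (hall i).2.1⟩)
    have hli2 : LinearIndependent ℂ (fun i : Fin 3 => (⟨(Y ^ (i : ℕ)) v, (hall i).1⟩ : fixP xx ρ)) :=
      LinearIndependent.of_comp (fixP xx ρ).subtype hli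
    have := hli2.fintype_card_le_finrank
    rw [hd] at this
    simp at this
  · have h01 : μ ^ k ^ 0 = μ ^ k ^ 1 → k ≡ 1 [MOD Fintype.card F - 1] := fun h => by
      simpa using (hmod _ _ h).symm
    have h02 : μ ^ k ^ 0 = μ ^ k ^ 2 → k ≡ 1 [MOD Fintype.card F - 1] := fun h => by
      exact hk2 (by simpa using (hmod _ _ h).symm)
    have h12 : μ ^ k ^ 1 = μ ^ k ^ 2 → k ≡ 1 [MOD Fintype.card F - 1] := fun h => by
      have h5 := (hmod _ _ h).symm.mul_left (k ^ (t - 1))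
      rw [← pow_add, ← pow_add, show t - 1 + 2 = t + 1 by have := ht.pos; omega,
        show t - 1 + 1 = t by have := ht.pos; omega, pow_succ] at h5
      have h6 := (hk.mul_right k).symm.trans (h5.trans hk)
      simpa using h6
    rw [Function.Injective] at hinj
    push Not at hinj
    obtain ⟨i, j, hij, hne⟩ := hinj
    fin_cases i <;> fin_cases j <;> simp only [Fin.isValue] at hij hne
    · exact absurd rfl hne
    · exact h01 hij
    · exact h02 hij
    · exact h01 hij.symm
    · exact absurd rfl hne
    · exact h12 hij
    · exact h02 hij.symm
    · exact h12 hij.symm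
    · exact absurd rfl hne

theorem exists_D [Fintype F] (hq : 4 ≤ Fintype.card F) :
    ∃ (E : Type) (_ : AddCommGroup E) (_ : Module ℂ E) (_ : FiniteDimensional ℂ E)
      (ρ : SLF F → E →ₗ[ℂ] E) (t0 : Fˣ) (μ : ℂ) (v : E), PRep (fun _ _ => 1) ρ ∧ Irr ρ ∧
      Module.finrank ℂ E = Fintype.card F + 1 ∧ Module.finrank ℂ (fixP xx ρ) = 2 ∧
      IsPrimitiveRoot μ (Fintype.card F - 1) ∧ v ∈ fixP xx ρ ∧ v ≠ 0 ∧ ρ (hh t0) v = μ • v := by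
  obtain ⟨t0, ht0, ht1, hto⟩ := exists_gen F (by rwa [Nat.card_eq_fintype_card])
  rw [Nat.card_eq_fintype_card] at hto
  have hn0 : Fintype.card F - 1 ≠ 0 := by omega
  have hζ := Complex.isPrimitiveRoot_exp _ hn0
  set ζ := Complex.exp (2 * Real.pi * Complex.I / (Fintype.card F - 1 : ℕ))
  have hα : Cocyc (fun _ _ : SLF F => (1 : ℂ)) := ⟨by simp, by simp, by simp⟩
  have hreg := treg_prep hα
  obtain ⟨E, _, _, _, ρ, p, hρ, hi, h1, h2, -, -, v, hv, hv0, he⟩ :=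
    exists_ps hq (α := fun _ _ => 1) ⟨by simp, by simp⟩ hα ht0 ht1 hto ζ (hζ.ne_zero hn0) (by
      rw [hζ.pow_eq_one, one_smul]
      have hp := map_pow hreg.toHom (hh t0) (Fintype.card F - 1)
      rw [← map_pow, ← hto, pow_orderOf_eq_one, map_one, map_one, hto] at hp
      exact hp.symm) (by
      intro h
      have h' : ζ ^ 2 = 1 := by rw [h]; simp
      have := Nat.le_of_dvd (by norm_num) ((hζ.pow_eq_one_iff_dvd 2).1 h')
      omega)
  exact ⟨E, _, _, inferInstance, ρ, t0, ζ, v, hρ, hi, h1, h2, hζ, hv, hv0, he⟩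

variable {A : Type} [Group A] [Finite A] (S : Subgroup A) [S.Normal]

noncomputable def cjA (e : SLF F ≃* S) : A →* MulAut (SLF F) :=
  (MulAut.congr e.symm).toMonoidHom.comp MulAut.conjNormal

theorem cjA_apply (e : SLF F ≃* S) (x : A) (m : SLF F) : (e (cjA S e x m) : A) = x * e m * x⁻¹ := by
  simp [cjA, MulAut.congr]

theorem cjA_one (e : SLF F ≃* S) (hc : Subgroup.centralizer (S : Set A) = ⊥) {x : A}
    (h : cjA S e x = 1) : x = 1 := by
  rw [← Subgroup.mem_bot, ← hc, Subgroup.mem_centralizer_iff]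
  intro s hs
  have := cjA_apply S e x (e.symm ⟨s, hs⟩)
  rw [h, MulAut.one_apply, e.apply_symm_apply] at this
  simp only at this
  nth_rw 1 [this]
  group

theorem caseV16 [Fintype F] (hq : Fintype.card F = 16) (e : SLF F ≃* S)
    (hc : Subgroup.centralizer (S : Set A) = ⊥) {t : ℕ} (ht : t.Prime)
    (htS : ¬ t ∣ Nat.card (SLF F)) : ¬ t ∣ Nat.card A := by
  intro htA
  have : Fact t.Prime := ⟨ht⟩
  obtain ⟨x, hx⟩ := exists_prime_orderOf_dvd_card' t htA
  have hφ : (cjA S e x) ^ t = 1 := by rw [← map_pow, ← hx, pow_orderOf_eq_one, map_one]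
  obtain ⟨g, k, -, -, hk, h3⟩ := aut_norm (by omega) _ ht hφ htS
  have hx1 : x = 1 := by
    apply cjA_one S e hc
    apply h3
    rw [hq] at hk ⊢
    have hodd : t ≠ 2 := by
      rintro rfl
      exact htS (by rw [sl_card]; exact two_dvd_card.mul_right _)
    have hk1 : ((k : ZMod 15)) ^ t = 1 := by
      have := (ZMod.natCast_eq_natCast_iff _ _ 15).2 hk
      simpa using this
    have hk4 : ((k : ZMod 15)) ^ 4 = 1 := by
      have hu : IsUnit (k : ZMod 15) := IsUnit.of_pow_eq_one hk1 ht.ne_zero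
      revert hu
      generalize (k : ZMod 15) = z
      revert z
      decide
    have h5 : orderOf (k : ZMod 15) ∣ Nat.gcd t 4 :=
      Nat.dvd_gcd (orderOf_dvd_of_pow_eq_one hk1) (orderOf_dvd_of_pow_eq_one hk4)
    have h6 : Nat.gcd t (2 ^ 2) = 1 := Nat.Coprime.pow_right 2 (
      (Nat.coprime_primes ht Nat.prime_two).2 hodd)
    rw [show 4 = 2 ^ 2 from rfl, h6, Nat.dvd_one, orderOf_eq_one_iff] at h5
    exact (ZMod.natCast_eq_natCast_iff _ _ _).1 (by simpa using h5)
  rw [hx1, orderOf_one] at hx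
  exact ht.ne_one hx.symm

theorem caseV [Fintype F] (hq : 4 ≤ Fintype.card F) (e : SLF F ≃* S)
    (hc : Subgroup.centralizer (S : Set A) = ⊥) {t : ℕ} (ht : t.Prime) (htA : t ∣ Nat.card A)
    (htS : ¬ t ∣ Nat.card (SLF F)) : ∃ n ∈ charDegrees A, t * (Fintype.card F + 1) ∣ n := by
  have : Fact t.Prime := ⟨ht⟩
  obtain ⟨E, _, _, _, ρ, t0, μ, v, hρ, hi, h1, h2, hμ, hv, hv0, he⟩ := exists_D hq
  let π : A →* A ⧸ S := QuotientGroup.mk' S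
  have hπ : Function.Surjective π := QuotientGroup.mk'_surjective S
  have hker : π.ker = S := QuotientGroup.ker_mk' S
  let e' : π.ker ≃* SLF F := (MulEquiv.subgroupCongr hker).trans e.symm
  obtain ⟨θ, hθ, hθv⟩ := NRep.ofKer (π := π) (hρ.comp e'.toMonoidHom)
    (hi.comp_surj e' e'.surjective)
  have hθ2 : ∀ m : SLF F, θ (e m : A) = ρ m := by
    intro m
    have hm : (e m : A) ∈ π.ker := by rw [hker]; exact (e m).2
    rw [hθv ⟨_, hm⟩]
    change ρ (e.symm ⟨(e m : A), _⟩) = ρ m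
    congr 1
    exact e.symm_apply_apply m
  obtain ⟨H, B, β, hL⟩ := exists_lift hπ hθ
  obtain ⟨E2, _, _, _, ρE, hE, hEi⟩ := exists_alp_irr (hL.cocyc hπ hθ)
  refine ⟨_, clifford_up hπ hθ hL hE hEi, ?_⟩
  rw [h1]
  refine mul_dvd_mul ?_ (dvd_mul_right _ _)
  by_contra hti
  have hcard := (H.comap π).card_mul_index
  rw [Subgroup.index_comap_of_surjective _ hπ] at hcard
  have htH : t ∣ Nat.card (H.comap π) := by
    rw [← hcard] at htA
    exact (ht.dvd_mul.1 htA).resolve_right hti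
  obtain ⟨x, hx⟩ := exists_prime_orderOf_dvd_card' t htH
  have hx' : orderOf (x : A) = t := by rw [Subgroup.orderOf_coe, hx]
  have hφ : (cjA S e x) ^ t = 1 := by rw [← map_pow, ← hx', pow_orderOf_eq_one, map_one]
  have hst : Stab π θ (x : A)⁻¹ := by
    rw [← hL.stab, map_inv]; exact H.inv_mem x.2
  obtain ⟨X, hX0, hX⟩ := hst
  have := aut_rep hq _ ht hφ htS hρ hi h2 hμ hv hv0 he X hX0 (by
    intro m
    rw [← hθ2, ← hθ2, cjA_apply, hX]
    · congr 2; group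
    · change _ ∈ π.ker
      rw [hker]; rw [← cjA_apply]; exact (e _).2)
  have hx1 := cjA_one S e hc this
  rw [hx1, orderOf_one] at hx'
  exact ht.ne_one hx'.symm
end CaseV

end

section
open CategoryTheory

theorem ar_three {g k : ℕ} (h : 2 ^ g + 1 = 3 ^ k) : g < 4 := by
  by_contra hg
  obtain ⟨j, rfl⟩ := Nat.exists_eq_add_of_le (not_lt.1 hg)
  have h1 : 3 ^ k % 16 = 1 := by rw [← h, pow_add]; omega
  have h2 : k % 4 = 0 := by
    have h3 : k = 4 * (k / 4) + k % 4 := (Nat.div_add_mod k 4).symm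
    rw [h3, pow_add, pow_mul, Nat.mul_mod, Nat.pow_mod] at h1
    have h4 : k % 4 < 4 := Nat.mod_lt _ (by norm_num)
    interval_cases k % 4 <;> simp at h1 ⊢
  have h3 : 3 ^ k % 5 = 1 := by
    have h3 : k = 4 * (k / 4) := by omega
    rw [h3, pow_mul, Nat.pow_mod]; simp
  have h5 : 5 ∣ 2 ^ (4 + j) := by omega
  have := (Nat.Prime.dvd_of_dvd_pow (by norm_num) h5)
  omega

theorem ar_pp {n p : ℕ} (h : n.primeFactors.card = 1) (hp : p.Prime) (hpn : p ∣ n) :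
    ∃ k, n = p ^ k := by
  rw [← isPrimePow_iff_card_primeFactors_eq_one, isPrimePow_nat_iff] at h
  obtain ⟨r, k, hr, hk, rfl⟩ := h
  exact ⟨k, by rw [(Nat.prime_dvd_prime_iff_eq hp hr).1 (hp.dvd_of_dvd_pow hpn)]⟩

theorem ar_mod3 (g : ℕ) : (g % 2 = 0 → 2 ^ g % 3 = 1) ∧ (g % 2 = 1 → 2 ^ g % 3 = 2) := by
  have h3 : g = 2 * (g / 2) + g % 2 := (Nat.div_add_mod g 2).symm
  constructor <;> intro h <;> rw [h3, h, pow_add, pow_mul, Nat.mul_mod, Nat.pow_mod] <;> simp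

theorem card_pf_7 : (7 : ℕ).primeFactors.card = 1 := by
  rw [Nat.Prime.primeFactors (by norm_num)]; rfl
theorem card_pf_3 : (3 : ℕ).primeFactors.card = 1 := by
  rw [Nat.Prime.primeFactors (by norm_num)]; rfl
theorem card_pf_5 : (5 : ℕ).primeFactors.card = 1 := by
  rw [Nat.Prime.primeFactors (by norm_num)]; rfl

theorem ar_four {f : ℕ} (hf : 2 ≤ f) (h1 : (2 ^ f - 1).primeFactors.card = 2)
    (h2 : (2 ^ f + 1).primeFactors.card = 1) : f = 4 := by
  rcases Nat.mod_two_eq_zero_or_one f with hp | hp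
  · obtain ⟨g, rfl⟩ : ∃ g, f = 2 * g := ⟨f / 2, by omega⟩
    have hg1 : g ≠ 1 := by rintro rfl; norm_num [card_pf_3] at h1
    have hg2 : 2 ≤ g := by omega
    have h4 : 4 ≤ 2 ^ g := by
      calc 4 = 2 ^ 2 := rfl
        _ ≤ 2 ^ g := Nat.pow_le_pow_right (by norm_num) hg2
    have e : 2 ^ (2 * g) - 1 = (2 ^ g - 1) * (2 ^ g + 1) := by
      rw [mul_comm 2 g, pow_mul]
      obtain ⟨c, hc⟩ := Nat.exists_eq_add_of_le h4
      rw [hc]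
      have : 4 + c - 1 = 3 + c := by omega
      rw [this]
      apply Nat.sub_eq_of_eq_add; ring
    have hev : 2 ∣ 2 ^ g := dvd_pow_self 2 (by omega)
    have hcop : Nat.Coprime (2 ^ g - 1) (2 ^ g + 1) := by
      have h5 : Nat.gcd (2 ^ g - 1) (2 ^ g + 1) ∣ 2 := by
        have h6 := Nat.dvd_sub (Nat.gcd_dvd_right (2 ^ g - 1) (2 ^ g + 1)) (Nat.gcd_dvd_left (2 ^ g - 1) (2 ^ g + 1))
        have h7 : 2 ^ g + 1 - (2 ^ g - 1) = 2 := by omega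
        rwa [h7] at h6
      rcases (Nat.dvd_prime Nat.prime_two).1 h5 with h6 | h6
      · exact h6
      · have := Nat.gcd_dvd_right (2 ^ g - 1) (2 ^ g + 1)
        rw [h6] at this
        omega
    rw [e, hcop.primeFactors_mul, Finset.card_union_of_disjoint hcop.disjoint_primeFactors] at h1
    have c1 : 0 < (2 ^ g - 1).primeFactors.card := Finset.card_pos.2 (Nat.nonempty_primeFactors.2 (by omega))
    have c2 : 0 < (2 ^ g + 1).primeFactors.card := Finset.card_pos.2 (Nat.nonempty_primeFactors.2 (by omega))
    rcases Nat.mod_two_eq_zero_or_one g with hp | hp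
    · have h3 := (ar_mod3 g).1 hp
      obtain ⟨k, hk⟩ := ar_pp (p := 3) (show (2 ^ g - 1).primeFactors.card = 1 by omega) (by norm_num) (by omega)
      by_contra hne
      obtain ⟨j, rfl⟩ := Nat.exists_eq_add_of_le (show 3 ≤ g by omega)
      have h8 : 3 ^ k % 8 = 7 := by rw [← hk, pow_add] at *; omega
      have h9 : k = 2 * (k / 2) + k % 2 := (Nat.div_add_mod k 2).symm
      rw [h9, pow_add, pow_mul, Nat.mul_mod, Nat.pow_mod] at h8
      rcases Nat.mod_two_eq_zero_or_one k with h | h <;> rw [h] at h8 <;> simp at h8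
    · have h3 := (ar_mod3 g).2 hp
      obtain ⟨k, hk⟩ := ar_pp (p := 3) (show (2 ^ g + 1).primeFactors.card = 1 by omega) (by norm_num) (by omega)
      have := ar_three hk
      obtain rfl : g = 3 := by omega
      norm_num at h2
      obtain ⟨k, hk⟩ := ar_pp (p := 5) h2 (by norm_num) (by norm_num)
      have : 13 ∣ 5 ^ k := by omega
      have := (Nat.Prime.dvd_of_dvd_pow (by norm_num) this)
      omega
  · have h3 := (ar_mod3 f).2 hp
    obtain ⟨k, hk⟩ := ar_pp (p := 3) h2 (by norm_num) (by omega)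
    have := ar_three hk
    obtain rfl : f = 3 := by omega
    norm_num [card_pf_7] at h1

theorem pair_of_card {n : ℕ} (h : n.primeFactors.card = 2) : ∃ a b, a.Prime ∧ b.Prime ∧ a ≠ b ∧
    a ∣ n ∧ b ∣ n ∧ ∀ c, c.Prime → c ∣ n → c = a ∨ c = b := by
  have hn : n ≠ 0 := by rintro rfl; simp at h
  obtain ⟨a, b, hab, e⟩ := Finset.card_eq_two.1 h
  have ha : a ∈ n.primeFactors := by rw [e]; simp
  have hb : b ∈ n.primeFactors := by rw [e]; simp
  refine ⟨a, b, Nat.prime_of_mem_primeFactors ha, Nat.prime_of_mem_primeFactors hb, hab,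
    Nat.dvd_of_mem_primeFactors ha, Nat.dvd_of_mem_primeFactors hb, fun c hc hcn => ?_⟩
  have : c ∈ n.primeFactors := Nat.mem_primeFactors.2 ⟨hc, hcn, hn⟩
  rw [e] at this; simpa using this

theorem single_of_card {n : ℕ} (h : n.primeFactors.card = 1) : ∃ a, a.Prime ∧
    a ∣ n ∧ ∀ c, c.Prime → c ∣ n → c = a := by
  have hn : n ≠ 0 := by rintro rfl; simp at h
  obtain ⟨a, e⟩ := Finset.card_eq_one.1 h
  have ha : a ∈ n.primeFactors := by rw [e]; simp
  refine ⟨a, Nat.prime_of_mem_primeFactors ha, Nat.dvd_of_mem_primeFactors ha, fun c hc hcn => ?_⟩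
  have : c ∈ n.primeFactors := Nat.mem_primeFactors.2 ⟨hc, hcn, hn⟩
  rw [e] at this; simpa using this

end

section
open CategoryTheory

theorem graph_final (G : Type) [Group G] [Finite G]
    (h4 : (charGraph G).CliqueFree 4)
    (h7 : Nat.card ↥(charPrimes G) = 7) (N a b c : ℕ)
    (hN : ∀ p, p ∈ N.primeFactors ↔ p = 2 ∨ p = c ∨ p = a ∨ p = b)
    (hbip : ¬ (((charGraph G).induce
      {x : ↥(charPrimes G) | (x : ℕ) ∈ N.primeFactors})ᶜ).Colorable 2)
    (hoddcyc : ∀ (v : ↥(charPrimes G)) (w : ((charGraph G)ᶜ).Walk v v),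
      w.IsCycle → Odd w.length → ∀ x ∈ w.support, (x : ℕ) ∈ N.primeFactors)
    (hab : a ≠ b) (hadj : ∃ m ∈ charDegrees G, a * b ∣ m)
    (hkey : ∀ x, (x = a ∨ x = b) →
      (∀ m ∈ charDegrees G, ¬ 2 * c ∣ m ∧ ¬ 2 * x ∣ m ∧ ¬ c * x ∣ m) →
      ∀ t, t.Prime → t ∉ N.primeFactors → (∃ m ∈ charDegrees G, t ∣ m) →
      ∃ m ∈ charDegrees G, t * (a * b) ∣ m) : False := by
  classical
  have hpa : a.Prime := Nat.prime_of_mem_primeFactors ((hN a).2 (by simp))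
  have hpb : b.Prime := Nat.prime_of_mem_primeFactors ((hN b).2 (by simp))
  let adj : ℕ → ℕ → Prop := fun p q => ∃ m ∈ charDegrees G, p * q ∣ m
  have hsymm : ∀ p q, adj p q → adj q p := by
    rintro p q ⟨m, hm, hd⟩; exact ⟨m, hm, by rwa [mul_comm]⟩
  have hx : ∃ x, (x = a ∨ x = b) ∧ ¬ adj 2 c ∧ ¬ adj 2 x ∧ ¬ adj c x := by
    by_contra hno
    push Not at hno
    apply hbip
    have hcol : ∀ f : ℕ → Bool, (∀ p q, p ∈ N.primeFactors → q ∈ N.primeFactors → p ≠ q → f p = f q → adj p q) →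
        (((charGraph G).induce
          {x : ↥(charPrimes G) | (x : ℕ) ∈ N.primeFactors})ᶜ).Colorable 2 := by
      intro f hf
      have C : (((charGraph G).induce
          {x : ↥(charPrimes G) | (x : ℕ) ∈ N.primeFactors})ᶜ).Coloring Bool :=
        SimpleGraph.Coloring.mk (fun v => f (v : charPrimes G)) (by
          rintro ⟨⟨p, hp⟩, hp'⟩ ⟨⟨q, hq⟩, hq'⟩ ⟨h1, h2⟩ h3
          apply h2
          have hne : p ≠ q := by rintro rfl; exact h1 rfl
          exact ⟨hne, hf p q hp' hq' hne h3⟩)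
      simpa using C.colorable
    by_cases h2c : adj 2 c
    · refine hcol (fun p => decide (p = 2 ∨ p = c)) ?_
      intro p q hp hq hne hf
      rw [hN] at hp hq
      have hf2 : (p = 2 ∨ p = c) ↔ (q = 2 ∨ q = c) := decide_eq_decide.1 hf
      by_cases h : p = 2 ∨ p = c
      · have h' := hf2.1 h
        rcases h with rfl | rfl <;> rcases h' with rfl | rfl
        · exact absurd rfl hne
        · exact h2c
        · exact hsymm _ _ h2c
        · exact absurd rfl hne
      · have h' : ¬ (q = 2 ∨ q = c) := fun h' => h (hf2.2 h')
        have hp' : p = a ∨ p = b := by tauto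
        have hq' : q = a ∨ q = b := by tauto
        rcases hp' with rfl | rfl <;> rcases hq' with rfl | rfl
        · exact absurd rfl hne
        · exact hadj
        · exact hsymm _ _ hadj
        · exact absurd rfl hne
    · refine hcol (fun p => decide (p = 2 ∨ (p ≠ c ∧ adj 2 p))) ?_
      have key : ∀ x, (x = a ∨ x = b) → adj 2 x ∨ adj c x := by
        intro x hx
        by_contra h
        push Not at h
        exact h.2 (hno x hx h2c h.1)
      have main : ∀ p q, p ∈ N.primeFactors → q ∈ N.primeFactors → p ≠ q →
          (p = 2 ∨ (p ≠ c ∧ adj 2 p)) → (q = 2 ∨ (q ≠ c ∧ adj 2 q)) → adj p q := by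
        intro p q hp hq hne h h'
        rw [hN] at hp hq
        rcases h with rfl | ⟨h, h1⟩
        · rcases h' with rfl | ⟨h', h1'⟩
          · exact absurd rfl hne
          · exact h1'
        · rcases h' with rfl | ⟨h', h1'⟩
          · exact hsymm _ _ h1
          · by_cases hp2 : p = 2
            · subst hp2; exact h1'
            by_cases hq2 : q = 2
            · subst hq2; exact hsymm _ _ h1
            have hp' : p = a ∨ p = b := by tauto
            have hq' : q = a ∨ q = b := by tauto
            rcases hp' with rfl | rfl <;> rcases hq' with rfl | rfl
            · exact absurd rfl hne
            · exact hadj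
            · exact hsymm _ _ hadj
            · exact absurd rfl hne
      have main2 : ∀ p q, p ∈ N.primeFactors → q ∈ N.primeFactors → p ≠ q →
          ¬ (p = 2 ∨ (p ≠ c ∧ adj 2 p)) → ¬ (q = 2 ∨ (q ≠ c ∧ adj 2 q)) → adj p q := by
        intro p q hp hq hne h h'
        rw [hN] at hp hq
        by_cases hpc : p = c
        · subst hpc
          have hq' : q = a ∨ q = b := by
            rcases hq with h1 | h1 | h1
            · exact absurd (Or.inl h1) h'
            · exact absurd h1.symm hne
            · exact h1
          exact (key q hq').resolve_left fun h1 => h' (Or.inr ⟨hne.symm, h1⟩)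
        by_cases hqc : q = c
        · subst hqc
          have hp' : p = a ∨ p = b := by
            rcases hp with h1 | h1 | h1
            · exact absurd (Or.inl h1) h
            · exact absurd h1 hne
            · exact h1
          exact hsymm _ _ ((key p hp').resolve_left fun h1 => h (Or.inr ⟨hne, h1⟩))
        have hp' : p = a ∨ p = b := by tauto
        have hq' : q = a ∨ q = b := by tauto
        rcases hp' with rfl | rfl <;> rcases hq' with rfl | rfl
        · exact absurd rfl hne
        · exact hadj
        · exact hsymm _ _ hadj
        · exact absurd rfl hne
      intro p q hp hq hne hf
      have hf2 := decide_eq_decide.1 hf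
      by_cases h : (p = 2 ∨ (p ≠ c ∧ adj 2 p))
      · exact main p q hp hq hne h (hf2.1 h)
      · exact main2 p q hp hq hne h fun h' => h (hf2.2 h')
  obtain ⟨x, hxab, hx1, hx2, hx3⟩ := hx
  have hk := hkey x hxab fun m hm => ⟨fun h => hx1 ⟨m, hm, h⟩, fun h => hx2 ⟨m, hm, h⟩, fun h => hx3 ⟨m, hm, h⟩⟩
  have hT : 2 < (charPrimes G \ ({2, c, a, b} : Set ℕ)).ncard := by
    have h1 : ({2, c, a, b} : Set ℕ).ncard ≤ 4 := by
      refine (Set.ncard_insert_le _ _).trans (Nat.succ_le_succ ?_)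
      refine (Set.ncard_insert_le _ _).trans (Nat.succ_le_succ ?_)
      refine (Set.ncard_insert_le _ _).trans (Nat.succ_le_succ ?_)
      simp
    have h2 := Set.le_ncard_sdiff ({2, c, a, b} : Set ℕ) (charPrimes G) (by simp)
    have h3 : (charPrimes G).ncard = 7 := h7
    omega
  obtain ⟨t1, t2, t3, m1, m2, m3, d12, d13, d23⟩ := (Set.two_lt_ncard_iff (Set.finite_of_ncard_pos (by omega))).1 hT
  have hnot : ∀ t, t ∈ charPrimes G \ ({2, c, a, b} : Set ℕ) → t ∉ N.primeFactors := by
    intro t ht h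
    rw [hN] at h
    exact ht.2 (by simpa using h)
  obtain ⟨mab, hmab, hdab⟩ := hadj
  have ha : a ∈ charPrimes G := ⟨hpa, mab, hmab, (dvd_mul_right _ _).trans hdab⟩
  have hb : b ∈ charPrimes G := ⟨hpb, mab, hmab, (dvd_mul_left _ _).trans hdab⟩
  have hnon : ∀ t t' (ht : t ∈ charPrimes G \ ({2, c, a, b} : Set ℕ)) (ht' : t' ∈ charPrimes G \ ({2, c, a, b} : Set ℕ)),
      t ≠ t' → (charGraph G)ᶜ.Adj ⟨t, ht.1⟩ ⟨t', ht'.1⟩ := by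
    intro t t' ht ht' hne
    rw [SimpleGraph.compl_adj]
    refine ⟨fun h => hne (congrArg Subtype.val h), fun hadj' => ?_⟩
    obtain ⟨m, hm, hd⟩ := hk t ht.1.1 (hnot t ht) ht.1.2
    obtain ⟨m', hm', hd'⟩ := hk t' ht'.1.1 (hnot t' ht') ht'.1.2
    have na : t ≠ a := fun h => ht.2 (by simp [h])
    have nb : t ≠ b := fun h => ht.2 (by simp [h])
    have na' : t' ≠ a := fun h => ht'.2 (by simp [h])
    have nb' : t' ≠ b := fun h => ht'.2 (by simp [h])
    have A1 : (charGraph G).Adj ⟨t, ht.1⟩ ⟨a, ha⟩ := ⟨na, m, hm, (mul_dvd_mul_left t (dvd_mul_right a b)).trans hd⟩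
    have A2 : (charGraph G).Adj ⟨t, ht.1⟩ ⟨b, hb⟩ := ⟨nb, m, hm, (mul_dvd_mul_left t (dvd_mul_left b a)).trans hd⟩
    have A3 : (charGraph G).Adj ⟨t', ht'.1⟩ ⟨a, ha⟩ := ⟨na', m', hm', (mul_dvd_mul_left t' (dvd_mul_right a b)).trans hd'⟩
    have A4 : (charGraph G).Adj ⟨t', ht'.1⟩ ⟨b, hb⟩ := ⟨nb', m', hm', (mul_dvd_mul_left t' (dvd_mul_left b a)).trans hd'⟩
    have A5 : (charGraph G).Adj ⟨a, ha⟩ ⟨b, hb⟩ := ⟨hab, mab, hmab, hdab⟩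
    refine h4 {⟨t, ht.1⟩, ⟨t', ht'.1⟩, ⟨a, ha⟩, ⟨b, hb⟩} ⟨?_, ?_⟩
    · simp [SimpleGraph.isClique_insert, A1, A2, A3, A4, A5, hadj']
    · rw [Finset.card_insert_of_notMem, Finset.card_insert_of_notMem, Finset.card_insert_of_notMem,
        Finset.card_singleton] <;> simp [*]
  have B1 := hnon t1 t2 m1 m2 d12
  have B2 := hnon t2 t3 m2 m3 d23
  have B3 := hnon t3 t1 m3 m1 d13.symm
  have := hoddcyc _ (SimpleGraph.Walk.cons B1 (.cons B2 (.cons B3 .nil))) (by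
    rw [SimpleGraph.Walk.cons_isCycle_iff]
    constructor
    · simp [SimpleGraph.Walk.cons_isPath_iff, d12, d13, d23, Ne.symm d12, Ne.symm d13, Ne.symm d23]
    · simp [d12, d13, d23, Ne.symm d12, Ne.symm d13, Ne.symm d23]) (by simp; decide) ⟨t1, m1.1⟩ (by simp)
  exact hnot t1 m1 this

end

open CategoryTheory

theorem psl_sl (F : Type) [Field F] [CharP F 2] : Nonempty (PSL2 F ≃* SLF F) := by
  have hc : Subgroup.center (SLF F) = ⊥ := by
    rw [eq_bot_iff]
    intro k hk
    rw [Subgroup.mem_center_iff] at hk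
    have h1 := congrArg (fun a : SLF F => a 0 0) (hk (xx 1))
    have h2 := congrArg (fun a : SLF F => a 0 1) (hk (xx 1))
    have h3 := congrArg (fun a : SLF F => a 0 0) (hk (yy 1))
    have hd := sl_det k
    simp at h1 h2 h3
    have h4 : k 1 1 = k 0 0 := by linear_combination h2
    rw [h1, h4, mul_zero, sub_zero, ← sq] at hd
    have h5 : k 0 0 = 1 := CharTwo.sq_injective (by simpa using hd)
    rw [Subgroup.mem_bot]
    apply sl_ext <;> simp [h1, h4, h5, h3]
  exact ⟨(QuotientGroup.quotientMulEquivOfEq hc).trans QuotientGroup.quotientBot⟩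

section Fin
variable {F : Type} [Field F] [CharP F 2] [Fintype F] {G : Type} [Group G] [Finite G]

theorem exists_pi (R M : Subgroup G) [R.Normal] (e : SLF F ≃* M.map (QuotientGroup.mk' R)) :
    ∃ π : M →* SLF F, Function.Surjective π ∧ ∀ m : M, π m = 1 ↔ (m : G) ∈ R := by
  refine ⟨e.symm.toMonoidHom.comp ((QuotientGroup.mk' R).subgroupMap M),
    e.symm.surjective.comp (MonoidHom.subgroupMap_surjective _ _), fun m => ?_⟩
  rw [MonoidHom.comp_apply]
  change e.symm _ = 1 ↔ _
  rw [EmbeddingLike.map_eq_one_iff, ← Subtype.coe_inj]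
  change (QuotientGroup.mk' R) (m : G) = 1 ↔ _
  exact QuotientGroup.eq_one_iff _

theorem adj_pm (hq : 4 < Fintype.card F) (M : Subgroup G) [M.Normal] {π : M →* SLF F}
    (hπ : Function.Surjective π) :
    (∃ m ∈ charDegrees G, Fintype.card F - 1 ∣ m) ∧ (∃ m ∈ charDegrees G, Fintype.card F + 1 ∣ m) := by
  have hα : Cocyc (fun _ _ : SLF F => (1 : ℂ)) := ⟨by simp, by simp, by simp⟩
  obtain ⟨⟨E, _, _, _, ρ, hρ, hi, hd⟩, ⟨E', _, _, _, ρ', hρ', hi', hd'⟩⟩ := thmIV hq hα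
  constructor
  · obtain ⟨m, hm, h⟩ := cd_normal M (cd_quot π hπ (mem_cd.2 ⟨E, _, _, inferInstance, ρ, hρ, hi, rfl⟩))
    exact ⟨m, hm, hd.trans h⟩
  · obtain ⟨m, hm, h⟩ := cd_normal M (cd_quot π hπ (mem_cd.2 ⟨E', _, _, inferInstance, ρ', hρ', hi', rfl⟩))
    exact ⟨m, hm, hd'.trans h⟩

theorem key_t (hq : 4 < Fintype.card F) (R M : Subgroup G) [R.Normal] [M.Normal] (hRM : R ≤ M)
    (e : SLF F ≃* M.map (QuotientGroup.mk' R))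
    (hcent : Subgroup.centralizer ((M.map (QuotientGroup.mk' R)) : Set (G ⧸ R)) = ⊥)
    {p r : ℕ} (hp : p.Prime) (hr : r.Prime)
    (hpq : p ∣ Fintype.card F - 1) (hrq : r ∣ Fintype.card F + 1)
    (hcase : (∃ k, Fintype.card F - 1 = p ^ k) ∨ (Fintype.card F = 16 ∧ r = 17))
    (hn : ∀ m ∈ charDegrees G, ¬ 2 * p ∣ m ∧ ¬ 2 * r ∣ m ∧ ¬ p * r ∣ m)
    {t : ℕ} (ht : t.Prime) (htS : ¬ t ∣ Nat.card (SLF F)) (htG : ∃ m ∈ charDegrees G, t ∣ m) :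
    (∃ m ∈ charDegrees G, t * (Fintype.card F + 1) ∣ m) ∧
    (Fintype.card F = 16 → ∃ m ∈ charDegrees G, t * (Fintype.card F - 1) ∣ m) := by
  have : (M.map (QuotientGroup.mk' R)).Normal :=
    Subgroup.Normal.map inferInstance _ (QuotientGroup.mk'_surjective R)
  by_cases htA : t ∣ Nat.card (G ⧸ R)
  · constructor
    · obtain ⟨n, hn, hd⟩ := caseV _ hq.le e hcent ht htA htS
      exact ⟨n, cd_quot (QuotientGroup.mk' R) (QuotientGroup.mk'_surjective R) hn, hd⟩
    · intro h16
      exact (caseV16 _ h16 e hcent ht htS htA).elim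
  obtain ⟨π, hπ, hker⟩ := exists_pi R M e
  obtain ⟨m, hm, htm⟩ := htG
  obtain ⟨V, _, _, _, ρ, hρ, hi, rfl⟩ := mem_cd.1 hm
  obtain ⟨W, _, _, _, θ, hθ, hd⟩ := clifford_down (QuotientGroup.mk'_surjective R) hρ hi
  have htW : t ∣ Module.finrank ℂ W := (ht.dvd_mul.1 (htm.trans hd)).resolve_left htA
  have hmk : ∀ g : G, (QuotientGroup.mk' R) g = 1 ↔ g ∈ R := fun g => QuotientGroup.eq_one_iff g
  have hθ' : NRep π (fun m : M => θ (m : G)) := by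
    refine ⟨hθ.one, fun n m hn hm => ?_, ?_⟩
    · exact hθ.mul _ _ ((hmk _).2 ((hker n).1 hn)) ((hmk _).2 ((hker m).1 hm))
    · refine hθ.irr.comp_surj (fun n : π.ker => (⟨((n : M) : G), (hmk _).2 ((hker n).1 n.2)⟩ :
        (QuotientGroup.mk' R).ker)) ?_
      rintro ⟨g, hg⟩
      have hgR : g ∈ R := (hmk g).1 hg
      exact ⟨⟨⟨g, hRM hgR⟩, (hker _).2 hgR⟩, rfl⟩
  obtain ⟨⟨m1, hm1, d1⟩, ⟨m2, hm2, d2⟩⟩ := inv_up hπ hq hp hr hpq hrq hcase (by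
    intro m hm
    obtain ⟨m', hm', hd'⟩ := cd_normal M hm
    obtain ⟨n1, n2, n3⟩ := hn m' hm'
    exact ⟨fun h => n1 (h.trans hd'), fun h => n2 (h.trans hd'), fun h => n3 (h.trans hd')⟩) hθ'
  constructor
  · obtain ⟨m', hm', hd'⟩ := cd_normal M hm2
    exact ⟨m', hm', ((mul_dvd_mul_right htW _).trans d2).trans hd'⟩
  · intro _
    obtain ⟨m', hm', hd'⟩ := cd_normal M hm1
    exact ⟨m', hm', ((mul_dvd_mul_right htW _).trans d1).trans hd'⟩
end Fin

theorem mem_pf {f n N : ℕ} (hf : 2 ≤ f) (hN : N = 2 ^ f * ((2 ^ f - 1) * (2 ^ f + 1))) :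
    n ∈ N.primeFactors ↔ n.Prime ∧ (n = 2 ∨ n ∣ 2 ^ f - 1 ∨ n ∣ 2 ^ f + 1) := by
  have h4 : 4 ≤ 2 ^ f := Nat.pow_le_pow_right (n := 2) (by norm_num) hf
  have h0 : N ≠ 0 := by
    rw [hN]
    refine mul_ne_zero (by omega) (mul_ne_zero (by omega) (by omega))
  rw [Nat.mem_primeFactors]
  constructor
  · rintro ⟨hn, hd, -⟩
    refine ⟨hn, ?_⟩
    rw [hN, hn.dvd_mul, hn.dvd_mul] at hd
    exact hd.imp_left fun h => (Nat.prime_dvd_prime_iff_eq hn Nat.prime_two).1 (hn.dvd_of_dvd_pow h)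
  · rintro ⟨hn, h⟩
    refine ⟨hn, ?_, h0⟩
    rw [hN, hn.dvd_mul, hn.dvd_mul]
    exact h.imp_left fun h => by rw [h]; exact dvd_pow_self 2 (by omega)

theorem stmt11 (G : Type) [Group G] [Finite G]
    (h4 : (charGraph G).CliqueFree 4)
    (h7 : Nat.card ↥(charPrimes G) = 7)
    (M : Subgroup G) (hM : M.Normal) (hRM : solvableRadical G < M)
    (f : ℕ) (hf : 2 ≤ f)
    (hS : Nonempty (↥(radicalQuotImage M) ≃* PSL2 (GaloisField 2 f)))
    (hcent : Subgroup.centralizer ((radicalQuotImage M) : Set (G ⧸ solvableRadical G)) = ⊥)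
    (hbip : ¬ (((charGraph G).induce
      {x : ↥(charPrimes G) | (x : ℕ) ∈ (Nat.card ↥(radicalQuotImage M)).primeFactors})ᶜ).Colorable 2)
    (hoddcyc : ∀ (v : ↥(charPrimes G)) (w : ((charGraph G)ᶜ).Walk v v),
      w.IsCycle → Odd w.length →
      ∀ x ∈ w.support, (x : ℕ) ∈ (Nat.card ↥(radicalQuotImage M)).primeFactors) :
    ¬ (((2 ^ f - 1).primeFactors.card = 1 ∧ (2 ^ f + 1).primeFactors.card = 2) ∨
       ((2 ^ f - 1).primeFactors.card = 2 ∧ (2 ^ f + 1).primeFactors.card = 1)) := by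
  intro hor
  obtain ⟨e0⟩ := hS
  obtain ⟨e1⟩ := psl_sl (GaloisField 2 f)
  let e : SLF (GaloisField 2 f) ≃* radicalQuotImage M := (e0.trans e1).symm
  have : Fintype (GaloisField 2 f) := Fintype.ofFinite _
  have hq : Fintype.card (GaloisField 2 f) = 2 ^ f := by
    rw [← Nat.card_eq_fintype_card, GaloisField.card 2 f (by omega)]
  have hcS : Nat.card (radicalQuotImage M) = Nat.card (SLF (GaloisField 2 f)) :=
    (Nat.card_congr e.toEquiv).symm
  have hcS2 : Nat.card (radicalQuotImage M) = 2 ^ f * ((2 ^ f - 1) * (2 ^ f + 1)) := by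
    rw [hcS, sl_card, hq]
  have hf3 : f ≠ 2 := by
    rintro rfl
    rcases hor with ⟨-, h⟩ | ⟨h, -⟩
    · norm_num [card_pf_5] at h
    · norm_num [card_pf_3] at h
  have hq4 : 4 < Fintype.card (GaloisField 2 f) := by
    rw [hq]
    calc 4 < 2 ^ 3 := by norm_num
      _ ≤ 2 ^ f := Nat.pow_le_pow_right (by norm_num) (by omega)
  have htS : ∀ t, t.Prime → t ∉ (Nat.card (radicalQuotImage M)).primeFactors →
      ¬ t ∣ Nat.card (SLF (GaloisField 2 f)) := by
    intro t ht h h'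
    rw [← hcS] at h'
    exact h (Nat.mem_primeFactors.2 ⟨ht, h', by rw [hcS]; exact Nat.card_pos.ne'⟩)
  obtain ⟨π, hπ, -⟩ := exists_pi (solvableRadical G) M e
  obtain ⟨⟨m1, hm1, d1⟩, ⟨m2, hm2, d2⟩⟩ := adj_pm hq4 M hπ
  rcases hor with ⟨h1, h2⟩ | ⟨h1, h2⟩
  · obtain ⟨c, hc, hcd, hcu⟩ := single_of_card h1
    obtain ⟨a, b, ha, hb, hab, had, hbd, hu⟩ := pair_of_card h2
    have habd : a * b ∣ 2 ^ f + 1 := ((Nat.coprime_primes ha hb).2 hab).mul_dvd_of_dvd_of_dvd had hbd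
    refine graph_final G h4 h7 _ a b c (fun n => ?_) hbip hoddcyc hab
      ⟨m2, hm2, by rw [hq] at d2; exact habd.trans d2⟩ ?_
    · rw [mem_pf hf hcS2]
      constructor
      · rintro ⟨hn, h | h | h⟩
        · exact Or.inl h
        · exact Or.inr (Or.inl (hcu n hn h))
        · exact Or.inr (Or.inr (hu n hn h))
      · rintro (rfl | rfl | rfl | rfl)
        · exact ⟨Nat.prime_two, Or.inl rfl⟩
        · exact ⟨hc, Or.inr (Or.inl hcd)⟩
        · exact ⟨ha, Or.inr (Or.inr had)⟩
        · exact ⟨hb, Or.inr (Or.inr hbd)⟩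
    · intro x hx hn t ht htn htG
      have hxp : x.Prime ∧ x ∣ 2 ^ f + 1 := by
        rcases hx with rfl | rfl
        · exact ⟨ha, had⟩
        · exact ⟨hb, hbd⟩
      obtain ⟨⟨m, hm, hd⟩, -⟩ := key_t hq4 (solvableRadical G) M hRM.le e hcent hc hxp.1
        (by rw [hq]; exact hcd) (by rw [hq]; exact hxp.2)
        (Or.inl (by rw [hq]; exact ar_pp h1 hc hcd)) hn ht (htS t ht htn) htG
      rw [hq] at hd
      exact ⟨m, hm, (mul_dvd_mul_left t habd).trans hd⟩
  · obtain rfl := ar_four hf h1 h2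
    obtain ⟨c, hc, hcd, hcu⟩ := single_of_card h2
    obtain ⟨a, b, ha, hb, hab, had, hbd, hu⟩ := pair_of_card h1
    have hc17 : c = 17 := by
      norm_num at hcd
      exact (Nat.prime_dvd_prime_iff_eq hc (by norm_num)).1 hcd
    have habd : a * b ∣ 2 ^ 4 - 1 := ((Nat.coprime_primes ha hb).2 hab).mul_dvd_of_dvd_of_dvd had hbd
    refine graph_final G h4 h7 _ a b c (fun n => ?_) hbip hoddcyc hab
      ⟨m1, hm1, by rw [hq] at d1; exact habd.trans d1⟩ ?_
    · rw [mem_pf hf hcS2]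
      constructor
      · rintro ⟨hn, h | h | h⟩
        · exact Or.inl h
        · exact Or.inr (Or.inr (hu n hn h))
        · exact Or.inr (Or.inl (hcu n hn h))
      · rintro (rfl | h | rfl | rfl)
        · exact ⟨Nat.prime_two, Or.inl rfl⟩
        · rw [h]; exact ⟨hc, Or.inr (Or.inr hcd)⟩
        · exact ⟨ha, Or.inr (Or.inl had)⟩
        · exact ⟨hb, Or.inr (Or.inl hbd)⟩
    · intro x hx hn t ht htn htG
      have hxp : x.Prime ∧ x ∣ 2 ^ 4 - 1 := by
        rcases hx with rfl | rfl
        · exact ⟨ha, had⟩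
        · exact ⟨hb, hbd⟩
      obtain ⟨-, h16⟩ := key_t hq4 (solvableRadical G) M hRM.le e hcent hxp.1 hc
        (by rw [hq]; exact hxp.2) (by rw [hq]; exact hcd)
        (Or.inr ⟨by rw [hq]; norm_num, hc17⟩) (fun m hm => by
          obtain ⟨n1, n2, n3⟩ := hn m hm
          exact ⟨n2, n1, by rwa [mul_comm]⟩) ht (htS t ht htn) htG
      obtain ⟨m, hm, hd⟩ := h16 (by rw [hq]; norm_num)
      rw [hq] at hd
      exact ⟨m, hm, (mul_dvd_mul_left t habd).trans hd⟩
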